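/- arXiv:2203.01709 — 8 statements merged into one kernel-verified Lean document; each statement's English description precedes it below -/
import Mathlib

section
/- Let F be a field of characteristic 0 and let Φ : M_n(F) → M_k(F) be a multiplicative map. Then there exists an invertible matrix S ∈ GL(k,F) such that, setting s = rank(Φ(0)) and l = rank(Φ(I_n)) − rank(Φ(0)), for every A ∈ M_n(F) there is a matrix Ã ∈ M_l(F) with S·Φ(A)·S⁻¹ equal to the block-diagonal matrix diag(Ã, 0_{k−l−s}, I_s) (an l×l block Ã, followed by a (k−l−s)×(k−l−s) zero block, followed by the s×s identity block). -/
open Matrix in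
/-- Rank factorization of an idempotent matrix. -/
theorem IsIdempotentElem.exists_matrix_rank_factorization {F : Type*} [Field F] {k : ℕ}
    {E : Matrix (Fin k) (Fin k) F} (hE : IsIdempotentElem E) :
    ∃ (X : Matrix (Fin k) (Fin E.rank) F) (Y : Matrix (Fin E.rank) (Fin k) F),
      X * Y = E ∧ Y * X = 1 := by
  let f := Matrix.toLin' E
  have hr : Module.finrank F (LinearMap.range f) = E.rank := rfl
  let b : Module.Basis (Fin E.rank) F (LinearMap.range f) := Module.finBasisOfFinrankEq F _ hr
  let c := Pi.basisFun F (Fin k)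
  refine ⟨LinearMap.toMatrix b c (LinearMap.range f).subtype,
    LinearMap.toMatrix c b f.rangeRestrict, ?_, ?_⟩
  · rw [← LinearMap.toMatrix_comp c b c, LinearMap.subtype_comp_codRestrict]
    exact LinearMap.toMatrix'_toLin' E
  · rw [← LinearMap.toMatrix_comp b c b]
    convert LinearMap.toMatrix_id b
    ext1 ⟨x, y, rfl⟩
    apply Subtype.ext
    change E *ᵥ (E *ᵥ y) = E *ᵥ y
    rw [mulVec_mulVec, hE.eq]

/-- In characteristic zero, the rank of an idempotent matrix is its trace. -/
theorem IsIdempotentElem.natCast_matrix_rank {F : Type*} [Field F] {k : ℕ}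
    {E : Matrix (Fin k) (Fin k) F} (hE : IsIdempotentElem E) :
    (E.rank : F) = E.trace := by
  obtain ⟨X, Y, h, h'⟩ := hE.exists_matrix_rank_factorization
  rw [← congrArg Matrix.trace h, Matrix.trace_mul_comm, h', Matrix.trace_one, Fintype.card_fin]


/-- Let `F` be a field of characteristic 0 and
`Φ : M_n(F) → M_k(F)` a multiplicative map. Then there is an invertible
`S ∈ GL(k,F)` such that, with `s = rank Φ(0)` and `l = rank Φ(I) − rank Φ(0)`,
for every `A` there is `Ã ∈ M_l(F)` with `S · Φ(A) · S⁻¹ = diag(Ã, 0, I_s)`. -/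
theorem multiplicative_map_block_form {F : Type*} [Field F] [CharZero F] {n k : ℕ}
    (Φ : Matrix (Fin n) (Fin n) F → Matrix (Fin k) (Fin k) F)
    (hmul : ∀ A B, Φ (A * B) = Φ A * Φ B) :
    ∃ S : (Matrix (Fin k) (Fin k) F)ˣ,
      ∀ A : Matrix (Fin n) (Fin n) F,
        ∃ Atil : Matrix (Fin ((Φ 1).rank - (Φ 0).rank)) (Fin ((Φ 1).rank - (Φ 0).rank)) F,
          ∀ i j : Fin k,
            ((S : Matrix (Fin k) (Fin k) F) * Φ A * ((S⁻¹ : (Matrix (Fin k) (Fin k) F)ˣ) : Matrix (Fin k) (Fin k) F)) i j =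
              if hi : (i : ℕ) < (Φ 1).rank - (Φ 0).rank then
                (if hj : (j : ℕ) < (Φ 1).rank - (Φ 0).rank then Atil ⟨i, hi⟩ ⟨j, hj⟩ else 0)
              else
                (if i = j ∧ k - (Φ 0).rank ≤ (i : ℕ) then 1 else 0) := by
  have hPP : Φ 0 * Φ 0 = Φ 0 := by rw [← hmul, mul_zero]
  have hQQ : Φ 1 * Φ 1 = Φ 1 := by rw [← hmul, mul_one]
  have hAP (A) : Φ A * Φ 0 = Φ 0 := by rw [← hmul, mul_zero]
  have hPA (A) : Φ 0 * Φ A = Φ 0 := by rw [← hmul, zero_mul]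
  have hAQ (A) : Φ A * Φ 1 = Φ A := by rw [← hmul, mul_one]
  have hQA (A) : Φ 1 * Φ A = Φ A := by rw [← hmul, one_mul]
  have hD : IsIdempotentElem (Φ 1 - Φ 0) := by
    simp [IsIdempotentElem, mul_sub, sub_mul, hPP, hQQ, hAP, hPA]
  have hC : IsIdempotentElem (1 - Φ 1) := IsIdempotentElem.one_sub hQQ
  have hPi : IsIdempotentElem (Φ 0) := hPP
  have hQi : IsIdempotentElem (Φ 1) := hQQ
  have hl : (Φ 1 - Φ 0).rank + (Φ 0).rank = (Φ 1).rank := by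
    apply Nat.cast_injective (R := F)
    push_cast
    rw [hD.natCast_matrix_rank, hPi.natCast_matrix_rank, hQi.natCast_matrix_rank,
      Matrix.trace_sub, sub_add_cancel]
  have hm : (1 - Φ 1).rank + (Φ 1).rank = k := by
    apply Nat.cast_injective (R := F)
    push_cast
    rw [hC.natCast_matrix_rank, hQi.natCast_matrix_rank, Matrix.trace_sub, sub_add_cancel,
      Matrix.trace_one, Fintype.card_fin]
  obtain ⟨X₁, Y₁, h₁, h₁'⟩ := hD.exists_matrix_rank_factorization
  obtain ⟨X₂, Y₂, h₂, h₂'⟩ := hC.exists_matrix_rank_factorization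
  obtain ⟨X₃, Y₃, h₃, h₃'⟩ := hPi.exists_matrix_rank_factorization
  have hl' : (Φ 1).rank - (Φ 0).rank = (Φ 1 - Φ 0).rank := by omega
  rw [hl']
  generalize (Φ 1 - Φ 0).rank = l at *
  generalize (1 - Φ 1).rank = m at *
  generalize (Φ 0).rank = s at *
  have hk : l + (m + s) = k := by omega
  have hX₁ : (Φ 1 - Φ 0) * X₁ = X₁ := by rw [← h₁, Matrix.mul_assoc, h₁', Matrix.mul_one]
  have hX₂ : (1 - Φ 1) * X₂ = X₂ := by rw [← h₂, Matrix.mul_assoc, h₂', Matrix.mul_one]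
  have hX₃ : Φ 0 * X₃ = X₃ := by rw [← h₃, Matrix.mul_assoc, h₃', Matrix.mul_one]
  have hY₁ : Y₁ * (Φ 1 - Φ 0) = Y₁ := by rw [← h₁, ← Matrix.mul_assoc, h₁', Matrix.one_mul]
  have hY₂ : Y₂ * (1 - Φ 1) = Y₂ := by rw [← h₂, ← Matrix.mul_assoc, h₂', Matrix.one_mul]
  let e : Fin l ⊕ (Fin m ⊕ Fin s) ≃ Fin k :=
    ((Equiv.sumCongr (Equiv.refl _) finSumFinEquiv).trans finSumFinEquiv).trans (finCongr hk)
  let T₀ : Matrix (Fin k) (Fin l ⊕ (Fin m ⊕ Fin s)) F := Matrix.fromCols X₁ (Matrix.fromCols X₂ X₃)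
  let S₀ : Matrix (Fin l ⊕ (Fin m ⊕ Fin s)) (Fin k) F := Matrix.fromRows Y₁ (Matrix.fromRows Y₂ Y₃)
  let S : Matrix (Fin k) (Fin k) F := S₀.submatrix e.symm id
  let T : Matrix (Fin k) (Fin k) F := T₀.submatrix id e.symm
  have hTS : T * S = 1 := by
    rw [Matrix.submatrix_mul_equiv, Matrix.submatrix_id_id, Matrix.fromCols_mul_fromRows,
      Matrix.fromCols_mul_fromRows, h₁, h₂, h₃]
    abel
  have hST : S * T = 1 := _root_.mul_eq_one_comm.mp hTS
  have hΦX₂ (A) : Φ A * X₂ = 0 := by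
    rw [← hX₂, ← Matrix.mul_assoc, mul_sub, mul_one, hAQ, sub_self, Matrix.zero_mul]
  have hΦX₃ (A) : Φ A * X₃ = X₃ := by
    rw [← hX₃, ← Matrix.mul_assoc, hAP]
  have hY₂Φ (A) : Y₂ * Φ A = 0 := by
    rw [← hY₂, Matrix.mul_assoc, sub_mul, one_mul, hQA, sub_self, Matrix.mul_zero]
  have hY₁P : Y₁ * Φ 0 = 0 := by
    rw [← hY₁, Matrix.mul_assoc, sub_mul, hAP, hPP, sub_self, Matrix.mul_zero]
  have hY₁X₃ : Y₁ * X₃ = 0 := by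
    rw [← hX₃, ← Matrix.mul_assoc, hY₁P, Matrix.zero_mul]
  have hY₂X₃ : Y₂ * X₃ = 0 := by
    rw [← hX₃, ← Matrix.mul_assoc, hY₂Φ, Matrix.zero_mul]
  have hY₃Φ (A) : Y₃ * Φ A = Y₃ := by
    have hY₃ : Y₃ * Φ 0 = Y₃ := by rw [← h₃, ← Matrix.mul_assoc, h₃', Matrix.one_mul]
    rw [← hY₃, Matrix.mul_assoc, hPA]
  have hY₃X₁ : Y₃ * X₁ = 0 := by
    rw [← hX₁, ← Matrix.mul_assoc, Matrix.mul_sub, hY₃Φ, hY₃Φ, sub_self, Matrix.zero_mul]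
  have hY₃X₂ : Y₃ * X₂ = 0 := by
    rw [← hY₃Φ 1, Matrix.mul_assoc, hΦX₂, Matrix.mul_zero]
  refine ⟨⟨S, T, hST, hTS⟩, fun A ↦ ⟨Y₁ * Φ A * X₁, fun i j ↦ ?_⟩⟩
  have hblock : S₀ * Φ A * T₀ = Matrix.fromBlocks (Y₁ * Φ A * X₁) 0 0
      (Matrix.fromBlocks 0 0 0 1) := by
    simp only [S₀, T₀, Matrix.fromRows_mul, Matrix.mul_fromCols, hY₂Φ, hY₃Φ, hY₃X₁, hY₃X₂, h₃',
      Matrix.mul_assoc Y₁, hΦX₂, hΦX₃, hY₁X₃, Matrix.zero_mul, Matrix.mul_zero]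
    ext (i | i | i) (j | j | j) <;> simp
  have hSAT : S * Φ A * T = (S₀ * Φ A * T₀).submatrix e.symm e.symm := rfl
  change (S * Φ A * T) i j = _
  rw [hSAT, hblock]
  obtain ⟨i, rfl⟩ := e.surjective i
  obtain ⟨j, rfl⟩ := e.surjective j
  rcases i with i | i | i <;> rcases j with j | j | j <;>
    simp [e, Matrix.one_apply, Fin.ext_iff] <;> have hi := i.isLt <;> have hj := j.isLt
  any_goals omega
  congr 1
  exact propext ⟨fun h ↦ ⟨h, by omega⟩, And.left⟩
end

section
/- Let F be a field of characteristic 0 and let n, k be positive integers with k < n. Every multiplicative map Φ : M_n(F) → M_k(F) with Φ(0) = 0 and Φ(I_n) = I_k is trivial; that is, Φ(A) = I_k for every A ∈ M_n(F) with det A = 1. -/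
open Matrix Finset

theorem Nat.le_choose_of_pos_of_lt {n j : ℕ} (hj : 0 < j) (hjn : j < n) :
    n ≤ n.choose j := by
  induction n generalizing j with
  | zero => omega
  | succ n ih =>
    obtain ⟨j, rfl⟩ := Nat.exists_eq_succ_of_ne_zero hj.ne'
    rw [Nat.succ_eq_add_one, Nat.choose_succ_succ]
    have hpos : 0 < n.choose j := Nat.choose_pos (by omega)
    rcases Nat.lt_or_ge (j + 1) n with h | h
    · have := ih (Nat.succ_pos j) h
      simp only [Nat.succ_eq_add_one] at *
      omega
    · obtain rfl : n = j + 1 := by omega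
      simp

namespace Matrix

section SignChar

variable {ι F : Type*} [Field F]

/-- The sign character of `ι → ℤˣ` attached to a finite set `S` of indices. -/
def signChar (F : Type*) [Field F] (S : Finset ι) (ε : ι → ℤˣ) : F :=
  ∏ i ∈ S, ((ε i : ℤ) : F)

theorem signChar_mul (S : Finset ι) (ε η : ι → ℤˣ) :
    signChar F S (ε * η) = signChar F S ε * signChar F S η := by
  simp [signChar, prod_mul_distrib]

theorem signChar_mul_self (S : Finset ι) (ε : ι → ℤˣ) :
    signChar F S ε * signChar F S ε = 1 := by
  rw [← signChar_mul]
  refine prod_eq_one fun i _ => ?_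
  simp

theorem signChar_map (S : Finset ι) (σ : Equiv.Perm ι) (ε : ι → ℤˣ) :
    signChar F (S.map σ.toEmbedding) ε = signChar F S (ε ∘ σ) := by
  simp [signChar]

theorem sum_signChar [Fintype ι] (ε : ι → ℤˣ) :
    ∑ S : Finset ι, signChar F S ε = if ε = 1 then 2 ^ Fintype.card ι else 0 := by
  have h : ∑ S : Finset ι, signChar F S ε = ∏ i, (1 + ((ε i : ℤ) : F)) := by
    rw [prod_one_add, powerset_univ]
    rfl
  rw [h]
  split_ifs with hε
  · subst hε
    norm_num
  · obtain ⟨i, hi⟩ := Function.ne_iff.mp hε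
    refine prod_eq_zero (mem_univ i) ?_
    rcases Int.units_eq_one_or (ε i) with h | h
    · exact absurd h hi
    · simp [h]

end SignChar

section SignMatrix

variable {ι F : Type*} [DecidableEq ι] [Field F]

theorem diagonal_mulSingle (i : ι) (a : F) :
    diagonal (Pi.mulSingle i a) = 1 + single i i (a - 1) := by
  ext b c
  by_cases hb : b = c
  · subst hb
    by_cases hi : b = i
    · subst hi; simp
    · simp [hi, Ne.symm hi]
  · have h : ¬(i = b ∧ i = c) := fun h => hb (h.1.symm.trans h.2)
    simp [hb, h]

/-- The diagonal matrix whose diagonal entries are the given signs. -/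
def signMatrix (F : Type*) [Field F] (ε : ι → ℤˣ) : Matrix ι ι F :=
  diagonal fun i => ((ε i : ℤ) : F)

theorem signMatrix_one : signMatrix F (1 : ι → ℤˣ) = 1 := by
  simp [signMatrix]

variable [Fintype ι]

theorem diagonal_mul_single (d : ι → F) (i j : ι) (t : F) :
    diagonal d * single i j t = single i j (d i * t) := by
  ext a b
  simp only [diagonal_mul, single_apply]
  split_ifs with h
  · rw [h.1]
  · simp

theorem single_mul_diagonal (d : ι → F) (i j : ι) (t : F) :
    single i j t * diagonal d = single i j (t * d j) := by
  ext a b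
  simp only [mul_diagonal, single_apply]
  split_ifs with h
  · rw [h.2]
  · simp

theorem signMatrix_mul (ε η : ι → ℤˣ) :
    signMatrix F (ε * η) = signMatrix F ε * signMatrix F η := by
  simp [signMatrix]

theorem signMatrix_mul_self (ε : ι → ℤˣ) : signMatrix F ε * signMatrix F ε = 1 := by
  rw [← signMatrix_mul, ← signMatrix_one]
  congr 1
  ext i
  simp

theorem signMatrix_mul_transvection {i j : ι} (ε : ι → ℤˣ) (hi : ε i = -1) (hj : ε j = 1)
    (t : F) :
    signMatrix F ε * transvection i j t = transvection i j (-t) * signMatrix F ε := by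
  simp only [signMatrix, transvection, mul_add, add_mul, mul_one, one_mul, diagonal_mul_single,
    single_mul_diagonal, hi, hj]
  simp

theorem permMatrix_mul_signMatrix (σ : Equiv.Perm ι) (ε : ι → ℤˣ) :
    σ.permMatrix F * signMatrix F ε = signMatrix F (ε ∘ σ) * σ.permMatrix F := by
  ext i j
  simp only [signMatrix, mul_diagonal, diagonal_mul, Equiv.Perm.permMatrix,
    PEquiv.toMatrix_apply, Equiv.toPEquiv_apply, Option.mem_some_iff, Function.comp_apply]
  split_ifs with h
  · simp [h]
  · simp

end SignMatrix

section WeightProjection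

variable {ι κ F : Type*} [Fintype ι] [DecidableEq ι] [Fintype κ] [DecidableEq κ] [Field F]
  (Φ : Matrix ι ι F →* Matrix κ κ F)

/-- The projection onto the simultaneous eigenspace of the matrices `Φ (signMatrix F ε)` on which
they act through the character `signChar F S`. -/
def weightProj (S : Finset ι) : Matrix κ κ F :=
  ((2 : F) ^ Fintype.card ι)⁻¹ • ∑ ε : ι → ℤˣ, signChar F S ε • Φ (signMatrix F ε)

theorem map_signMatrix_mul_weightProj (S : Finset ι) (ε : ι → ℤˣ) :
    Φ (signMatrix F ε) * weightProj Φ S = signChar F S ε • weightProj Φ S := by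
  rw [weightProj, mul_smul_comm, smul_comm]
  congr 1
  rw [mul_sum, smul_sum]
  refine Fintype.sum_equiv (Equiv.mulLeft ε) _ _ fun η => ?_
  rw [Equiv.coe_mulLeft, signChar_mul, signMatrix_mul, map_mul, smul_smul, ← mul_assoc,
    signChar_mul_self, one_mul, mul_smul_comm]

theorem sum_weightProj [CharZero F] : ∑ S : Finset ι, weightProj Φ S = 1 := by
  simp only [weightProj]
  rw [← smul_sum, sum_comm]
  simp only [← sum_smul, sum_signChar, ite_smul, zero_smul, sum_ite_eq', mem_univ, if_true]
  rw [smul_smul, inv_mul_cancel₀ (pow_ne_zero _ two_ne_zero), one_smul, signMatrix_one, map_one]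

theorem isIdempotentElem_weightProj [CharZero F] (S : Finset ι) :
    IsIdempotentElem (weightProj Φ S) := by
  have h : weightProj Φ S * weightProj Φ S = ((2 : F) ^ Fintype.card ι)⁻¹ •
      ∑ ε : ι → ℤˣ, signChar F S ε • (Φ (signMatrix F ε) * weightProj Φ S) := by
    conv_lhs => enter [1]; rw [weightProj]
    simp only [smul_mul_assoc, sum_mul]
  rw [IsIdempotentElem, h]
  simp only [map_signMatrix_mul_weightProj, smul_smul, signChar_mul_self, one_smul, sum_const]
  rw [card_univ, Fintype.card_fun, Fintype.card_units_int, ← Nat.cast_smul_eq_nsmul F, smul_smul,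
    Nat.cast_pow, Nat.cast_ofNat, inv_mul_cancel₀ (pow_ne_zero _ two_ne_zero), one_smul]

theorem trace_map_signMatrix_comp (σ : Equiv.Perm ι) (ε : ι → ℤˣ) :
    (Φ (signMatrix F (ε ∘ σ))).trace = (Φ (signMatrix F ε)).trace := by
  have hσ : σ.permMatrix F * σ⁻¹.permMatrix F = 1 := by
    rw [← permMatrix_mul, inv_mul_cancel, permMatrix_one]
  have hσ' : σ⁻¹.permMatrix F * σ.permMatrix F = 1 := by
    rw [← permMatrix_mul, mul_inv_cancel, permMatrix_one]
  have h : signMatrix F (ε ∘ σ) = σ.permMatrix F * signMatrix F ε * σ⁻¹.permMatrix F := by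
    rw [permMatrix_mul_signMatrix, mul_assoc, hσ, mul_one]
  rw [h, map_mul, map_mul, trace_mul_cycle, ← map_mul, hσ', map_one, one_mul]

theorem trace_weightProj_map (S : Finset ι) (σ : Equiv.Perm ι) :
    (weightProj Φ (S.map σ.toEmbedding)).trace = (weightProj Φ S).trace := by
  simp only [weightProj, trace_smul, trace_sum, signChar_map]
  congr 1
  refine Fintype.sum_equiv (σ.symm.arrowCongr (Equiv.refl ℤˣ)) _ _ fun ε => ?_
  have h : σ.symm.arrowCongr (Equiv.refl ℤˣ) ε = ε ∘ σ := rfl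
  rw [h, trace_map_signMatrix_comp]

theorem trace_weightProj_eq_of_card_eq {S T : Finset ι} (h : #S = #T) :
    (weightProj Φ S).trace = (weightProj Φ T).trace := by
  let σ : Equiv.Perm ι := (Finset.equivOfCardEq h).extendSubtype
  have hσ : S.map σ.toEmbedding = T := by
    refine eq_of_subset_of_card_le (fun x hx => ?_) (by rw [card_map, h])
    obtain ⟨y, hy, rfl⟩ := mem_map.mp hx
    exact (Finset.equivOfCardEq h).extendSubtype_mem y hy
  rw [← hσ, trace_weightProj_map]

end WeightProjection

/-- The trace of an idempotent matrix is its rank. -/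
theorem trace_eq_rank_of_isIdempotentElem {κ F : Type*} [Fintype κ] [DecidableEq κ] [Field F]
    {P : Matrix κ κ F} (hP : IsIdempotentElem P) : P.trace = P.rank := by
  have h : IsIdempotentElem (toLin' P) := by
    rw [IsIdempotentElem, Module.End.mul_eq_comp, ← toLin'_mul, hP]
  rw [← trace_toLin'_eq, (LinearMap.IsIdempotentElem.isProj_range _ h).trace]
  rfl

section Diagonal

variable {ι κ F : Type*} [Fintype ι] [DecidableEq ι] [Fintype κ] [DecidableEq κ] [Field F]
  (Φ : Matrix ι ι F →* Matrix κ κ F)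

/-- A diagonal entry can be moved along the diagonal by conjugating with transvections. -/
theorem map_diagonal_mulSingle_eq (h : ∀ i j : ι, i ≠ j → ∀ t : F, Φ (transvection i j t) = 1)
    (i j : ι) (a : F) : Φ (diagonal (Pi.mulSingle i a)) = Φ (diagonal (Pi.mulSingle j a)) := by
  rcases eq_or_ne i j with rfl | hij
  · rfl
  have key : diagonal (Pi.mulSingle i a) *
        (transvection i j 1 * transvection j i (-1) * transvection i j 1)
      = (transvection i j 1 * transvection j i (-1) * transvection i j 1) *
        diagonal (Pi.mulSingle j a) := by
    simp only [transvection, diagonal_mulSingle]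
    simp [mul_add, add_mul, hij, hij.symm, sub_eq_add_neg, single_add, ← single_neg]
    abel
  have := congrArg Φ key
  simpa only [map_mul, h i j hij, h j i hij.symm, mul_one, one_mul] using this

theorem map_diagonal_eq_one (h : ∀ i j : ι, i ≠ j → ∀ t : F, Φ (transvection i j t) = 1)
    {D : ι → F} (hD : ∏ i, D i = 1) : Φ (diagonal D) = 1 := by
  cases isEmpty_or_nonempty ι
  · rw [Subsingleton.elim (diagonal D) 1, map_one]
  obtain ⟨i₀⟩ := ‹Nonempty ι›
  have key (s : Finset ι) : Φ (diagonal (∏ i ∈ s, Pi.mulSingle i (D i)))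
      = Φ (diagonal (Pi.mulSingle i₀ (∏ i ∈ s, D i))) := by
    induction s using Finset.induction_on with
    | empty => simp
    | insert i s hi ih =>
      have hmul (d e : ι → F) : Φ (diagonal (d * e)) = Φ (diagonal d) * Φ (diagonal e) := by
        rw [← map_mul, diagonal_mul_diagonal]
        rfl
      rw [prod_insert hi, prod_insert hi, Pi.mulSingle_mul, hmul, hmul, ih,
        map_diagonal_mulSingle_eq Φ h i i₀]
  have h1 := key univ
  rw [Finset.univ_prod_mulSingle, hD, Pi.mulSingle_one] at h1
  rw [h1, Pi.one_def, diagonal_one, map_one]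

end Diagonal

section Triviality

variable {ι κ F : Type*} [Fintype ι] [DecidableEq ι] [Fintype κ] [DecidableEq κ] [Field F]
  [CharZero F] (Φ : Matrix ι ι F →* Matrix κ κ F)

theorem weightProj_eq_zero (hcard : Fintype.card κ < Fintype.card ι) {S : Finset ι}
    (hS : S.Nonempty) (hS' : S ≠ univ) : weightProj Φ S = 0 := by
  have hrank (T : Finset ι) : (weightProj Φ T).trace = (weightProj Φ T).rank :=
    trace_eq_rank_of_isIdempotentElem (isIdempotentElem_weightProj Φ T)
  have hsum : ∑ T : Finset ι, (weightProj Φ T).rank = Fintype.card κ := by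
    have h := congrArg trace (sum_weightProj Φ)
    simp only [trace_sum, hrank, trace_one] at h
    exact_mod_cast h
  have hlevel : ∑ T ∈ powersetCard #S univ, (weightProj Φ T).rank
      = (Fintype.card ι).choose #S * (weightProj Φ S).rank := by
    rw [sum_congr rfl (g := fun _ => (weightProj Φ S).rank), sum_const, card_powersetCard,
      card_univ, smul_eq_mul]
    intro T hT
    have h := trace_weightProj_eq_of_card_eq Φ (mem_powersetCard.mp hT).2
    rw [hrank, hrank] at h
    exact_mod_cast h
  have hle : ∑ T ∈ powersetCard #S univ, (weightProj Φ T).rank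
      ≤ ∑ T : Finset ι, (weightProj Φ T).rank :=
    sum_le_sum_of_subset (subset_univ _)
  have hchoose : Fintype.card ι ≤ (Fintype.card ι).choose #S :=
    Nat.le_choose_of_pos_of_lt hS.card_pos (card_lt_iff_ne_univ S |>.mpr hS')
  have hzero : (weightProj Φ S).rank = 0 := by
    by_contra h
    have := Nat.le_mul_of_pos_right ((Fintype.card ι).choose #S) (Nat.pos_of_ne_zero h)
    omega
  rw [rank, Submodule.finrank_eq_zero, LinearMap.range_eq_bot] at hzero
  exact toLin'.injective (hzero.trans (map_zero toLin').symm)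

theorem map_signMatrix_eq_one (hcard : Fintype.card κ < Fintype.card ι) {ε : ι → ℤˣ}
    (hε : ∏ i, ε i = 1) : Φ (signMatrix F ε) = 1 := by
  rw [← mul_one (Φ _), ← sum_weightProj Φ, mul_sum]
  refine sum_congr rfl fun S _ => ?_
  rw [map_signMatrix_mul_weightProj]
  rcases S.eq_empty_or_nonempty with rfl | hS
  · simp [signChar]
  · by_cases hS' : S = univ
    · have h : signChar F univ ε = ((((∏ i, ε i : ℤˣ) : ℤ)) : F) := by
        simp [signChar]
      rw [hS', h, hε]
      simp
    · rw [weightProj_eq_zero Φ hcard hS hS', smul_zero]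

theorem map_transvection_eq_one_of_commute {i j : ι} (hij : i ≠ j) (ε : ι → ℤˣ) (hi : ε i = -1)
    (hj : ε j = 1) (h : ∀ t, Commute (Φ (signMatrix F ε)) (Φ (transvection i j t))) (t : F) :
    Φ (transvection i j t) = 1 := by
  have hneg (t : F) : Φ (transvection i j t) = Φ (transvection i j (-t)) := by
    have h1 : Φ (transvection i j t) * Φ (signMatrix F ε)
        = Φ (transvection i j (-t)) * Φ (signMatrix F ε) := by
      rw [← (h t).eq, ← map_mul, signMatrix_mul_transvection ε hi hj, map_mul]
    have h2 := congrArg (· * Φ (signMatrix F ε)) h1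
    simpa only [mul_assoc, ← map_mul Φ (signMatrix F ε), signMatrix_mul_self, map_one, mul_one]
      using h2
  rw [← add_halves t, ← transvection_mul_transvection_same i j hij, map_mul]
  nth_rw 2 [hneg]
  rw [← map_mul, transvection_mul_transvection_same i j hij, add_neg_cancel, transvection_zero,
    map_one]

theorem map_transvection_eq_one (hcard : Fintype.card κ < Fintype.card ι) {i j : ι} (hij : i ≠ j)
    (t : F) : Φ (transvection i j t) = 1 := by
  by_cases hl : ∃ l, l ≠ i ∧ l ≠ j
  · obtain ⟨l, hli, hlj⟩ := hl
    have hε : Φ (signMatrix F (Pi.mulSingle i (-1) * Pi.mulSingle l (-1))) = 1 :=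
      map_signMatrix_eq_one Φ hcard (by simp [prod_mul_distrib])
    refine map_transvection_eq_one_of_commute Φ hij
      (Pi.mulSingle i (-1) * Pi.mulSingle l (-1)) ?_ ?_ (fun t => ?_) t
    · simp [hli.symm]
    · simp [hij.symm, hlj.symm]
    · rw [hε]
      exact Commute.one_left _
  · have hι : Fintype.card ι ≤ 2 := by
      have h : (univ : Finset ι) ⊆ {i, j} := fun l _ => by
        by_contra hl'
        exact hl ⟨l, by simpa using hl'⟩
      exact (card_le_card h).trans card_le_two
    have : Subsingleton κ := Fintype.card_le_one_iff_subsingleton.mp (by omega)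
    refine map_transvection_eq_one_of_commute Φ hij (Pi.mulSingle i (-1)) ?_ ?_ (fun t => ?_) t
    · simp
    · simp [hij.symm]
    · ext a b
      obtain rfl := Subsingleton.elim a b
      simp [mul_apply, mul_comm, Subsingleton.elim _ a]

theorem map_eq_one_of_det_eq_one (hcard : Fintype.card κ < Fintype.card ι) {A : Matrix ι ι F}
    (hA : A.det = 1) : Φ A = 1 := by
  have h (i j : ι) (hij : i ≠ j) (t : F) : Φ (transvection i j t) = 1 :=
    map_transvection_eq_one Φ hcard hij t
  refine diagonal_transvection_induction (fun B => Φ B = 1) A (fun D hD => ?_) (fun t => ?_)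
    fun B C hB hC => ?_
  · exact map_diagonal_eq_one Φ h (by rw [← det_diagonal, hD, hA])
  · exact h t.i t.j t.hij t.c
  · rw [map_mul, hB, hC, one_mul]

end Triviality

end Matrix

/-- For `k < n`, every multiplicative map `Φ : M_n(F) → M_k(F)`
with `Φ(0) = 0` and `Φ(I_n) = I_k` is trivial, i.e. `Φ(A) = I_k` whenever `det A = 1`. -/
theorem multiplicative_map_to_smaller_is_trivial {F : Type*} [Field F] [CharZero F]
    {n k : ℕ} (hn : 0 < n) (hk : 0 < k) (hkn : k < n)
    (Φ : Matrix (Fin n) (Fin n) F → Matrix (Fin k) (Fin k) F)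
    (hmul : ∀ A B, Φ (A * B) = Φ A * Φ B)
    (h0 : Φ 0 = 0) (h1 : Φ 1 = 1) :
    ∀ A : Matrix (Fin n) (Fin n) F, A.det = 1 → Φ A = 1 := by
  intro A hA
  let Ψ : Matrix (Fin n) (Fin n) F →* Matrix (Fin k) (Fin k) F :=
    { toFun := Φ, map_one' := h1, map_mul' := hmul }
  exact Matrix.map_eq_one_of_det_eq_one Ψ (by simpa using hkn) hA
end

section
/- Let F be a field of characteristic 0, let n, k be positive integers with k < n, and let Φ : M_n(F) → M_k(F) be a multiplicative map with Φ(0) = 0 and Φ(I_n) = I_k. Then there exists a map f : F → M_k(F) with f(xy) = f(x)f(y) for all x, y ∈ F, f(1) = I_k and f(0) = 0, such that Φ(A) = f(det A) for every A ∈ M_n(F). -/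
open Module

/-- A nonconstant function has at least as many distinct translates under transpositions as its
domain has elements. -/
theorem exists_injective_comp_swap {ι α : Type*} [DecidableEq ι] {ε : ι → α} {i j : ι}
    (hij : ε i ≠ ε j) (hε : ∀ x, ε x = ε i ∨ ε x = ε j) :
    ∃ p q : ι → ι, Function.Injective fun x => ε ∘ Equiv.swap (p x) (q x) := by
  classical
  refine ⟨id, fun x => if x = i then i else if ε x = ε i then j else i, fun x y hxy => ?_⟩
  by_contra hne
  have hx := congrFun hxy x
  have hy := congrFun hxy y
  have hi := congrFun hxy i
  have hj := congrFun hxy j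
  have h1 := hε x
  have h2 := hε y
  simp only [Function.comp_apply, Equiv.swap_apply_def, id] at hx hy hi hj
  grind

section
variable {F V ι : Type*} [Field F] [AddCommGroup V] [Module F V]

/-- Commuting endomorphisms annihilated by `(X - a) * (X - b)` have a common eigenvector in every
nonzero invariant submodule. -/
theorem exists_common_eigenvector [Fintype ι] {J : ι → End F V} {a b : F}
    (hcomm : ∀ i j v, J i (J j v) = J j (J i v))
    (hJ : ∀ i v, J i (J i v) = (a + b) • J i v - (a * b) • v)
    {W : Submodule F V} (hW : ∀ i, ∀ v ∈ W, J i v ∈ W) (hne : W ≠ ⊥) :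
    ∃ v ∈ W, v ≠ 0 ∧ ∃ ε : ι → F, ∀ i, (ε i = a ∨ ε i = b) ∧ J i v = ε i • v := by
  classical
  suffices H : ∀ s : Finset ι, ∃ v ∈ W, v ≠ 0 ∧
      ∀ i ∈ s, J i v = a • v ∨ J i v = b • v by
    obtain ⟨v, hv, hv0, h⟩ := H Finset.univ
    refine ⟨v, hv, hv0, fun i => if J i v = a • v then a else b, fun i => ?_⟩
    have := h i (Finset.mem_univ i)
    dsimp only
    split_ifs with hi
    · exact ⟨Or.inl rfl, hi⟩
    · exact ⟨Or.inr rfl, this.resolve_left hi⟩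
  intro s
  induction s using Finset.induction_on with
  | empty =>
    obtain ⟨v, hv, hv0⟩ := W.exists_mem_ne_zero_of_ne_bot hne
    exact ⟨v, hv, hv0, by simp⟩
  | insert i s _ ih =>
    obtain ⟨v, hv, hv0, h⟩ := ih
    by_cases hi : J i v = b • v
    · exact ⟨v, hv, hv0, by simpa [hi] using h⟩
    · refine ⟨J i v - b • v, W.sub_mem (hW i v hv) (W.smul_mem b hv), sub_ne_zero.2 hi, ?_⟩
      intro j hj
      rcases Finset.mem_insert.1 hj with rfl | hj
      · left
        rw [map_sub, map_smul, hJ]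
        module
      · rcases h j hj with h | h
        · left
          rw [map_sub, map_smul, hcomm, h, map_smul]
          module
        · right
          rw [map_sub, map_smul, hcomm, h, map_smul]
          module

/-- If commuting endomorphisms are permuted by conjugation under all transpositions of the
indices and the dimension is less than the number of indices, then every two-valued system of
common eigenvalues is constant. -/
theorem common_eigenvalue_eq [Fintype ι] [DecidableEq ι] [FiniteDimensional F V]
    (hcard : finrank F V < Fintype.card ι) {J : ι → End F V}
    (hcomm : ∀ i j v, J i (J j v) = J j (J i v))
    {Q : ι → ι → End F V} (hQ : ∀ p q v, Q p q v = 0 → v = 0)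
    (hQJ : ∀ p q i v, J i (Q p q v) = Q p q (J (Equiv.swap p q i) v))
    {a b : F} {v : V} (hv : v ≠ 0) {ε : ι → F}
    (hε : ∀ i, (ε i = a ∨ ε i = b) ∧ J i v = ε i • v) (i j : ι) : ε i = ε j := by
  by_contra hij
  obtain ⟨p, q, hinj⟩ := exists_injective_comp_swap hij (fun x => by
    have := (hε x).1; have := (hε i).1; have := (hε j).1; grind)
  have hind := (End.independent_iInf_maxGenEigenspace_of_forall_mapsTo J fun i j φ =>
    End.mapsTo_maxGenEigenspace_of_comm (LinearMap.ext (hcomm j i)) φ).comp hinj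
  have hli := hind.linearIndependent _ (v := fun x => Q (p x) (q x) v) (fun x => by
    simp only [Function.comp_apply, Submodule.mem_iInf]
    intro k
    refine End.mem_maxGenEigenspace _ _ _ |>.2 ⟨1, ?_⟩
    simp [hQJ, (hε _).2]) (fun x h => hv (hQ _ _ _ h))
  exact absurd hli.fintype_card_le_finrank (not_le.2 hcard)

end

section
variable {F V ι : Type*} [Field F] [AddCommGroup V] [Module F V] [Fintype ι] [DecidableEq ι]

open Matrix

/-- The diagonal matrix with entry `c` at `i` and `1` elsewhere. -/
def diagonalSingle (i : ι) (c : F) : Matrix ι ι F :=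
  diagonal (Function.update 1 i c)

theorem diagonalSingle_mul (i : ι) (c d : F) :
    diagonalSingle i c * diagonalSingle i d = diagonalSingle i (c * d) := by
  simp only [diagonalSingle, diagonal_mul_diagonal]
  congr 1; ext x
  by_cases h : x = i <;> simp [h]

omit [Fintype ι] in
theorem diagonalSingle_one (i : ι) : diagonalSingle i (1 : F) = 1 := by
  rw [diagonalSingle, Function.update_eq_self_iff.2 (Pi.one_apply i).symm]
  exact diagonal_one

theorem det_diagonalSingle (i : ι) (c : F) : (diagonalSingle i c).det = c := by
  simp [diagonalSingle, det_diagonal, Finset.prod_update_of_mem]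

theorem diagonalSingle_comm (i j : ι) (c d : F) :
    diagonalSingle i c * diagonalSingle j d = diagonalSingle j d * diagonalSingle i c := by
  simp only [diagonalSingle, diagonal_mul_diagonal, mul_comm]

theorem diagonalSingle_mul_permMatrix_swap (p q i : ι) (c : F) :
    diagonalSingle i c * (Equiv.swap p q).permMatrix F =
      (Equiv.swap p q).permMatrix F * diagonalSingle (Equiv.swap p q i) c := by
  ext x y
  simp only [diagonalSingle, diagonal_mul, mul_diagonal, PEquiv.toMatrix_apply,
    Equiv.toPEquiv_apply, Option.mem_some_iff, Function.update_apply, Pi.one_apply]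
  by_cases h : Equiv.swap p q x = y
  · subst h; simp
  · simp [h]

theorem permMatrix_swap_mul_self (p q : ι) :
    (Equiv.swap p q).permMatrix F * (Equiv.swap p q).permMatrix F = 1 := by
  rw [← permMatrix_mul]; simp

/-- Among the images of commuting matrices `diagonalSingle i c`, every nonzero invariant submodule
contains a common eigenvector with the same eigenvalue for all `i`. -/
theorem exists_diagonalSingle_eigenvector [FiniteDimensional F V]
    (hcard : finrank F V < Fintype.card ι) (φ : Matrix ι ι F →* End F V) {c a b : F}
    (hc : ∀ i v, φ (diagonalSingle i c) (φ (diagonalSingle i c) v) =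
      (a + b) • φ (diagonalSingle i c) v - (a * b) • v)
    {W : Submodule F V} (hW : ∀ i, ∀ v ∈ W, φ (diagonalSingle i c) v ∈ W) (hne : W ≠ ⊥) :
    ∃ v ∈ W, v ≠ 0 ∧ ∃ e, (e = a ∨ e = b) ∧ ∀ i, φ (diagonalSingle i c) v = e • v := by
  have hcomm (i j v) : φ (diagonalSingle i c) (φ (diagonalSingle j c) v) =
      φ (diagonalSingle j c) (φ (diagonalSingle i c) v) := by
    rw [← Module.End.mul_apply, ← Module.End.mul_apply, ← map_mul, ← map_mul, diagonalSingle_comm]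
  obtain ⟨v, hvW, hv, ε, hε⟩ := exists_common_eigenvector hcomm hc hW hne
  have hconst := common_eigenvalue_eq hcard hcomm
    (Q := fun p q => φ ((Equiv.swap p q).permMatrix F))
    (fun p q v h => by
      have := congrArg (φ ((Equiv.swap p q).permMatrix F)) h
      rwa [← Module.End.mul_apply, ← map_mul, permMatrix_swap_mul_self, map_one, map_zero] at this)
    (fun p q i v => by
      rw [← Module.End.mul_apply, ← Module.End.mul_apply, ← map_mul, ← map_mul,
        diagonalSingle_mul_permMatrix_swap])
    hv hε
  obtain ⟨i⟩ : Nonempty ι := Fintype.card_pos_iff.1 (by omega)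
  exact ⟨v, hvW, hv, ε i, (hε i).1, fun j => by rw [(hε j).2, hconst j i]⟩

theorem map_diagonal_eq_prod {M : Type*} [Monoid M] (φ : Matrix ι ι F →* M) (f : F →* M)
    (hf : ∀ i x, φ (diagonalSingle i x) = f x) (d : ι → F) :
    φ (diagonal d) = f (∏ i, d i) := by
  suffices H : ∀ s : Finset ι, φ (diagonal fun i => if i ∈ s then d i else 1) =
      f (∏ i ∈ s, d i) by simpa using H Finset.univ
  intro s
  induction s using Finset.induction_on with
  | empty => simp
  | insert i s hi ih =>
    rw [Finset.prod_insert hi, map_mul, ← ih, ← hf i, ← map_mul, diagonalSingle,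
      diagonal_mul_diagonal]
    congr 2; ext x
    by_cases h : x = i
    · subst h; simp [hi]
    · simp [h]

theorem map_diagonalSingle_zero [FiniteDimensional F V]
    (hcard : finrank F V < Fintype.card ι) (φ : Matrix ι ι F →* End F V) (h0 : φ 0 = 0) (i : ι) :
    φ (diagonalSingle i 0) = 0 := by
  have hidem (j : ι) : φ (diagonalSingle j 0) * φ (diagonalSingle j 0) =
      φ (diagonalSingle j 0) := by rw [← map_mul, diagonalSingle_mul, mul_zero]
  by_contra hne
  obtain ⟨v, hvW, hv, e, -, he⟩ := exists_diagonalSingle_eigenvector hcard φ (c := 0) (a := 1)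
    (b := 0) (fun j v => by rw [← Module.End.mul_apply, hidem]; simp)
    (W := (φ (diagonalSingle i 0)).range) (fun j v ⟨w, hw⟩ => ⟨φ (diagonalSingle j 0) w, by
      rw [← hw, ← Module.End.mul_apply, ← Module.End.mul_apply, ← map_mul, ← map_mul,
        diagonalSingle_comm]⟩)
    (fun h => hne (LinearMap.range_eq_bot.1 h))
  have hfix (j : ι) : φ (diagonalSingle j 0) v = v := by
    obtain ⟨w, hw⟩ := hvW
    have : φ (diagonalSingle i 0) v = v := by rw [← hw, ← Module.End.mul_apply, hidem]
    rw [he j, ← he i, this]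
  have H (s : Finset ι) : φ (diagonal fun j => if j ∈ s then 0 else 1) v = v := by
    induction s using Finset.induction_on with
    | empty => simp
    | insert j s hj ih =>
      have : (diagonal fun k => if k ∈ insert j s then (0 : F) else 1) =
          diagonalSingle j 0 * diagonal fun k => if k ∈ s then 0 else 1 := by
        rw [diagonalSingle, diagonal_mul_diagonal]
        congr 1; ext k
        by_cases h : k = j <;> simp [h]
      rw [this, map_mul, Module.End.mul_apply, ih, hfix]
  have := H Finset.univ
  simp [h0] at this
  exact hv this.symm

theorem map_eq_zero_of_det_eq_zero {M : Type*} [MonoidWithZero M] (φ : Matrix ι ι F →* M)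
    (h : ∀ i, φ (diagonalSingle i 0) = 0) (A : Matrix ι ι F) (hA : A.det = 0) : φ A = 0 := by
  revert hA
  induction A using diagonal_transvection_induction with
  | hdiag D _ =>
    intro hA
    rw [det_diagonal, Finset.prod_eq_zero_iff] at hA
    obtain ⟨i, -, hi⟩ := hA
    have : diagonal D = diagonalSingle i 0 * diagonal D := by
      rw [diagonalSingle, diagonal_mul_diagonal]
      congr 1; ext k
      by_cases hk : k = i
      · subst hk; simp [hi]
      · simp [hk]
    rw [this, map_mul, h, zero_mul]
  | htransvec t => simp
  | hmul A B hA hB =>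
    rw [det_mul, mul_eq_zero, map_mul]
    rintro (h | h)
    · rw [hA h, zero_mul]
    · rw [hB h, mul_zero]

theorem map_diagonalSingle_neg_one_mul [FiniteDimensional F V] [NeZero (2 : F)]
    (hcard : finrank F V < Fintype.card ι) (φ : Matrix ι ι F →* End F V) (i j : ι) :
    φ (diagonalSingle i (-1) * diagonalSingle j (-1)) = 1 := by
  set K := diagonalSingle i (-1 : F) * diagonalSingle j (-1) with hK
  have hinv (k : ι) : diagonalSingle k (-1 : F) * diagonalSingle k (-1) = 1 := by
    rw [diagonalSingle_mul, neg_mul_neg, mul_one, diagonalSingle_one]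
  have hKK : K * K = 1 := by
    calc K * K = (diagonalSingle i (-1) * diagonalSingle i (-1)) *
          (diagonalSingle j (-1) * diagonalSingle j (-1)) := by
          rw [hK, mul_assoc, mul_assoc, ← mul_assoc (diagonalSingle j _),
            diagonalSingle_comm j i, mul_assoc]
      _ = 1 := by rw [hinv, hinv, mul_one]
  have hcomm (k : ι) : K * diagonalSingle k (-1) = diagonalSingle k (-1) * K := by
    rw [hK, mul_assoc, diagonalSingle_comm j k, ← mul_assoc, diagonalSingle_comm i k, mul_assoc]
  by_contra hne
  obtain ⟨v, hvW, hv, e, he', he⟩ := exists_diagonalSingle_eigenvector hcard φ (c := -1) (a := 1)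
    (b := -1) (fun k v => by rw [← Module.End.mul_apply, ← map_mul, hinv]; simp)
    (W := (φ K - 1).range) (fun k v ⟨w, hw⟩ => ⟨φ (diagonalSingle k (-1)) w, by
      rw [← hw, ← Module.End.mul_apply, ← Module.End.mul_apply, sub_mul, mul_sub, ← map_mul,
        ← map_mul, hcomm, one_mul, mul_one]⟩)
    (fun h => hne (sub_eq_zero.1 (LinearMap.range_eq_bot.1 h)))
  have hneg : φ K v = -v := by
    obtain ⟨w, rfl⟩ := hvW
    rw [← Module.End.mul_apply, mul_sub, ← map_mul, hKK]
    simp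
  have hpos : φ K v = v := by
    rw [hK, map_mul, Module.End.mul_apply, he, map_smul, he, smul_smul]
    rcases he' with rfl | rfl <;> simp
  have h2 : (2 : F) • v = 0 := by
    rw [two_smul]; nth_rw 1 [← hpos]; rw [hneg, neg_add_cancel]
  exact hv ((smul_eq_zero.1 h2).resolve_left two_ne_zero)

theorem diagonalSingle_mul_transvection {i j : ι} (hij : i ≠ j) (c : F) :
    diagonalSingle i (-1) * transvection i j c =
      transvection i j (-c) * diagonalSingle i (-1) := by
  ext x y
  simp only [diagonalSingle, diagonal_mul, mul_diagonal, transvection, Matrix.add_apply, one_apply,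
    single_apply, Function.update_apply, Pi.one_apply]
  grind

theorem diagonalSingle_mul_transvection_comm {i j k : ι} (hi : k ≠ i) (hj : k ≠ j) (c d : F) :
    diagonalSingle k d * transvection i j c = transvection i j c * diagonalSingle k d := by
  ext x y
  simp only [diagonalSingle, diagonal_mul, mul_diagonal, transvection, Matrix.add_apply, one_apply,
    single_apply, Function.update_apply, Pi.one_apply]
  grind

theorem Module.End.mul_comm_of_finrank_le_one [FiniteDimensional F V] (h : finrank F V ≤ 1)
    (f g : End F V) : f * g = g * f := by
  obtain ⟨v, hv⟩ := finrank_le_one_iff.1 h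
  obtain ⟨a, ha⟩ := hv (f v)
  obtain ⟨b, hb⟩ := hv (g v)
  ext w
  obtain ⟨c, rfl⟩ := hv w
  simp only [Module.End.mul_apply, map_smul, ← ha, ← hb, smul_comm a b]

theorem map_transvection_eq_one [FiniteDimensional F V] [NeZero (2 : F)]
    (hcard : finrank F V < Fintype.card ι) (φ : Matrix ι ι F →* End F V) {i j : ι} (hij : i ≠ j)
    (c : F) : φ (transvection i j c) = 1 := by
  have hneg (c : F) : φ (transvection i j c) = φ (transvection i j (-c)) := by
    have hconj := diagonalSingle_mul_transvection hij c
    by_cases hk : ∃ k, k ≠ i ∧ k ≠ j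
    · obtain ⟨k, hki, hkj⟩ := hk
      have hD := map_diagonalSingle_neg_one_mul hcard φ i k
      have h : diagonalSingle i (-1) * diagonalSingle k (-1) * transvection i j c =
          transvection i j (-c) * (diagonalSingle i (-1) * diagonalSingle k (-1)) := by
        rw [mul_assoc, diagonalSingle_mul_transvection_comm hki hkj, ← mul_assoc, hconj, mul_assoc]
      simpa only [map_mul, ← map_mul φ (diagonalSingle i _), hD, one_mul, mul_one] using
        congrArg φ h
    · push Not at hk
      have hle : Fintype.card ι ≤ 2 := by
        rw [← Finset.card_univ, ← Finset.card_pair hij]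
        refine Finset.card_le_card fun k _ => ?_
        by_cases h : k = i
        · simp [h]
        · simp [hk k h]
      have h := congrArg (fun A => φ A * φ (diagonalSingle i (-1))) hconj
      simp only [map_mul] at h
      rw [Module.End.mul_comm_of_finrank_le_one (by omega) (φ (diagonalSingle i (-1))),
        mul_assoc, mul_assoc, ← map_mul φ (diagonalSingle i _), diagonalSingle_mul, neg_mul_neg,
        mul_one, diagonalSingle_one, map_one, mul_one, mul_one] at h
      exact h
  have h := hneg (c / 2)
  have h2 : transvection i j c = transvection i j (c / 2) * transvection i j (c / 2) := by
    rw [transvection_mul_transvection_same _ _ hij, add_halves]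
  rw [h2, map_mul]
  nth_rw 2 [h]
  rw [← map_mul, transvection_mul_transvection_same _ _ hij, add_neg_cancel, transvection_zero,
    map_one]

omit [Fintype ι] in
theorem diagonalSingle_eq_one_add (i : ι) (c : F) :
    diagonalSingle i c = 1 + (c - 1) • single i i (1 : F) := by
  ext x y
  simp only [diagonalSingle, diagonal_apply, Matrix.add_apply, one_apply,
    Matrix.smul_apply, smul_eq_mul,
    single_apply, Function.update_apply, Pi.one_apply]
  grind

/-- A product of transvections conjugates `diagonalSingle i c` into `diagonalSingle j c`. -/
theorem transvection_mul_diagonalSingle {i j : ι} (hij : i ≠ j) (c : F) :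
    transvection j i 1 * transvection i j (-1) * transvection j i 1 * diagonalSingle i c =
      diagonalSingle j c * (transvection j i 1 * transvection i j (-1) * transvection j i 1) := by
  have h : transvection j i 1 * transvection i j (-1) * transvection j i 1 * single i i (1 : F) =
      single j j 1 * (transvection j i 1 * transvection i j (-1) * transvection j i 1) := by
    simp [transvection, mul_add, add_mul, hij, hij.symm, ← single_neg]
  rw [diagonalSingle_eq_one_add, diagonalSingle_eq_one_add, mul_add, add_mul, mul_one, one_mul,
    mul_smul_comm, smul_mul_assoc, h]

/-- A multiplicative map from matrices to endomorphisms of a space of smaller dimension that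
preserves `0` and `1` depends only on the determinant. -/
theorem map_eq_map_diagonalSingle_det [FiniteDimensional F V] [NeZero (2 : F)]
    (hcard : finrank F V < Fintype.card ι) (φ : Matrix ι ι F →* End F V) (h0 : φ 0 = 0)
    (i : ι) (A : Matrix ι ι F) : φ A = φ (diagonalSingle i A.det) := by
  have hzero := map_diagonalSingle_zero hcard φ h0
  by_cases hA : A.det = 0
  · rw [map_eq_zero_of_det_eq_zero φ hzero A hA, hA, hzero]
  have htrans {i j : ι} (hij : i ≠ j) (c : F) := map_transvection_eq_one hcard φ hij c
  have hdiag (j : ι) (x : F) : φ (diagonalSingle j x) = φ (diagonalSingle i x) := by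
    by_cases hij : i = j
    · rw [hij]
    · have := congrArg φ (transvection_mul_diagonalSingle hij x)
      simpa [htrans hij, htrans (Ne.symm hij)] using this.symm
  let f : F →* End F V :=
    { toFun x := φ (diagonalSingle i x)
      map_one' := by rw [diagonalSingle_one, map_one]
      map_mul' x y := by rw [← map_mul, diagonalSingle_mul] }
  change φ A = f A.det
  induction A using diagonal_transvection_induction with
  | hdiag D _ => rw [map_diagonal_eq_prod φ f hdiag, det_diagonal]
  | htransvec t => rw [t.det, map_one]; exact htrans t.hij t.c
  | hmul A B hA hB => simp_all
end


/-- For `k < n`, every multiplicative map `Φ : M_n(F) → M_k(F)`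
with `Φ(0) = 0`, `Φ(I_n) = I_k` factors through the determinant: there is a
multiplicative `f : F → M_k(F)` with `f(1) = I_k`, `f(0) = 0`, and `Φ(A) = f(det A)`. -/
theorem multiplicative_map_to_smaller_factors_through_det {F : Type*} [Field F] [CharZero F]
    {n k : ℕ} (hn : 0 < n) (hk : 0 < k) (hkn : k < n)
    (Φ : Matrix (Fin n) (Fin n) F → Matrix (Fin k) (Fin k) F)
    (hmul : ∀ A B, Φ (A * B) = Φ A * Φ B)
    (h0 : Φ 0 = 0) (h1 : Φ 1 = 1) :
    ∃ f : F → Matrix (Fin k) (Fin k) F,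
      (∀ x y : F, f (x * y) = f x * f y) ∧ f 1 = 1 ∧ f 0 = 0 ∧
      ∀ A : Matrix (Fin n) (Fin n) F, Φ A = f A.det := by
  let φ : Matrix (Fin n) (Fin n) F →* Module.End F (Fin k → F) :=
    { toFun A := Matrix.toLinAlgEquiv' (Φ A)
      map_one' := by rw [h1, map_one]
      map_mul' A B := by rw [hmul, map_mul] }
  have hdet (A : Matrix (Fin n) (Fin n) F) : Φ A = Φ (diagonalSingle ⟨0, hn⟩ A.det) :=
    Matrix.toLinAlgEquiv'.injective
      (map_eq_map_diagonalSingle_det (by simpa using hkn) φ (by simp [φ, h0]) ⟨0, hn⟩ A)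
  refine ⟨fun x => Φ (diagonalSingle ⟨0, hn⟩ x), fun x y => ?_, ?_, ?_, hdet⟩
  · rw [← hmul, diagonalSingle_mul]
  · simp only [diagonalSingle_one, h1]
  · have : Nonempty (Fin n) := ⟨⟨0, hn⟩⟩
    have h := hdet 0
    rw [Matrix.det_zero, h0] at h
    exact h.symm
end

section
/- Let F be a field of characteristic 0 and let A ∈ GL(n,F) be an invertible n×n matrix. Then A is unipotent (i.e., (A − I_n)^n = 0) if and only if for every integer m ≥ 1 there exists an invertible matrix P ∈ GL(n,F) with A^m = P·A·P⁻¹. -/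
open Polynomial DirectSum

/-- Substituting `X ^ m` for `X` does not increase the order of vanishing at `1`. -/
lemma Polynomial.X_sub_one_pow_dvd_of_dvd_expand {F : Type*} [Field F] [CharZero F] {m : ℕ}
    (hm : 0 < m) {k : ℕ} {f : F[X]} (h : (X - 1) ^ k ∣ expand F m f) : (X - 1) ^ k ∣ f := by
  rcases eq_or_ne f 0 with rfl | hf
  · exact dvd_zero _
  obtain ⟨g, hfg, hg⟩ := exists_eq_pow_rootMultiplicity_mul_and_not_dvd f hf 1
  rw [dvd_iff_isRoot, IsRoot.def] at hg
  rw [C_1] at hfg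
  generalize rootMultiplicity 1 f = j at hfg
  have hexp : expand F m f =
      (X - 1) ^ j * ((∑ i ∈ Finset.range m, X ^ i) ^ j * expand F m g) := by
    rw [hfg, map_mul, map_pow, map_sub, expand_X, map_one, ← mul_geom_sum, mul_pow, mul_assoc]
  have hcop : IsCoprime ((X - 1 : F[X]) ^ k)
      ((∑ i ∈ Finset.range m, X ^ i) ^ j * expand F m g) := by
    refine IsCoprime.pow_left ?_
    rw [← C_1, (irreducible_X_sub_C (1 : F)).coprime_iff_not_dvd, dvd_iff_isRoot, IsRoot.def]
    simp [eval_finsetSum, expand_eval, hg, hm.ne']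
  rw [hexp] at h
  rw [hfg]
  exact (hcop.dvd_of_dvd_mul_right h).mul_right g

/-- A finitely generated `(X - 1)`-power torsion module over `F[X]` carries an injective additive
endomorphism that is semilinear with respect to the substitution of `X ^ m` for `X`. -/
lemma Module.exists_injective_expand_semilinear {F : Type*} [Field F] [CharZero F] {m : ℕ}
    (hm : 0 < m) {M : Type*} [AddCommGroup M] [Module F[X] M] [Module.Finite F[X] M]
    (hM : Module.IsTorsion' M (Submonoid.powers (X - 1 : F[X]))) :
    ∃ φ : M →+ M, Function.Injective φ ∧ ∀ (f : F[X]) (x : M), φ (f • x) = expand F m f • φ x := by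
  classical
  have hirr : Irreducible (X - 1 : F[X]) := by
    simpa using irreducible_X_sub_C (1 : F)
  obtain ⟨d, k, ⟨e⟩⟩ := Module.torsion_by_prime_power_decomposition hirr hM
  have hle (i : Fin d) : Ideal.span {(X - 1 : F[X]) ^ k i} ≤
      (Ideal.span {(X - 1 : F[X]) ^ k i}).comap (expand F m : F[X] →+* F[X]) := by
    rw [Ideal.span_singleton_le_iff_mem, Ideal.mem_comap, Ideal.mem_span_singleton]
    simpa using pow_dvd_pow_of_dvd (sub_one_dvd_pow_sub_one (X : F[X]) m) (k i)
  let q (i : Fin d) : (F[X] ⧸ Ideal.span {(X - 1 : F[X]) ^ k i}) →+*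
      (F[X] ⧸ Ideal.span {(X - 1 : F[X]) ^ k i}) :=
    Ideal.quotientMap _ (expand F m : F[X] →+* F[X]) (hle i)
  have hq (i : Fin d) : Function.Injective (q i) := by
    refine Ideal.quotientMap_injective' fun f hf ↦ ?_
    rw [Ideal.mem_comap, Ideal.mem_span_singleton] at hf
    rw [Ideal.mem_span_singleton]
    exact X_sub_one_pow_dvd_of_dvd_expand hm hf
  have hqs (i : Fin d) (f : F[X]) (x) : q i (f • x) = expand F m f • q i x := by
    obtain ⟨x, rfl⟩ := Ideal.Quotient.mk_surjective x
    exact congrArg (Ideal.Quotient.mk _) (map_mul (expand F m) f x)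
  let Φ : (⨁ i : Fin d, F[X] ⧸ Ideal.span {(X - 1 : F[X]) ^ k i}) →+
      ⨁ i : Fin d, F[X] ⧸ Ideal.span {(X - 1 : F[X]) ^ k i} :=
    DirectSum.map fun i ↦ (q i).toAddMonoidHom
  have hΦ : Function.Injective Φ := (DirectSum.map_injective _).2 hq
  have hΦs (f : F[X]) (x) : Φ (f • x) = expand F m f • Φ x := by
    ext i
    exact hqs i f (x i)
  refine ⟨(e.symm.toAddEquiv.toAddMonoidHom.comp Φ).comp e.toAddEquiv.toAddMonoidHom, ?_, ?_⟩
  · exact e.symm.injective.comp (hΦ.comp e.injective)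
  · intro f x
    change e.symm (Φ (e (f • x))) = expand F m f • e.symm (Φ (e x))
    rw [map_smul, hΦs, map_smul]

/-- A unipotent endomorphism in characteristic zero is conjugate to its positive powers. -/
lemma LinearMap.exists_equiv_pow_of_unipotent {F V : Type*} [Field F] [CharZero F]
    [AddCommGroup V] [Module F V] [FiniteDimensional F V] {a : Module.End F V} {k m : ℕ}
    (ha : (a - 1) ^ k = 0) (hm : 0 < m) :
    ∃ P : V ≃ₗ[F] V, ∀ v, P (a v) = (a ^ m) (P v) := by
  have hM : Module.IsTorsion' (Module.AEval F V a) (Submonoid.powers (X - 1 : F[X])) := by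
    intro x
    refine ⟨⟨(X - 1) ^ k, k, rfl⟩, (Module.AEval.of F V a).symm.injective ?_⟩
    change (Module.AEval.of F V a).symm (((X - 1) ^ k : F[X]) • x) = _
    rw [Module.AEval.of_symm_smul]
    simp [ha]
  obtain ⟨φ, hφ, hs⟩ := Module.exists_injective_expand_semilinear hm hM
  let ψ : V →ₗ[F] V :=
    { toFun v := (Module.AEval.of F V a).symm (φ (Module.AEval.of F V a v))
      map_add' v w := by simp
      map_smul' c v := by
        rw [map_smul, ← Module.AEval.C_smul, hs, expand_C, Module.AEval.C_smul, map_smul,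
          RingHom.id_apply] }
  have hψ : Function.Injective ψ :=
    (Module.AEval.of F V a).symm.injective.comp (hφ.comp (Module.AEval.of F V a).injective)
  refine ⟨LinearEquiv.ofInjectiveEndo ψ hψ, fun v ↦ ?_⟩
  change (Module.AEval.of F V a).symm (φ (Module.AEval.of F V a (a • v))) =
    (a ^ m) • (Module.AEval.of F V a).symm (φ (Module.AEval.of F V a v))
  rw [← Module.AEval.X_smul_of, hs, expand_X, Module.AEval.of_symm_smul, aeval_X_pow]

/-- A finite set of nonzero elements that is its own image under every positive power map is
contained in `{1}`. -/
lemma Set.eq_one_of_forall_image_pow_eq {K : Type*} [Field K] {S : Set K} (hS : S.Finite)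
    (h0 : (0 : K) ∉ S) (h : ∀ m : ℕ, 0 < m → (· ^ m) '' S = S) {x : K} (hx : x ∈ S) : x = 1 := by
  have hfin (s : K) (hs : s ∈ S) : 0 < orderOf s := by
    have hmaps : Set.MapsTo (fun i : ℕ ↦ s ^ (i + 1)) Set.univ S := fun i _ ↦
      h (i + 1) i.succ_pos ▸ Set.mem_image_of_mem _ hs
    obtain ⟨i, -, j, -, hij, heq⟩ := Set.infinite_univ.exists_lt_map_eq_of_mapsTo hmaps hS
    have hs0 : s ≠ 0 := fun h ↦ h0 (h ▸ hs)
    refine orderOf_pos_iff.2 (isOfFinOrder_iff_pow_eq_one.2 ⟨j - i, by omega, ?_⟩)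
    have : s ^ (i + 1) * s ^ (j - i) = s ^ (i + 1) * 1 := by
      rw [← pow_add, mul_one, show i + 1 + (j - i) = j + 1 by omega]
      exact heq.symm
    exact mul_left_cancel₀ (pow_ne_zero _ hs0) this
  obtain ⟨s, hs, rfl⟩ := (h (∏ s ∈ hS.toFinset, orderOf s)
    (Finset.prod_pos fun s hs ↦ hfin s (hS.mem_toFinset.1 hs))).symm ▸ hx
  exact orderOf_dvd_iff_pow_eq_one.1 (Finset.dvd_prod_of_mem _ (hS.mem_toFinset.2 hs))

/-- Over an algebraically closed field, an invertible matrix with the same spectrum as each of its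
positive powers is unipotent. -/
lemma Matrix.sub_one_pow_eq_zero_of_spectrum_pow_eq {K ι : Type*} [Field K] [IsAlgClosed K]
    [Fintype ι] [DecidableEq ι] {A : Matrix ι ι K} (hA : IsUnit A)
    (h : ∀ m : ℕ, 0 < m → spectrum K (A ^ m) = spectrum K A) :
    (A - 1) ^ Fintype.card ι = 0 := by
  classical
  have hfin : (spectrum K A).Finite := by
    refine A.charpoly.roots.toFinset.finite_toSet.subset fun r hr ↦ ?_
    simpa [A.charpoly_monic.ne_zero] using Matrix.mem_spectrum_iff_isRoot_charpoly.1 hr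
  have hroots (r : K) (hr : r ∈ A.charpoly.roots) : r = 1 := by
    refine Set.eq_one_of_forall_image_pow_eq hfin (spectrum.zero_notMem K hA) (fun m hm ↦ ?_)
      (Matrix.mem_spectrum_iff_isRoot_charpoly.2 (isRoot_of_mem_roots hr))
    rw [← spectrum.map_pow_of_pos A hm, h m hm]
  have hsplit := IsAlgClosed.splits A.charpoly
  have hchar : A.charpoly = (X - C 1) ^ Fintype.card ι := by
    rw [hsplit.eq_prod_roots_of_monic A.charpoly_monic, Multiset.eq_replicate.2
      ⟨hsplit.natDegree_eq_card_roots.symm.trans A.charpoly_natDegree_eq_dim, hroots⟩]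
    simp
  simpa [hchar] using A.aeval_self_charpoly

/-- An invertible matrix `A` over a field of characteristic `0` is
unipotent iff for every `m ≥ 1` the power `A^m` is conjugate to `A`. -/
theorem unipotent_iff_conj_pow {F : Type*} [Field F] [CharZero F] {n : ℕ}
    (A : Matrix (Fin n) (Fin n) F) (hA : IsUnit A) :
    (A - 1) ^ n = 0 ↔
      ∀ m : ℕ, 1 ≤ m → ∃ P : (Matrix (Fin n) (Fin n) F)ˣ,
        A ^ m = (P : Matrix (Fin n) (Fin n) F) * A *
          ((P⁻¹ : (Matrix (Fin n) (Fin n) F)ˣ) : Matrix (Fin n) (Fin n) F) := by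
  constructor
  · intro h m hm
    let T : Matrix (Fin n) (Fin n) F ≃ₐ[F] Module.End F (Fin n → F) := Matrix.toLinAlgEquiv'
    have hT : (T A - 1) ^ n = 0 := by
      rw [← map_one T, ← map_sub, ← map_pow, h, map_zero]
    obtain ⟨P, hP⟩ := LinearMap.exists_equiv_pow_of_unipotent hT hm
    let u : (Module.End F (Fin n → F))ˣ := LinearMap.GeneralLinearGroup.ofLinearEquiv P
    refine ⟨Units.map (T.symm : Module.End F (Fin n → F) →* Matrix (Fin n) (Fin n) F) u, ?_⟩
    rw [Units.eq_mul_inv_iff_mul_eq]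
    apply T.injective
    have hu : (u : Module.End F (Fin n → F)) * T A = T A ^ m * u := LinearMap.ext hP
    simpa using hu.symm
  · intro h
    let f := algebraMap F (AlgebraicClosure F)
    have hunit : IsUnit (f.mapMatrix A) := hA.map _
    have key := Matrix.sub_one_pow_eq_zero_of_spectrum_pow_eq hunit fun m hm ↦ by
      obtain ⟨P, hP⟩ := h m hm
      let Q := Units.map (f.mapMatrix (m := Fin n)).toMonoidHom P
      have hQ : f.mapMatrix A ^ m = (Q : Matrix (Fin n) (Fin n) (AlgebraicClosure F)) *
          f.mapMatrix A * (Q⁻¹ : (Matrix (Fin n) (Fin n) (AlgebraicClosure F))ˣ) := by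
        rw [← map_pow, hP, map_mul, map_mul]
        rfl
      rw [hQ, spectrum.units_conjugate]
    rw [Fintype.card_fin, ← map_one f.mapMatrix, ← map_sub, ← map_pow] at key
    exact Matrix.map_injective f.injective (key.trans (map_zero f.mapMatrix).symm)
end

section
/- Let F be a field of characteristic 0, let n, k be positive integers, and let Φ : GL(n,F) → GL(k,F) satisfy Φ(AB) = Φ(A)Φ(B) for all A, B ∈ GL(n,F) and Φ(I_n) = I_k. If A ∈ GL(n,F) is unipotent, then Φ(A) is unipotent. -/
/-- If `N` is nilpotent and `u` is a bijective linear map commuting with `N`, then `N` and `N * u`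
are intertwined by an injective linear map. -/
theorem exists_injective_intertwining_of_pow_eq_zero {K : Type*} [Field K] (r : ℕ) :
    ∀ {V : Type*} [AddCommGroup V] [Module K V] (N u : Module.End K V), N ^ r = 0 →
      Function.Bijective u → Commute N u →
      ∃ g : Module.End K V, Function.Injective g ∧ g * N = N * u * g := by
  induction r with
  | zero =>
    intro V _ _ N u hN _ _
    have h (v : V) : v = 0 := by simpa using LinearMap.congr_fun hN v
    exact ⟨1, Function.injective_id, LinearMap.ext fun v => by rw [h v, map_zero, map_zero]⟩
  | succ r ih =>
    intro V _ _ N u hN hu hc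
    have hNu (v : V) : N (u v) = u (N v) := LinearMap.congr_fun hc v
    set W := LinearMap.range N
    have hNmem (v : V) : N v ∈ W := LinearMap.mem_range_self N v
    have huW : ∀ w ∈ W, u w ∈ W := by
      rintro _ ⟨v, rfl⟩
      exact ⟨u v, hNu v⟩
    obtain ⟨f, hf, hfN⟩ := ih (N.restrict fun w _ => hNmem w : Module.End K W) (u.restrict huW)
      (by
        ext ⟨_, v, rfl⟩
        rw [Module.End.pow_restrict]
        simpa [pow_succ] using LinearMap.congr_fun hN v)
      (by
        constructor
        · intro a b hab
          exact Subtype.ext (hu.1 (congrArg Subtype.val hab))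
        · rintro ⟨_, v, rfl⟩
          obtain ⟨v, rfl⟩ := hu.2 v
          exact ⟨⟨N v, hNmem v⟩, Subtype.ext (hNu v).symm⟩)
      (LinearMap.ext fun w => Subtype.ext (hNu w))
    have hfN' (w : W) : (f ⟨N w, hNmem w⟩ : V) = N (u (f w)) :=
      congrArg Subtype.val (LinearMap.congr_fun hfN w)
    have hker (v : V) (hv : N (u v) = 0) : N v = 0 := by
      rw [hNu] at hv
      exact hu.1 (hv.trans (map_zero u).symm)
    obtain ⟨s, hs⟩ := LinearMap.exists_rightInverse_of_surjective
      ((N * u).codRestrict W fun v => hNmem (u v)) (by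
        rw [LinearMap.range_eq_top]
        rintro ⟨_, v, rfl⟩
        obtain ⟨v, rfl⟩ := hu.2 v
        exact ⟨v, rfl⟩)
    have hs' (w : W) : N (u (s w)) = w := congrArg Subtype.val (LinearMap.congr_fun hs w)
    obtain ⟨C, hdisj, hsup⟩ := IsModularLattice.exists_disjoint_and_sup_eq
      (inf_le_left : LinearMap.ker N ⊓ W ≤ LinearMap.ker N)
    have hCker : C ≤ LinearMap.ker N := hsup ▸ le_sup_right
    have hCW : Disjoint C W := by
      rw [Submodule.disjoint_def] at hdisj ⊢
      exact fun x hx hxW => hdisj x ⟨hCker hx, hxW⟩ hx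
    obtain ⟨C', hCC', hcompl⟩ := hCW.exists_isCompl
    obtain ⟨D, hD⟩ := exists_isCompl C
    let p : V →ₗ[K] W := W.projectionOnto C' hcompl.symm
    let q : V →ₗ[K] V := LinearMap.id - W.subtype ∘ₗ p
    let π : V →ₗ[K] V := C.projection D hD
    let g : V →ₗ[K] V := W.subtype ∘ₗ f ∘ₗ p + s ∘ₗ f ∘ₗ N.rangeRestrict ∘ₗ q + π ∘ₗ q
    have hg (v : V) : g v = f (p v) + s (f ⟨N (q v), hNmem _⟩) + π (q v) := rfl
    have hq (v : V) : q v = v - p v := rfl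
    have hpW (w : W) : p w = w := Submodule.projectionOnto_apply_left hcompl.symm w
    have hgW (w : W) : g w = f w := by
      have : q w = 0 := by rw [hq, hpW, sub_self]
      have h0 : (⟨N (q w), hNmem _⟩ : W) = 0 := Subtype.ext (by simp [this])
      rw [hg, hpW, h0, this]
      simp
    have hgC (c : V) (hc : c ∈ C) : g c = c := by
      have hp : p c = 0 := Submodule.projectionOnto_apply_of_mem_right hcompl.symm (hCC' hc)
      have hqc : q c = c := by rw [hq, hp]; simp
      have h0 : (⟨N (q c), hNmem _⟩ : W) = 0 :=
        Subtype.ext (by rw [hqc]; exact hCker hc)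
      rw [hg, hp, h0, hqc]
      simp only [map_zero, ZeroMemClass.coe_zero, zero_add]
      exact Submodule.projection_apply_of_mem_left hD hc
    have hgN (v : V) : g (N v) = N (u (g v)) := by
      have hπ : N (u (π (q v))) = 0 := by
        rw [hNu, show N (π (q v)) = 0 from hCker (Submodule.projection_apply_mem hD _), map_zero]
      rw [hgW ⟨N v, hNmem v⟩, hg, map_add, map_add, map_add, map_add, hπ, hs', ← hfN', add_zero,
        ← Submodule.coe_add, ← map_add]
      congr 2
      ext
      simp [hq]
    refine ⟨g, ?_, LinearMap.ext hgN⟩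
    rw [← LinearMap.ker_eq_bot, LinearMap.ker_eq_bot']
    intro v hv
    have hNv : N v = 0 := by
      have h : (f ⟨N v, hNmem v⟩ : V) = 0 := by
        rw [← hgW ⟨N v, hNmem v⟩, hgN, hv, map_zero, map_zero]
      have h' : f ⟨N v, hNmem v⟩ = f 0 := by
        rw [map_zero]
        exact Subtype.ext h
      exact congrArg Subtype.val (hf h')
    have hv' : v ∈ LinearMap.ker N ⊓ W ⊔ C := hsup.symm ▸ hNv
    obtain ⟨w, hw, c, hc, rfl⟩ := Submodule.mem_sup.mp hv'
    rw [map_add, hgW ⟨w, hw.2⟩, hgC c hc] at hv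
    have hcW : c ∈ W := by
      rw [eq_neg_of_add_eq_zero_right hv]
      exact W.neg_mem (f _).2
    obtain rfl : c = 0 := Submodule.disjoint_def.mp hCW c hc hcW
    rw [add_zero] at hv ⊢
    have h' : f ⟨w, hw.2⟩ = f 0 := by
      rw [map_zero]
      exact Subtype.ext hv
    exact congrArg Subtype.val (hf h')

/-- Over a field of characteristic zero, a unipotent matrix is conjugate to each of its positive
powers. -/
theorem isConj_pow_of_unipotent {F : Type*} [Field F] [CharZero F] {n : ℕ}
    (A : GL (Fin n) F) (hA : IsNilpotent ((A : Matrix (Fin n) (Fin n) F) - 1)) {m : ℕ}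
    (hm : 0 < m) : IsConj A (A ^ m) := by
  set a : Matrix (Fin n) (Fin n) F := A.val
  set b : Matrix (Fin n) (Fin n) F := ∑ i ∈ Finset.range m, a ^ i with hb
  have hcomm : Commute (a - 1) b :=
    Commute.sum_right _ _ _ fun i _ => ((Commute.refl a).sub_left (Commute.one_left a)).pow_right i
  have hbu : IsUnit b := by
    have hnil : IsNilpotent (∑ i ∈ Finset.range m, (a ^ i - 1)) := by
      refine Commute.isNilpotent_sum (fun i _ => ?_) fun i j _ _ => ?_
      · rw [← mul_geom_sum]
        exact Commute.isNilpotent_mul_right (Commute.sum_right _ _ _ fun i _ =>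
          ((Commute.refl a).sub_left (Commute.one_left a)).pow_right i) hA
      · exact ((Commute.pow_pow_self a i j).sub_left (Commute.one_left _)).sub_right
          (Commute.one_right _)
    have hmu : IsUnit (m : Matrix (Fin n) (Fin n) F) := by
      have := (IsUnit.mk0 (m : F) (by exact_mod_cast hm.ne')).map
        (algebraMap F (Matrix (Fin n) (Fin n) F))
      rwa [map_natCast] at this
    have hsum : b = m + ∑ i ∈ Finset.range m, (a ^ i - 1) := by
      simp [hb]
    rw [hsum]
    exact hnil.isUnit_add_left_of_commute hmu (Nat.cast_commute m _).symm
  obtain ⟨r, hr⟩ := hA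
  obtain ⟨g, hg, hgN⟩ := exists_injective_intertwining_of_pow_eq_zero r
    (Matrix.toLinAlgEquiv' (a - 1)) (Matrix.toLinAlgEquiv' b)
    (by rw [← map_pow, hr, map_zero])
    ((Module.End.isUnit_iff _).mp (hbu.map Matrix.toLinAlgEquiv'))
    (hcomm.map Matrix.toLinAlgEquiv')
  have hgu : IsUnit (LinearMap.toMatrixAlgEquiv' g) :=
    ((Module.End.isUnit_iff g).mpr
      ⟨hg, LinearMap.injective_iff_surjective.mp hg⟩).map LinearMap.toMatrixAlgEquiv'
  obtain ⟨c, hc⟩ := hgu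
  refine ⟨toUnits c, Units.ext ?_⟩
  have h := congrArg LinearMap.toMatrixAlgEquiv' hgN
  rw [map_mul, map_mul, map_mul, LinearMap.toMatrixAlgEquiv'_toLinAlgEquiv',
    LinearMap.toMatrixAlgEquiv'_toLinAlgEquiv', mul_geom_sum, ← hc, mul_sub, sub_mul] at h
  simpa using h

/-- An invertible matrix over a field which is conjugate to all of its positive powers is
unipotent. -/
theorem sub_one_pow_eq_zero_of_isConj_pow {F : Type*} [Field F] {k : ℕ} (B : GL (Fin k) F)
    (hB : ∀ m : ℕ, 0 < m → IsConj B (B ^ m)) :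
    ((B : Matrix (Fin k) (Fin k) F) - 1) ^ k = 0 := by
  let i : F →+* AlgebraicClosure F := algebraMap F (AlgebraicClosure F)
  let B' : GL (Fin k) (AlgebraicClosure F) := Matrix.GeneralLinearGroup.map i B
  set b : Matrix (Fin k) (Fin k) (AlgebraicClosure F) := B'.val with hb
  let S : Set (AlgebraicClosure F) := spectrum (AlgebraicClosure F) b
  have hS (m : ℕ) (hm : 0 < m) : Set.image (· ^ m) S = S := by
    have hconj : IsConj B' (B' ^ m) := by
      have := (Matrix.GeneralLinearGroup.map i).map_isConj (hB m hm)
      rwa [map_pow] at this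
    obtain ⟨c, hc⟩ := isConj_iff.mp hconj
    rw [← spectrum.map_pow_of_pos b hm, hb, ← Units.val_pow_eq_pow_val, ← hc, Units.val_mul,
      Units.val_mul]
    exact spectrum.units_conjugate
  have hfin : S.Finite := (Polynomial.finite_setOfPred_isRoot b.charpoly_monic.ne_zero).subset
    fun _ hx => Matrix.mem_spectrum_iff_isRoot_charpoly.mp hx
  have hord (x : AlgebraicClosure F) (hx : x ∈ S) : IsOfFinOrder x := by
    have hx0 : x ≠ 0 := by
      rintro rfl
      exact spectrum.zero_notMem _ B'.isUnit hx
    have hmaps : Set.MapsTo (fun m : ℕ => x ^ (m + 1)) Set.univ S := fun m _ =>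
      hS (m + 1) m.succ_pos ▸ Set.mem_image_of_mem _ hx
    obtain ⟨m, -, l, -, hne, heq⟩ :=
      Set.infinite_univ.exists_ne_map_eq_of_mapsTo hmaps hfin
    by_contra hinf
    exact hne (Nat.succ_injective ((injective_pow_iff_not_isOfFinOrder (x := Units.mk0 x hx0)).mpr
      (fun h => hinf (by simpa using (Units.coeHom _).isOfFinOrder h)) (Units.ext heq)))
  have hone (x : AlgebraicClosure F) (hx : x ∈ S) : x = 1 := by
    have hpos : 0 < ∏ y ∈ hfin.toFinset, orderOf y :=
      Finset.prod_pos fun y hy => (hord y (hfin.mem_toFinset.mp hy)).orderOf_pos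
    rw [← hS _ hpos] at hx
    obtain ⟨y, hy, rfl⟩ := hx
    exact orderOf_dvd_iff_pow_eq_one.mp
      (Finset.dvd_prod_of_mem orderOf (hfin.mem_toFinset.mpr hy))
  have hroots : b.charpoly.roots = Multiset.replicate k 1 := by
    rw [Multiset.eq_replicate]
    constructor
    · rw [← (IsAlgClosed.splits b.charpoly).natDegree_eq_card_roots, b.charpoly_natDegree_eq_dim,
        Fintype.card_fin]
    · exact fun x hx => hone x (Matrix.mem_spectrum_iff_isRoot_charpoly.mpr
        (Polynomial.isRoot_of_mem_roots hx))
  have hzero : (b - 1) ^ k = 0 := by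
    have h := b.aeval_self_charpoly
    rw [(IsAlgClosed.splits b.charpoly).eq_prod_roots_of_monic b.charpoly_monic, hroots] at h
    simpa using h
  refine Matrix.map_injective i.injective ?_
  change i.mapMatrix _ = i.mapMatrix _
  rw [map_pow, map_sub, map_one, map_zero]
  exact hzero

/-- A multiplicative map `Φ : GL(n,F) → GL(k,F)` with `Φ(I) = I`
sends unipotent matrices to unipotent matrices. -/
theorem multiplicative_map_preserves_unipotent {F : Type*} [Field F] [CharZero F]
    {n k : ℕ} (hn : 0 < n) (hk : 0 < k)
    (Φ : GL (Fin n) F → GL (Fin k) F)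
    (hmul : ∀ A B : GL (Fin n) F, Φ (A * B) = Φ A * Φ B)
    (h1 : Φ 1 = 1) :
    ∀ A : GL (Fin n) F, ((A : Matrix (Fin n) (Fin n) F) - 1) ^ n = 0 →
      ((Φ A : Matrix (Fin k) (Fin k) F) - 1) ^ k = 0 := by
  intro A hA
  let φ : GL (Fin n) F →* GL (Fin k) F := ⟨⟨Φ, h1⟩, hmul⟩
  refine sub_one_pow_eq_zero_of_isConj_pow (φ A) fun m hm => ?_
  rw [← map_pow]
  exact φ.map_isConj (isConj_pow_of_unipotent A ⟨n, hA⟩ hm)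
end

section
/- Let F be a field of characteristic 0, let n ≥ 2, and let Φ : GL(n,F) → GL(n,F) be a multiplicative map with Φ(I_n) = I_n that is nontrivial, i.e., Φ(A) ≠ I_n for some A with det A = 1. Let D_1(−1) = diag(−1,1,…,1). Then Φ(D_1(−1)) is conjugate in GL(n,F) either to D_1(−1) or to −D_1(−1). -/
open Matrix Equiv

section Kernel

variable {ι F G : Type*} [Fintype ι] [DecidableEq ι] [Field F] [Group G]

/-- The invertible matrix permuting the standard basis vectors by `σ`. -/
noncomputable def permGL (F : Type*) [Field F] : Perm ι →* GL ι F :=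
  (permMatrixHom (n := ι) (R := F)).toHomUnits

theorem permGL_mul (σ : Perm ι) (M : Matrix ι ι F) :
    (permGL F σ : Matrix ι ι F) * M = M.submatrix σ.symm id := by
  simp [permGL, PEquiv.toMatrix_toPEquiv_mul, Perm.inv_def]

theorem mul_permGL (σ : Perm ι) (M : Matrix ι ι F) :
    M * (permGL F σ : Matrix ι ι F) = M.submatrix id σ := by
  simp [permGL, PEquiv.mul_toMatrix_toPEquiv, Perm.inv_def]

theorem permGL_mul_transvection (σ : Perm ι) {i j : ι} (hij : i ≠ j) (c : F) :
    permGL F σ * (SpecialLinearGroup.transvection hij c : GL ι F) =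
      (SpecialLinearGroup.transvection (σ.injective.ne hij) c : GL ι F) * permGL F σ := by
  refine Units.ext ?_
  simp only [Units.val_mul, permGL_mul, mul_permGL, SpecialLinearGroup.coe_GL_coe_matrix,
    SpecialLinearGroup.transvection_coe]
  ext a b
  simp [one_apply, single_apply, Equiv.symm_apply_eq, Equiv.eq_symm_apply]

theorem diag2n_eq_transvections {i j : ι} (hij : i ≠ j) {a : F} (ha : a ≠ 0) :
    SpecialLinearGroup.diag2n hij a ha =
      SpecialLinearGroup.transvection hij a * SpecialLinearGroup.transvection hij.symm (-a⁻¹) *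
        SpecialLinearGroup.transvection hij (a - 1) * SpecialLinearGroup.transvection hij.symm 1 *
        SpecialLinearGroup.transvection hij (-1) := by
  refine SpecialLinearGroup.coeMonoidHom_injective ?_
  have hd : (SpecialLinearGroup.diag2n hij a ha).1 =
      1 + single i i (a - 1) + single j j (a⁻¹ - 1) := by
    ext k l
    by_cases hkl : k = l
    · subst hkl
      by_cases hki : k = i
      · subst hki
        simp [SpecialLinearGroup.diag2n_coe, hij.symm]
      · by_cases hkj : k = j
        · subst hkj
          simp [SpecialLinearGroup.diag2n_coe, hij, hki]
        · simp [SpecialLinearGroup.diag2n_coe, hki, hkj, Ne.symm hki, Ne.symm hkj]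
    · simp only [SpecialLinearGroup.diag2n_coe, diagonal_apply_ne _ hkl, Matrix.add_apply,
        one_apply_ne hkl, single_apply]
      grind
  simp only [SpecialLinearGroup.coeMonoidHom_apply, hd, map_mul,
    SpecialLinearGroup.transvection_coe, mul_add, add_mul, one_mul, mul_one, single_mul_single_same,
    single_mul_single_of_ne _ _ _ _ hij,
    single_mul_single_of_ne _ _ _ _ hij.symm, add_zero]
  ext k l
  simp only [Matrix.add_apply, single_apply]
  split_ifs <;> (field_simp; ring)

/-- A homomorphism from `GL` that sends some nonscalar diagonal matrix to an element commuting with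
its image is trivial on matrices of determinant one. -/
theorem map_eq_one_of_det_eq_one (φ : GL ι F →* G) {X : GL ι F} {x : ι → F}
    (hX : (X : Matrix ι ι F) = diagonal x) {i j : ι} (hx : x i ≠ x j)
    (hcomm : ∀ A, Commute (φ X) (φ A)) (A : GL ι F) (hA : (A : Matrix ι ι F).det = 1) :
    φ A = 1 := by
  have hij : i ≠ j := fun h => hx (h ▸ rfl)
  have : Nontrivial ι := ⟨i, j, hij⟩
  have hxj : x j ≠ 0 := by
    have hu := (Matrix.isUnit_iff_isUnit_det _).1 X.isUnit
    rw [hX, det_diagonal, isUnit_iff_ne_zero, Finset.prod_ne_zero_iff] at hu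
    exact hu j (Finset.mem_univ j)
  have hconj (c : F) : X * (SpecialLinearGroup.transvection hij c : GL ι F) =
      (SpecialLinearGroup.transvection hij (x i / x j * c) : GL ι F) * X := by
    refine Units.ext ?_
    simp only [Units.val_mul, hX, SpecialLinearGroup.coe_GL_coe_matrix,
      SpecialLinearGroup.transvection_coe]
    ext a b
    simp only [diagonal_mul, mul_diagonal, Matrix.add_apply, one_apply, single_apply]
    split_ifs <;> grind
  have hker (c : F) : φ (SpecialLinearGroup.transvection hij c : GL ι F) = 1 := by
    have hsub : x i / x j - 1 ≠ 0 := by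
      rw [sub_ne_zero, ne_eq, div_eq_one_iff_eq hxj]
      exact hx
    have key (d : F) : φ (SpecialLinearGroup.transvection hij d : GL ι F) =
        φ (SpecialLinearGroup.transvection hij (x i / x j * d) : GL ι F) := by
      have h := congrArg φ (hconj d)
      rw [map_mul, map_mul, (hcomm _).eq] at h
      exact mul_right_cancel h
    have hc : c = -(c / (x i / x j - 1)) + x i / x j * (c / (x i / x j - 1)) := by
      field_simp
      ring
    rw [hc, SpecialLinearGroup.transvection_add, map_mul, map_mul, ← key, ← map_mul, ← map_mul,
      ← SpecialLinearGroup.transvection_add, neg_add_cancel,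
      SpecialLinearGroup.transvection_coeff_zero, map_one, map_one]
  have hker' (k l : ι) (hkl : k ≠ l) (c : F) :
      φ (SpecialLinearGroup.transvection hkl c : GL ι F) = 1 := by
    obtain ⟨σ, rfl, rfl⟩ : ∃ σ : Perm ι, σ i = k ∧ σ j = l := by
      refine ⟨swap (swap i k j) l * swap i k, ?_, ?_⟩
      · rw [Perm.mul_apply, swap_apply_left, swap_apply_of_ne_of_ne _ hkl]
        intro h
        exact hij ((swap i k).injective (by rw [← h, swap_apply_left]))
      · simp
    have h := congrArg φ (permGL_mul_transvection σ hij c)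
    rw [map_mul, map_mul, hker, mul_one] at h
    exact mul_eq_right.1 h.symm
  have hSL (M : SpecialLinearGroup ι F) : φ (M : GL ι F) = 1 := by
    refine SpecialLinearGroup.diagonal_transvection_induction'
      (fun M => φ (M : GL ι F) = 1) M ?_ hker' ?_
    · intro k l hkl c hc
      simp [diag2n_eq_transvections, hker']
    · intro A B hA hB
      rw [map_mul, map_mul, hA, hB, one_mul]
  convert hSL ⟨A, hA⟩
  exact Units.ext rfl

end Kernel

section Involutions

theorem Nat.eq_one_or_succ_eq_of_choose_le {n k : ℕ} (hk : 1 ≤ k) (hkn : k + 1 ≤ n)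
    (h : n.choose k ≤ n) : k = 1 ∨ k + 1 = n := by
  induction n generalizing k with
  | zero => omega
  | succ n ih =>
    obtain ⟨k, rfl⟩ := Nat.exists_eq_succ_of_ne_zero (by omega : k ≠ 0)
    rw [Nat.succ_eq_add_one] at hk hkn h ⊢
    rcases Nat.lt_or_ge n (k + 2) with hn | hn
    · exact Or.inr (by omega)
    · rcases Nat.eq_zero_or_pos k with rfl | hk0
      · exact Or.inl rfl
      · rw [Nat.choose_succ_succ, Nat.succ_eq_add_one] at h
        have hpos := Nat.choose_pos (n := n) (k := k) (by omega)
        rcases ih (k := k + 1) (by omega) (by omega) (by omega) with h1 | h1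
        · omega
        · subst h1
          rw [Nat.choose_succ_self_right, Nat.choose_symm_of_eq_add (b := 2) rfl,
            Nat.choose_succ_succ, Nat.choose_one_right] at h
          omega

variable {ι F V : Type*} [Field F] [AddCommGroup V] [Module F V]

theorem add_ne_zero_or_sub_ne_zero (K : Type*) [Field K] [CharZero K] [Module K V] {w : V}
    (hw : w ≠ 0) (u : V) : w + u ≠ 0 ∨ w - u ≠ 0 := by
  by_contra! h
  have h2 : (2 : K) • w = 0 := by
    rw [two_smul, ← add_add_sub_cancel w w u, h.1, h.2, add_zero]
  exact hw ((smul_eq_zero.1 h2).resolve_left two_ne_zero)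

/-- A nonzero vector can be replaced by a joint eigenvector of commuting involutions without
losing any of its eigenvalues. -/
theorem exists_joint_eigenvector [CharZero F] {e : ι → Module.End F V} (hsq : ∀ i, e i * e i = 1)
    (hcomm : ∀ i j, Commute (e i) (e j)) (T : Finset ι) {w : V} (hw : w ≠ 0) :
    ∃ w' ≠ 0, (∀ i ∈ T, e i w' = w' ∨ e i w' = -w') ∧
      ∀ i (c : F), e i w = c • w → e i w' = c • w' := by
  classical
  induction T using Finset.induction_on with
  | empty => exact ⟨w, hw, by simp, fun _ _ h => h⟩
  | insert k T _ ih =>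
    obtain ⟨u, hu, hT, hc⟩ := ih
    have hsq' (x : V) : e k (e k x) = x := LinearMap.congr_fun (hsq k) x
    have hcomm' (i : ι) (x : V) : e i (e k x) = e k (e i x) :=
      LinearMap.congr_fun (hcomm i k).eq x
    rcases add_ne_zero_or_sub_ne_zero F hu (e k u) with h | h
    · refine ⟨_, h, fun i hi => ?_, fun i c hi => ?_⟩
      · rcases Finset.mem_insert.1 hi with rfl | hi
        · left
          rw [map_add, hsq', add_comm]
        · rcases hT i hi with h' | h'
          · left
            rw [map_add, hcomm', h']
          · right
            rw [map_add, hcomm', h', map_neg, neg_add]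
      · rw [map_add, hcomm', hc i c hi, map_smul, smul_add]
    · refine ⟨_, h, fun i hi => ?_, fun i c hi => ?_⟩
      · rcases Finset.mem_insert.1 hi with rfl | hi
        · right
          rw [map_sub, hsq', neg_sub]
        · rcases hT i hi with h' | h'
          · left
            rw [map_sub, hcomm', h']
          · right
            rw [map_sub, hcomm', h', map_neg, neg_sub', sub_neg_eq_add]
      · rw [map_sub, hcomm', hc i c hi, map_smul, smul_sub]

theorem linearIndependent_of_joint_eigenvectors {κ : Type*} {e : ι → Module.End F V}
    (hcomm : ∀ i j, Commute (e i) (e j)) {χ : κ → ι → F} (hχ : Function.Injective χ) {v : κ → V}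
    (hv : ∀ k, v k ≠ 0) (hev : ∀ k i, e i (v k) = χ k i • v k) : LinearIndependent F v := by
  have hind := Module.End.independent_iInf_maxGenEigenspace_of_forall_mapsTo e
    fun i j φ => Module.End.mapsTo_maxGenEigenspace_of_comm (hcomm j i) φ
  refine (hind.comp hχ).linearIndependent _ (fun k => ?_) hv
  rw [Function.comp_apply, Submodule.mem_iInf]
  intro i
  have hmem : v k ∈ (e i).eigenspace (χ k i) := Module.End.mem_eigenspace_iff.2 (hev k i)
  exact (e i).genEigenspace (χ k i) |>.monotone le_top hmem

/-- If as many commuting involutions as the dimension are permuted by conjugation under the full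
symmetric group, and are not all equal, then up to a common sign they are the coordinate
reflections of a basis. -/
theorem exists_reflection_basis [CharZero F] [Fintype ι] [DecidableEq ι] [FiniteDimensional F V]
    (hdim : Module.finrank F V = Fintype.card ι) {e : ι → Module.End F V}
    (hsq : ∀ i, e i * e i = 1) (hcomm : ∀ i j, Commute (e i) (e j))
    (hconj : ∀ σ : Perm ι, ∃ U : Module.End F V, Function.Injective U ∧
      ∀ i, U * e i = e (σ i) * U)
    {i₀ i₁ : ι} (hne : e i₀ ≠ e i₁) :
    ∃ ε : F, (ε = 1 ∨ ε = -1) ∧ ∃ v : ι → V, LinearIndependent F v ∧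
      ∀ i j, e i (v j) = (ε * if j = i then -1 else 1) • v j := by
  have hsq' (k : ι) (x : V) : e k (e k x) = x := LinearMap.congr_fun (hsq k) x
  have hcomm' (i k : ι) (x : V) : e i (e k x) = e k (e i x) :=
    LinearMap.congr_fun (hcomm i k).eq x
  obtain ⟨w, hw, i, j, hi, hj⟩ : ∃ w ≠ 0, ∃ i j, e i w = (1 : F) • w ∧ e j w = (-1 : F) • w := by
    obtain ⟨u, hu⟩ : ∃ u, e i₀ u ≠ e i₁ u := by
      by_contra! h
      exact hne (LinearMap.ext h)
    rcases add_ne_zero_or_sub_ne_zero F (sub_ne_zero.2 hu) (u - e i₀ (e i₁ u)) with h | h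
    · refine ⟨_, h, i₀, i₁, ?_, ?_⟩
      · simp only [map_add, map_sub, hsq', one_smul]
        abel
      · simp only [map_add, map_sub, hsq', hcomm' i₁ i₀, neg_smul, one_smul]
        abel
    · refine ⟨_, h, i₁, i₀, ?_, ?_⟩
      · simp only [map_sub, hsq', hcomm' i₁ i₀, one_smul]
        abel
      · simp only [map_sub, hsq', neg_smul, one_smul]
        abel
  obtain ⟨w', hw', hsign, heig⟩ := exists_joint_eigenvector hsq hcomm Finset.univ hw
  replace hi := heig i _ hi
  replace hj := heig j _ hj
  set χ : Finset ι → ι → F := fun S k => if k ∈ S then -1 else 1 with hχ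
  have hneg : (-1 : F) ≠ 1 := by norm_num
  have hχinj : Function.Injective χ := by
    intro S T h
    ext k
    have hk := congrFun h k
    simp only [hχ] at hk
    split_ifs at hk <;> grind
  classical
  set S : Finset ι := {k | e k w' = -w'} with hS
  have hwS (k : ι) : e k w' = χ S k • w' := by
    by_cases hk : e k w' = -w'
    · simp [hχ, hS, hk]
    · simpa [hχ, hS, hk] using (hsign k (Finset.mem_univ k)).resolve_right hk
  have hjS : j ∈ S := by simpa [hS] using hj
  have hiS : i ∉ S := by
    intro h
    rw [hwS] at hi
    exact hneg (by simpa [hχ, h] using smul_left_injective F hw' hi)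
  have hcard : S.card + 1 ≤ Fintype.card ι := by
    have : S ⊂ Finset.univ := Finset.ssubset_univ_iff.2 fun h => hiS (h ▸ Finset.mem_univ i)
    simpa using Finset.card_lt_card this
  have horbit (T : Finset ι) (hT : T.card = S.card) :
      ∃ x : V, x ≠ 0 ∧ ∀ k, e k x = χ T k • x := by
    obtain ⟨σ, hσ⟩ : ∃ σ : Perm ι, ∀ k, σ k ∈ T ↔ k ∈ S := by
      have f : {k // k ∈ S} ≃ {k // k ∈ T} := Finset.equivOfCardEq hT.symm
      refine ⟨f.extendSubtype, fun k => ?_⟩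
      by_cases hk : k ∈ S
      · simpa [hk] using f.extendSubtype_mem k hk
      · simpa [hk] using f.extendSubtype_not_mem k hk
    obtain ⟨U, hU, hUe⟩ := hconj σ
    refine ⟨U w', fun h => hw' (hU (by rw [h, map_zero])), fun k => ?_⟩
    obtain ⟨l, rfl⟩ := σ.surjective k
    have h := LinearMap.congr_fun (hUe l) w'
    rw [Module.End.mul_apply, Module.End.mul_apply, hwS, map_smul] at h
    rw [← h]
    simp only [hχ, hσ]
  choose x hx0 hx using fun T : {T : Finset ι // T.card = S.card} => horbit T.1 T.2
  have hlin : LinearIndependent F x := linearIndependent_of_joint_eigenvectors hcomm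
    (χ := fun T => χ T.1) (fun _ _ h => Subtype.ext (hχinj h)) hx0 hx
  have hle := hlin.fintype_card_le_finrank
  rw [hdim, Fintype.card_finset_len] at hle
  rcases Nat.eq_one_or_succ_eq_of_choose_le (Finset.card_pos.2 ⟨j, hjS⟩) hcard hle with h | h
  · refine ⟨1, Or.inl rfl, fun k => x ⟨{k}, by simp [h]⟩, hlin.comp _ ?_, fun k l => ?_⟩
    · intro a b hab
      simpa using hab
    · rw [hx]
      simp [hχ, eq_comm]
  · refine ⟨-1, Or.inr rfl, fun k => x ⟨{k}ᶜ, by rw [Finset.card_compl]; simp; omega⟩,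
      hlin.comp _ ?_, fun k l => ?_⟩
    · intro a b hab
      simpa using hab
    · rw [hx]
      by_cases hkl : l = k <;> simp [hχ, hkl, Ne.symm]

theorem exists_pair_eigenvectors [CharZero F] {e : Module.End F V} (hsq : e * e = 1) (h1 : e ≠ 1)
    (hneg : e ≠ -1) : ∃ v : Fin 2 → V, LinearIndependent F v ∧
      ∀ j, e (v j) = (if j = 0 then (-1 : F) else 1) • v j := by
  have hsq' (x : V) : e (e x) = x := LinearMap.congr_fun hsq x
  obtain ⟨a, ha⟩ : ∃ a, e a ≠ a := by
    by_contra! h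
    exact h1 (LinearMap.ext h)
  obtain ⟨b, hb⟩ : ∃ b, e b ≠ -b := by
    by_contra! h
    exact hneg (LinearMap.ext h)
  have hev : ∀ j, e (![a - e a, b + e b] j) =
      (if j = 0 then (-1 : F) else 1) • ![a - e a, b + e b] j := by
    intro j
    fin_cases j
    · simp [hsq']
    · simp [hsq', add_comm]
  refine ⟨_, linearIndependent_of_joint_eigenvectors (e := fun _ : Unit => e)
    (χ := fun (j : Fin 2) _ => if j = 0 then (-1 : F) else 1) (fun _ _ => Commute.refl e) ?_ ?_
    (fun j _ => hev j), hev⟩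
  · intro j k h
    have := congrFun h ()
    have hne : (-1 : F) ≠ 1 := by norm_num
    fin_cases j <;> fin_cases k <;> simp_all [hne.symm]
  · intro j
    fin_cases j
    · simpa [sub_eq_zero] using ha.symm
    · simpa [add_eq_zero_iff_eq_neg'] using hb

end Involutions

section Reflections

variable {ι F : Type*} [Fintype ι] [DecidableEq ι] [Field F]

/-- The reflection changing the sign of the `i`-th coordinate. -/
def reflectionGL (F : Type*) [Field F] (i : ι) : GL ι F :=
  have h : diagonal (fun k : ι => if k = i then (-1 : F) else 1) *
      diagonal (fun k : ι => if k = i then (-1 : F) else 1) = 1 := by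
    rw [diagonal_mul_diagonal, ← diagonal_one]
    congr 1
    ext k
    split_ifs <;> simp
  ⟨_, _, h, h⟩

theorem coe_reflectionGL (i : ι) : (reflectionGL F i : Matrix ι ι F) =
    diagonal (fun k => if k = i then (-1 : F) else 1) := rfl

theorem reflectionGL_mul_self (i : ι) : reflectionGL F i * reflectionGL F i = 1 :=
  Units.ext (reflectionGL F i).val_inv

theorem reflectionGL_commute (i j : ι) : Commute (reflectionGL F i) (reflectionGL F j) := by
  refine Units.ext ?_
  simp only [Units.val_mul, coe_reflectionGL, diagonal_mul_diagonal, mul_comm]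

theorem permGL_mul_reflectionGL (σ : Perm ι) (i : ι) :
    permGL F σ * reflectionGL F i = reflectionGL F (σ i) * permGL F σ := by
  refine Units.ext ?_
  simp only [Units.val_mul, permGL_mul, mul_permGL, coe_reflectionGL]
  ext a b
  simp [diagonal_apply, Equiv.symm_apply_eq]

theorem exists_conj_eq_diagonal {A : GL ι F} {d : ι → F} {v : ι → ι → F}
    (hv : LinearIndependent F v) (hA : ∀ j, (A : Matrix ι ι F) *ᵥ v j = d j • v j) :
    ∃ R : GL ι F, (R : Matrix ι ι F) * A * ((R⁻¹ : GL ι F) : Matrix ι ι F) = diagonal d := by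
  obtain ⟨P, hP⟩ : IsUnit (of v)ᵀ := by
    rw [← linearIndependent_cols_iff_isUnit]
    exact hv
  refine ⟨P⁻¹, ?_⟩
  have hAP : (A : Matrix ι ι F) * P = P * diagonal d := by
    ext a b
    rw [mul_diagonal, hP]
    simpa [mul_apply, mulVec, dotProduct, mul_comm] using congrFun (hA b) a
  rw [inv_inv, mul_assoc, hAP, ← mul_assoc, ← Units.val_mul, inv_mul_cancel, Units.val_one,
    one_mul]

end Reflections

/-- Let `Φ : GL(n,F) → GL(n,F)` (`n ≥ 2`) be a nontrivial
multiplicative map with `Φ(I) = I`, and let `D` be (the invertible matrix)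
`D_1(−1) = diag(−1,1,…,1)`. Then `Φ(D)` is conjugate to `D_1(−1)` or to `−D_1(−1)`. -/
theorem image_of_D1_neg_one {F : Type*} [Field F] [CharZero F] {n : ℕ} (hn : 2 ≤ n)
    (Φ : GL (Fin n) F → GL (Fin n) F)
    (hmul : ∀ A B : GL (Fin n) F, Φ (A * B) = Φ A * Φ B)
    (h1 : Φ 1 = 1)
    (hnontriv : ∃ A : GL (Fin n) F, (A : Matrix (Fin n) (Fin n) F).det = 1 ∧ Φ A ≠ 1)
    (D : GL (Fin n) F)
    (hD : (D : Matrix (Fin n) (Fin n) F) =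
      Matrix.diagonal (fun i : Fin n => if (i : ℕ) = 0 then (-1 : F) else 1)) :
    ∃ R : GL (Fin n) F,
      (R : Matrix (Fin n) (Fin n) F) * (Φ D : Matrix (Fin n) (Fin n) F) *
          ((R⁻¹ : GL (Fin n) F) : Matrix (Fin n) (Fin n) F) =
        Matrix.diagonal (fun i : Fin n => if (i : ℕ) = 0 then (-1 : F) else 1) ∨
      (R : Matrix (Fin n) (Fin n) F) * (Φ D : Matrix (Fin n) (Fin n) F) *
          ((R⁻¹ : GL (Fin n) F) : Matrix (Fin n) (Fin n) F) =
        -Matrix.diagonal (fun i : Fin n => if (i : ℕ) = 0 then (-1 : F) else 1) := by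
  let φ : GL (Fin n) F →* GL (Fin n) F := ⟨⟨Φ, h1⟩, hmul⟩
  let i₀ : Fin n := ⟨0, by omega⟩
  let i₁ : Fin n := ⟨1, by omega⟩
  have hi : i₁ ≠ i₀ := by simp [i₀, i₁]
  have hfun : (fun i : Fin n => if (i : ℕ) = 0 then (-1 : F) else 1) =
      fun i => if i = i₀ then (-1 : F) else 1 := by
    ext i
    simp [i₀, Fin.ext_iff]
  rw [hfun] at hD ⊢
  obtain rfl : D = reflectionGL F i₀ := Units.ext hD
  have hneg : (-1 : F) ≠ 1 := by norm_num
  have hcentral {X : GL (Fin n) F} {x : Fin n → F}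
      (hX : (X : Matrix (Fin n) (Fin n) F) = diagonal x) {i j : Fin n} (hx : x i ≠ x j)
      (hcomm : ∀ A, Commute (φ X) (φ A)) : False := by
    obtain ⟨A, hA, hA1⟩ := hnontriv
    exact hA1 (map_eq_one_of_det_eq_one φ hX hx hcomm A hA)
  let lin : GL (Fin n) F →* Module.End F (Fin n → F) :=
    (toLinAlgEquiv' : Matrix (Fin n) (Fin n) F ≃ₐ[F] _).toMonoidHom.comp (Units.coeHom _)
  let e (i : Fin n) : Module.End F (Fin n → F) := lin (φ (reflectionGL F i))
  have hsq (i : Fin n) : e i * e i = 1 := by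
    simp only [e, ← map_mul, reflectionGL_mul_self, map_one]
  have hinj : Function.Injective lin :=
    (toLinAlgEquiv' : Matrix (Fin n) (Fin n) F ≃ₐ[F] _).injective.comp Units.val_injective
  have hrefl {j : Fin n} (hj : j ≠ i₀) :
      (if i₀ = i₀ then (-1 : F) else 1) ≠ if j = i₀ then (-1 : F) else 1 := by
    simpa [hj] using hneg
  by_cases hne : e i₀ = e i₁
  · have hne' : φ (reflectionGL F i₀) = φ (reflectionGL F i₁) := hinj hne
    rcases hn.eq_or_lt with rfl | hn
    · obtain ⟨v, hv, hev⟩ := exists_pair_eigenvectors (F := F) (hsq i₀)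
        (fun h => hcentral (coe_reflectionGL i₀) (hrefl hi) fun A => by
          have hA : φ (reflectionGL F i₀) = 1 := hinj (h.trans (map_one lin).symm)
          rw [hA]
          exact Commute.one_left _)
        (fun h => hcentral (coe_reflectionGL i₀) (hrefl hi) fun A => hinj <| by
          rw [map_mul, map_mul, show lin (φ (reflectionGL F i₀)) = -1 from h]
          exact (Commute.neg_one_left (lin (φ A))).eq)
      obtain ⟨R, hR⟩ := exists_conj_eq_diagonal hv hev
      exact ⟨R, Or.inl hR⟩
    · have hX : ((reflectionGL F i₀ * reflectionGL F i₁ : GL (Fin n) F) :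
          Matrix (Fin n) (Fin n) F) = diagonal fun k =>
            (if k = i₀ then (-1 : F) else 1) * if k = i₁ then (-1 : F) else 1 := by
        rw [Units.val_mul, coe_reflectionGL, coe_reflectionGL, diagonal_mul_diagonal]
      refine (hcentral hX (i := i₀) (j := ⟨2, hn⟩) ?_ fun A => ?_).elim
      · simpa [i₀, i₁] using hneg
      · rw [map_mul, ← hne', ← map_mul, reflectionGL_mul_self, map_one]
        exact Commute.one_left _
  · obtain ⟨ε, hε, v, hv, hev⟩ := exists_reflection_basis (by simp) hsq
      (fun i j => ((reflectionGL_commute i j).map φ).map lin)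
      (fun σ => ⟨lin (φ (permGL F σ)), mulVec_injective_of_isUnit (φ (permGL F σ)).isUnit,
        fun i => by simp only [e, ← map_mul, permGL_mul_reflectionGL]⟩) hne
    obtain ⟨R, hR⟩ := exists_conj_eq_diagonal hv (hev i₀)
    refine ⟨R, ?_⟩
    rcases hε with rfl | rfl
    · exact Or.inl (hR.trans (by simp only [one_mul]))
    · exact Or.inr (hR.trans (by simp only [neg_one_mul, diagonal_neg]))
end

section
/- Let F be a field of characteristic 0, let n ≥ 2, and let Φ : GL(n,F) → GL(n,F) be a multiplicative map with Φ(I_n) = I_n that is nontrivial, i.e., Φ(A) ≠ I_n for some A with det A = 1. Then there exist a ring homomorphism φ : F → F, an invertible matrix R ∈ GL(n,F), and a map λ : Fˣ → Fˣ with λ(xy) = λ(x)λ(y) for all x,y ∈ Fˣ, such that either (i) for every A = (a_ij) ∈ GL(n,F), Φ(A) = λ(det A) · R⁻¹ (φ(a_ij)) R, or (ii) for every A = (a_ij) ∈ GL(n,F), Φ(A) = λ(det A) · R⁻¹ (adjugate((φ(a_ij))))ᵀ R. Here (φ(a_ij)) denotes the matrix obtained by applying φ to each entry of A, and (adjugate(B))ᵀ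 = det(B)·(B⁻¹)ᵀ is the cofactor matrix of B. -/
namespace MultiplicativeMapsGL

open Matrix

section Generators

variable {ι F : Type*} [Fintype ι] [DecidableEq ι] [Field F]

/-- The elementary transvection `1 + t E_ij` as an element of `GL`. -/
def elem {i j : ι} (h : i ≠ j) (t : F) : GL ι F :=
  (SpecialLinearGroup.transvection h t : SpecialLinearGroup ι F)

/-- The invertible diagonal matrices. -/
def diagGL : (ι → Fˣ) →* GL ι F :=
  (Units.map (diagonalRingHom ι F).toMonoidHom).comp MulEquiv.piUnits.symm.toMonoidHom

/-- The permutation matrices. -/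
def permGL : Equiv.Perm ι →* GL ι F :=
  (permMatrixHom (R := F)).toHomUnits

theorem elem_val {i j : ι} (h : i ≠ j) (t : F) :
    (elem h t : Matrix ι ι F) = 1 + single i j t := rfl

theorem diagGL_val (d : ι → Fˣ) :
    (diagGL d : Matrix ι ι F) = diagonal (fun i => (d i : F)) := rfl

theorem permGL_val (σ : Equiv.Perm ι) :
    ((permGL σ : GL ι F) : Matrix ι ι F) = σ⁻¹.permMatrix F := rfl

theorem elem_mul_elem {i j : ι} (h : i ≠ j) (s t : F) :
    elem h s * elem h t = elem h (s + t) := by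
  apply Units.ext
  exact transvection_mul_transvection_same i j h s t

theorem elem_zero {i j : ι} (h : i ≠ j) : elem h (0 : F) = 1 := by
  apply Units.ext
  simp [elem_val]

theorem elem_inv {i j : ι} (h : i ≠ j) (t : F) : (elem h t)⁻¹ = elem h (-t) := by
  rw [inv_eq_iff_mul_eq_one, elem_mul_elem, add_neg_cancel, elem_zero]

theorem det_elem {i j : ι} (h : i ≠ j) (t : F) :
    GeneralLinearGroup.det (elem h t) = 1 := by
  apply Units.ext
  exact det_transvection_of_ne i j h t

theorem det_diagGL (d : ι → Fˣ) : GeneralLinearGroup.det (diagGL d) = ∏ i, d i := by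
  apply Units.ext
  simp [diagGL_val]

theorem diagGL_mul_elem (d : ι → Fˣ) {i j : ι} (h : i ≠ j) (t : F) :
    diagGL d * elem h t = elem h (d i * t * (d j : F)⁻¹) * diagGL d := by
  apply Units.ext
  simp only [Units.val_mul, diagGL_val, elem_val, mul_add, add_mul, mul_one, one_mul,
    add_right_inj]
  ext a b
  rw [diagonal_mul, mul_diagonal]
  simp only [single_apply]
  split_ifs with hab
  · obtain ⟨rfl, rfl⟩ := hab
    field_simp
  · simp

theorem permGL_mul_elem (σ : Equiv.Perm ι) {i j : ι} (h : i ≠ j) (t : F) :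
    (permGL σ : GL ι F) * elem h t = elem (σ.injective.ne h) t * permGL σ := by
  apply Units.ext
  simp only [Units.val_mul, permGL_val, elem_val, mul_add, add_mul, mul_one, one_mul,
    add_right_inj]
  ext a b
  rw [Equiv.Perm.permMatrix, PEquiv.toMatrix_toPEquiv_mul, PEquiv.mul_toMatrix_toPEquiv]
  simp only [submatrix_apply, single_apply, id]
  congr 1
  simp [Equiv.Perm.inv_def, Equiv.eq_symm_apply]

theorem permGL_mul_diagGL (σ : Equiv.Perm ι) (d : ι → Fˣ) :
    permGL σ * diagGL d = diagGL (d ∘ σ.symm) * permGL σ := by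
  apply Units.ext
  simp only [Units.val_mul, permGL_val, diagGL_val]
  ext a b
  rw [Equiv.Perm.permMatrix, PEquiv.toMatrix_toPEquiv_mul, PEquiv.mul_toMatrix_toPEquiv]
  simp only [submatrix_apply, diagonal_apply, id, Function.comp]
  by_cases hab : σ.symm a = b
  · simp [Equiv.Perm.inv_def, ← hab]
  · simp [Equiv.Perm.inv_def, hab, show a ≠ σ b by rwa [ne_eq, ← Equiv.symm_apply_eq]]

theorem elem_commutator {i j k : ι} (hij : i ≠ j) (hjk : j ≠ k) (hik : i ≠ k) (s t : F) :
    elem hij s * elem hjk t = elem hik (s * t) * elem hjk t * elem hij s := by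
  apply Units.ext
  simp [elem_val, mul_add, add_mul, hik.symm, hjk.symm]
  abel

theorem elem_braid {i j : ι} (h : i ≠ j) :
    elem h (1 : F) * elem h.symm (-1) * elem h 1 =
      elem h.symm (-1) * elem h 1 * elem h.symm (-1) := by
  have hs (a b : ι) (c : F) : single a b c = c • single a b (1 : F) := by simp
  apply Units.ext
  simp only [Units.val_mul, elem_val]
  rw [hs j i (-1)]
  simp [mul_add, add_mul, h, h.symm, -smul_single]
  module

theorem mulSingle_mul_elem_prod {i j : ι} (h : i ≠ j) (t : Fˣ) :
    elem h.symm ((t : F) - 1) * elem h 1 * diagGL (Pi.mulSingle i t) *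
      elem h.symm (1 - (t : F)) * elem h (-1) = diagGL (Pi.mulSingle j t) := by
  have hd (k : ι) : (diagGL (Pi.mulSingle k t) : Matrix ι ι F) = 1 + single k k ((t : F) - 1) := by
    ext a b
    rw [diagGL_val]
    by_cases hab : a = b
    · subst hab
      by_cases hak : a = k
      · subst hak; simp
      · simp [hak, Ne.symm hak]
    · simp [hab, one_apply, single_apply]
      rintro rfl rfl; exact absurd rfl hab
  have hs (a b : ι) (c : F) : single a b c = c • single a b (1 : F) := by simp
  apply Units.ext
  simp only [Units.val_mul, hd, elem_val]
  rw [hs j i, hs j i (1 - (t : F)), hs i i, hs j j, hs i j (-1)]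
  simp [mul_add, add_mul, h, h.symm, -smul_single]
  module

theorem GL_induction {P : GL ι F → Prop} (hd : ∀ d, P (diagGL d))
    (he : ∀ {i j : ι} (h : i ≠ j) (t : F), P (elem h t))
    (hmul : ∀ A B, P A → P B → P (A * B)) (A : GL ι F) : P A := by
  suffices H : ∀ B : GL ι F, (B : Matrix ι ι F) = A → P B from H A rfl
  refine diagonal_transvection_induction_of_det_ne_zero
    (fun M => ∀ B : GL ι F, (B : Matrix ι ι F) = M → P B) A (GeneralLinearGroup.det_ne_zero A)
    ?_ ?_ ?_
  · intro D hD B hB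
    have h0 : ∀ i, D i ≠ 0 := by simpa [Finset.prod_ne_zero_iff] using hD
    rw [show B = diagGL (fun i => Units.mk0 (D i) (h0 i)) from Units.ext (by simp [hB, diagGL_val])]
    exact hd _
  · rintro ⟨i, j, h, t⟩ B hB
    rw [show B = elem h t from Units.ext hB]
    exact he h t
  · intro M N hM hN h1 h2 B hB
    have : B = GeneralLinearGroup.mkOfDetNeZero M hM * GeneralLinearGroup.mkOfDetNeZero N hN :=
      Units.ext hB
    rw [this]
    exact hmul _ _ (h1 _ rfl) (h2 _ rfl)

/-- A homomorphism on `GL` killing the transvections factors through the determinant. -/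
theorem hom_eq_of_elem_eq_one {G : Type*} [Group G] (χ : GL ι F →* G)
    (hχ : ∀ {i j : ι} (h : i ≠ j) (t : F), χ (elem h t) = 1) (i₀ : ι) (A : GL ι F) :
    χ A = χ (diagGL (Pi.mulSingle i₀ (GeneralLinearGroup.det A))) := by
  have key (i : ι) (t : Fˣ) : χ (diagGL (Pi.mulSingle i t)) = χ (diagGL (Pi.mulSingle i₀ t)) := by
    by_cases h : i = i₀
    · rw [h]
    · rw [← mulSingle_mul_elem_prod h t]
      simp [hχ]
  let ψ : Fˣ →* G := (χ.comp diagGL).comp (MonoidHom.mulSingle (fun _ => Fˣ) i₀)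
  change χ A = ψ (GeneralLinearGroup.det A)
  induction A using GL_induction with
  | hd d =>
    have : χ.comp diagGL = (ψ.comp GeneralLinearGroup.det).comp diagGL := by
      refine MonoidHom.pi_ext fun i t => ?_
      simp only [MonoidHom.comp_apply, det_diagGL, key i t]
      simp only [Finset.prod_pi_mulSingle', Finset.mem_univ, if_true]
      rfl
    exact DFunLike.congr_fun this d
  | he h t => rw [hχ, det_elem, map_one]
  | hmul A B hA hB => rw [map_mul, map_mul, map_mul, hA, hB]

end Generators

section Scalar

variable {ι F : Type*} [Fintype ι] [DecidableEq ι] [Field F]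

theorem map_elem (φ : F →+* F) {i j : ι} (h : i ≠ j) (t : F) :
    GeneralLinearGroup.map φ (elem h t) = elem h (φ t) := by
  ext a b
  simp [elem_val, one_apply, single_apply, apply_ite φ]

theorem scalar_injective [Nonempty ι] :
    Function.Injective (GeneralLinearGroup.scalar ι : Fˣ → GL ι F) := by
  intro u v h
  obtain ⟨i⟩ := ‹Nonempty ι›
  have := congrArg (fun A : GL ι F => (A : Matrix ι ι F) i i) h
  simpa [GeneralLinearGroup.coe_scalar, Units.ext_iff] using this

theorem exists_scalar_mul {Φ : GL ι F →* GL ι F} {φ : F →+* F}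
    (hΦ : ∀ {i j : ι} (h : i ≠ j) (t : F), Φ (elem h t) = elem h (φ t)) (A : GL ι F) :
    ∃ u : Fˣ, Φ A = GeneralLinearGroup.scalar ι u * GeneralLinearGroup.map φ A := by
  induction A using GL_induction with
  | hd d =>
    suffices H : (GeneralLinearGroup.map φ (diagGL d))⁻¹ * Φ (diagGL d) ∈
        Subgroup.center (GL ι F) by
      rw [GeneralLinearGroup.center_eq_range_scalar] at H
      obtain ⟨u, hu⟩ := H
      exact ⟨u, by rw [GeneralLinearGroup.scalar_commute, hu, mul_inv_cancel_left]⟩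
    rw [GeneralLinearGroup.mem_center_iff_val_mem_range_scalar]
    refine mem_range_scalar_of_commute_single fun i j h => ?_
    have h1 := congrArg Φ (diagGL_mul_elem d h 1)
    have h2 := congrArg (GeneralLinearGroup.map φ) (diagGL_mul_elem d h 1)
    simp only [map_mul, hΦ, map_elem] at h1 h2
    have h3 : elem h (1 : F) * ((GeneralLinearGroup.map φ (diagGL d))⁻¹ * Φ (diagGL d)) =
        (GeneralLinearGroup.map φ (diagGL d))⁻¹ * Φ (diagGL d) * elem h (1 : F) := by
      rw [map_one] at h1 h2
      rw [mul_assoc, h1, ← mul_assoc, ← mul_assoc, mul_left_inj,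
        mul_inv_eq_iff_eq_mul, mul_assoc (GeneralLinearGroup.map φ (diagGL d))⁻¹, ← h2,
        inv_mul_cancel_left]
    have h4 := congrArg (fun A : GL ι F => (A : Matrix ι ι F)) h3
    simp only [Units.val_mul _ _, elem_val, add_mul, mul_add, one_mul, mul_one,
      add_right_inj] at h4
    exact h4
  | he h t => exact ⟨1, by simp [hΦ, map_elem]⟩
  | hmul A B hA hB =>
    obtain ⟨u, hu⟩ := hA
    obtain ⟨v, hv⟩ := hB
    refine ⟨u * v, ?_⟩
    rw [map_mul, map_mul, map_mul, hu, hv]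
    exact Commute.mul_mul_mul_comm (GeneralLinearGroup.scalar_commute v _).symm _ _

/-- A homomorphism on `GL` that agrees on transvections with the one induced by a ring
homomorphism differs from it by a character of the determinant. -/
theorem exists_character {Φ : GL ι F →* GL ι F} {φ : F →+* F} [Nonempty ι]
    (hΦ : ∀ {i j : ι} (h : i ≠ j) (t : F), Φ (elem h t) = elem h (φ t)) :
    ∃ lam : Fˣ →* Fˣ, ∀ A, Φ A = GeneralLinearGroup.scalar ι (lam (GeneralLinearGroup.det A)) *
      GeneralLinearGroup.map φ A := by
  choose c hc using exists_scalar_mul hΦ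
  let χ : GL ι F →* Fˣ := MonoidHom.mk' c fun A B => by
    apply scalar_injective (ι := ι)
    have h := hc (A * B)
    rw [map_mul, map_mul, hc A, hc B] at h
    rw [map_mul]
    apply mul_right_cancel (b := GeneralLinearGroup.map φ A * GeneralLinearGroup.map φ B)
    have hcomm : Commute (GeneralLinearGroup.scalar ι (c B)) (GeneralLinearGroup.map φ A) :=
      GeneralLinearGroup.scalar_commute _ _
    rw [← h, hcomm.mul_mul_mul_comm]
  let i₀ : ι := Classical.arbitrary ι
  refine ⟨(χ.comp diagGL).comp (MonoidHom.mulSingle (fun _ => Fˣ) i₀), fun A => ?_⟩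
  have key := hom_eq_of_elem_eq_one χ (fun {i j} h t => by
    apply scalar_injective (ι := ι)
    have h' := hc (elem h t)
    rw [hΦ, map_elem, right_eq_mul] at h'
    rw [map_one]
    exact h') i₀ A
  change _ = GeneralLinearGroup.scalar ι (χ (diagGL (Pi.mulSingle i₀ _))) * _
  rw [← key]
  exact hc A

end Scalar

section Monomial

theorem monomial_mul_apply {ι F : Type*} [Fintype ι] [Field F] {σ : Equiv.Perm ι} {M : Matrix ι ι F}
    (hM : ∀ a b, a ≠ σ b → M a b = 0) (X : Matrix ι ι F) (i j : ι) :
    (M * X) (σ i) j = M (σ i) i * X i j := by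
  rw [mul_apply]
  refine Fintype.sum_eq_single _ fun a ha => ?_
  rw [hM _ _ (σ.injective.ne ha.symm), zero_mul]

theorem mul_monomial_apply {ι F : Type*} [Fintype ι] [Field F] {σ : Equiv.Perm ι} {M : Matrix ι ι F}
    (hM : ∀ a b, a ≠ σ b → M a b = 0) (X : Matrix ι ι F) (i j : ι) :
    (X * M) i j = X i (σ j) * M (σ j) j := by
  rw [mul_apply]
  refine Fintype.sum_eq_single _ fun a ha => ?_
  rw [hM _ _ ha, mul_zero]

variable {ι F : Type*} [Fintype ι] [DecidableEq ι] [Field F]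

theorem monomial_ne_zero {σ : Equiv.Perm ι} {M : GL ι F}
    (hM : ∀ a b, a ≠ σ b → M a b = 0) (i : ι) : M (σ i) i ≠ 0 := by
  intro h
  have h1 := monomial_mul_apply hM (M⁻¹ : GL ι F).val i (σ i)
  rw [← Units.val_mul, mul_inv_cancel, h, zero_mul] at h1
  simp at h1

/-- The diagonal matrix with `-1` at `i` and `1` elsewhere. -/
def refl (i : ι) : GL ι F := diagGL (Pi.mulSingle i (-1))

theorem refl_val (i : ι) :
    ((refl i : GL ι F) : Matrix ι ι F) = diagonal fun a => if a = i then -1 else 1 := by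
  rw [refl, diagGL_val]
  congr 1
  ext a
  by_cases h : a = i
  · subst h; simp
  · simp [h]

theorem permGL_mul_refl (σ : Equiv.Perm ι) (i : ι) :
    (permGL σ : GL ι F) * refl i = refl (σ i) * permGL σ := by
  rw [refl, permGL_mul_diagGL, refl]
  congr 2
  ext a
  simp [Pi.mulSingle_apply, Equiv.symm_apply_eq]

theorem refl_mul_refl (i : ι) : refl i * refl i = (1 : GL ι F) := by
  rw [refl, ← map_mul, ← Pi.mulSingle_mul, neg_mul_neg, one_mul, Pi.mulSingle_one, map_one]

theorem refl_mul_diagGL (i : ι) (d : ι → Fˣ) :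
    refl i * diagGL d = diagGL d * refl i := by
  rw [refl, ← map_mul, ← map_mul, mul_comm]

theorem refl_mul_elem_of_ne {i j k : ι} (h : i ≠ j) (hi : i ≠ k) (hj : j ≠ k) (t : F) :
    refl k * elem h t = elem h t * refl k := by
  simp [refl, diagGL_mul_elem, hi, hj]

theorem refl_mul_elem_left {i j : ι} (h : i ≠ j) (t : F) :
    refl i * elem h t = elem h (-t) * refl i := by
  simp [refl, diagGL_mul_elem, h.symm]

theorem refl_mul_apply (i a b : ι) (X : Matrix ι ι F) :
    ((refl i : GL ι F).val * X) a b = if a = i then - X a b else X a b := by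
  rw [refl_val, diagonal_mul]
  split_ifs <;> simp

theorem mul_refl_apply (i a b : ι) (X : Matrix ι ι F) :
    (X * (refl i : GL ι F).val) a b = if b = i then - X a b else X a b := by
  rw [refl_val, mul_diagonal]
  split_ifs <;> simp

theorem refl_mul_of_hom {Φ : GL ι F →* GL ι F} {ε : Fˣ}
    (hΦ : ∀ i, Φ (refl i) = GeneralLinearGroup.scalar ι ε * refl i)
    {A B : GL ι F} {k l : ι} (h : refl k * A = B * refl l) :
    refl k * Φ A = Φ B * refl l := by
  have := congrArg Φ h
  rwa [map_mul, map_mul, hΦ, hΦ, ← mul_assoc, ← GeneralLinearGroup.scalar_commute, mul_assoc,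
    mul_assoc, mul_right_inj] at this

theorem refl_mul_apply_of_hom {Φ : GL ι F →* GL ι F} {ε : Fˣ}
    (hΦ : ∀ i, Φ (refl i) = GeneralLinearGroup.scalar ι ε * refl i)
    {A B : GL ι F} {k l : ι} (h : refl k * A = B * refl l) (a b : ι) :
    (if a = k then - Φ A a b else Φ A a b) = if b = l then - Φ B a b else Φ B a b := by
  have := congrArg (fun X : GL ι F => X.val a b) (refl_mul_of_hom hΦ h)
  simpa only [Units.val_mul, refl_mul_apply, mul_refl_apply] using this

end Monomial

section Normalized

variable {ι F : Type*} [Fintype ι] [DecidableEq ι] [Field F] [CharZero F]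
  {Φ : GL ι F →* GL ι F} {ε : Fˣ}

theorem permGL_apply_of_hom (hΦ : ∀ i, Φ (refl i) = GeneralLinearGroup.scalar ι ε * refl i)
    (σ : Equiv.Perm ι) (a b : ι) (hab : a ≠ σ b) : Φ (permGL σ) a b = 0 := by
  have := refl_mul_apply_of_hom hΦ (permGL_mul_refl σ b).symm a b
  simpa [hab, self_eq_neg] using this

theorem diagGL_apply_of_hom (hΦ : ∀ i, Φ (refl i) = GeneralLinearGroup.scalar ι ε * refl i)
    (d : ι → Fˣ) (a b : ι) (hab : a ≠ b) : Φ (diagGL d) a b = 0 := by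
  have := refl_mul_apply_of_hom hΦ (refl_mul_diagGL b d) a b
  simpa [hab, self_eq_neg] using this

theorem elem_apply_of_hom_of_ne (hΦ : ∀ i, Φ (refl i) = GeneralLinearGroup.scalar ι ε * refl i)
    {i j k l : ι} (h : i ≠ j) (hi : i ≠ k) (hj : j ≠ k) (hl : l ≠ k) (t : F) :
    Φ (elem h t) k l = 0 ∧ Φ (elem h t) l k = 0 := by
  constructor
  · have := refl_mul_apply_of_hom hΦ (refl_mul_elem_of_ne h hi hj t) k l
    simpa [hl, neg_eq_self] using this
  · have := refl_mul_apply_of_hom hΦ (refl_mul_elem_of_ne h hi hj t) l k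
    simpa [hl, self_eq_neg] using this

theorem elem_add_apply (hΦ : ∀ i, Φ (refl i) = GeneralLinearGroup.scalar ι ε * refl i)
    {i j : ι} (h : i ≠ j) (s t : F) {a b : ι} (ha : a = i ∨ a = j) :
    Φ (elem h (s + t)) a b =
      Φ (elem h s) a i * Φ (elem h t) i b + Φ (elem h s) a j * Φ (elem h t) j b := by
  rw [← elem_mul_elem, map_mul, Units.val_mul, mul_apply]
  refine Fintype.sum_eq_add i j h fun k hk => ?_
  rw [(elem_apply_of_hom_of_ne hΦ h hk.1.symm hk.2.symm (l := a) (by grind) s).2, zero_mul]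

theorem elem_smul_diag_apply (hΦ : ∀ i, Φ (refl i) = GeneralLinearGroup.scalar ι ε * refl i)
    {i j : ι} (h : i ≠ j) (u : Fˣ) (t : F) (a b : ι) :
    Φ (diagGL (Pi.mulSingle i u)) a a * Φ (elem h t) a b =
      Φ (elem h (u * t)) a b * Φ (diagGL (Pi.mulSingle i u)) b b := by
  have h1 := congrArg Φ (diagGL_mul_elem (Pi.mulSingle i u) h t)
  simp only [map_mul, Pi.mulSingle_eq_same, Pi.mulSingle_eq_of_ne h.symm, Units.val_one, inv_one,
    mul_one] at h1
  have h2 := congrArg (fun X : GL ι F => X.val a b) h1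
  have h3 := diagGL_apply_of_hom hΦ (Pi.mulSingle i u)
  simp only [Units.val_mul] at h2
  exact (monomial_mul_apply (σ := 1) h3 _ a b).symm.trans
    (h2.trans (mul_monomial_apply (σ := 1) h3 _ a b))

theorem elem_val_of_hom (hΦ : ∀ i, Φ (refl i) = GeneralLinearGroup.scalar ι ε * refl i)
    {i j : ι} (h : i ≠ j) (t : F) :
    (Φ (elem h t)).val =
      1 + single i j (Φ (elem h t) i j) + single j i (Φ (elem h t) j i) := by
  have hneg (t : F) (a b : ι) := refl_mul_apply_of_hom hΦ (refl_mul_elem_left h t) a b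
  have hadd (s t : F) (a b : ι) (ha : a = i ∨ a = j) := elem_add_apply hΦ h s t (b := b) ha
  have hzero (a : ι) : Φ (elem h 0) a a = 1 := by simp [elem_zero]
  have hscale (u : Fˣ) (t : F) (a : ι) : Φ (elem h (u * t)) a a = Φ (elem h t) a a := by
    have h1 := elem_smul_diag_apply hΦ h u t a a
    have h2 := monomial_ne_zero (σ := 1) (diagGL_apply_of_hom hΦ (Pi.mulSingle i u)) a
    rw [mul_comm] at h1
    exact (mul_right_cancel₀ h2 h1).symm
  have hki (s t : F) (k : ι) (hi : k ≠ i) (hj : k ≠ j) :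
      Φ (elem h (s + t)) k k = Φ (elem h s) k k * Φ (elem h t) k k := by
    rw [← elem_mul_elem, map_mul, Units.val_mul, mul_apply]
    refine Fintype.sum_eq_single k fun l hl => ?_
    rw [(elem_apply_of_hom_of_ne hΦ h hi.symm hj.symm hl s).1, zero_mul]
  -- the determinant of the `2 × 2` block is one
  have hdet (t : F) (a : ι) (ha : a = i ∨ a = j) :
      Φ (elem h t) a a ^ 2 - Φ (elem h t) i j * Φ (elem h t) j i = 1 := by
    have h0 := hadd t (-t) a a ha
    rw [add_neg_cancel, hzero] at h0
    have n1 := hneg t i i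
    have n2 := hneg t i j
    have n3 := hneg t j i
    have n4 := hneg t j j
    simp only [if_true, if_neg h.symm, neg_inj] at n1 n2 n3 n4
    rcases ha with rfl | rfl
    · linear_combination -h0 + Φ (elem h t) a a * n1 - Φ (elem h t) a j * n3
    · linear_combination -h0 + Φ (elem h t) a a * n4 + Φ (elem h t) a i * n2
  have hij (t : F) : Φ (elem h t) i i = Φ (elem h t) j j := by
    have h1 := hadd (t / 2) (t / 2) i i (.inl rfl)
    have h2 := hadd (t / 2) (t / 2) j j (.inr rfl)
    have h3 := hdet (t / 2) i (.inl rfl)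
    have h4 := hdet (t / 2) j (.inr rfl)
    rw [add_halves] at h1 h2
    linear_combination h1 - h2 + h3 - h4
  have hone (t : F) : Φ (elem h t) i i = 1 := by
    have h2 := hscale (Units.mk0 2 two_ne_zero) t i
    have h3 := hscale (Units.mk0 3 three_ne_zero) t i
    simp only [Units.val_mk0] at h2 h3
    have a1 := hadd t t i i (.inl rfl)
    have a2 := hadd t t i j (.inl rfl)
    have a3 := hadd (2 * t) t i i (.inl rfl)
    rw [← two_mul] at a1 a2
    rw [show 2 * t + t = 3 * t by ring] at a3
    have d1 := hdet t i (.inl rfl)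
    have e1 := hij t
    rw [h3, h2, a2, ← e1] at a3
    rw [h2] at a1
    grind
  have hk1 (t : F) (k : ι) (hi : k ≠ i) (hj : k ≠ j) : Φ (elem h t) k k = 1 := by
    have h1 := hki (t / 2) (t / 2) k hi hj
    have h2 := hki (t / 2) (-(t / 2)) k hi hj
    have n := hneg (t / 2) k k
    simp only [if_neg hi] at n
    rw [add_halves] at h1
    rw [add_neg_cancel, hzero, ← n] at h2
    rw [h1, h2]
  ext a b
  simp only [Matrix.add_apply, one_apply, single_apply]
  by_cases hab : a = b
  · subst hab
    have : Φ (elem h t) a a = 1 := by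
      by_cases hi : a = i
      · rw [hi, hone]
      by_cases hj : a = j
      · rw [hj, ← hij, hone]
      exact hk1 t a hi hj
    rw [this]
    grind
  · by_cases hi : i = a ∧ j = b
    · grind
    by_cases hj : j = a ∧ i = b
    · grind
    by_cases ha : a = i ∨ a = j
    · have := (elem_apply_of_hom_of_ne hΦ h (k := b) (l := a) (by grind) (by grind) hab t).2
      rw [this]
      grind
    · have := (elem_apply_of_hom_of_ne hΦ h (k := a) (l := b) (by grind) (by grind)
        (Ne.symm hab) t).1
      rw [this]
      grind

end Normalized

section Standard

theorem exists_perm_apply_eq {ι : Type*} [DecidableEq ι] {i j k l : ι} (h : i ≠ j) (h' : k ≠ l) :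
    ∃ σ : Equiv.Perm ι, σ i = k ∧ σ j = l := by
  refine ⟨Equiv.swap (Equiv.swap i k j) l * Equiv.swap i k, ?_, ?_⟩
  · have h1 : k ≠ Equiv.swap i k j := by
      rw [← Equiv.swap_apply_left i k, Equiv.swap_apply_left]
      intro h2
      exact h ((Equiv.swap i k).injective ((Equiv.swap_apply_left i k).trans h2))
    simp [Equiv.swap_apply_of_ne_of_ne h1 h']
  · simp

variable {ι F : Type*} [Fintype ι] [DecidableEq ι] [Field F]

theorem elem_injective {i j : ι} (h : i ≠ j) :
    Function.Injective (elem h : F → GL ι F) := by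
  intro s t hst
  have := congrArg (fun X : GL ι F => X.val i j) hst
  simpa [elem_val, h] using this

theorem mul_eq_neg_one_of_braid {i j : ι} (h : i ≠ j) {x y : F} (hx : x ≠ 0)
    (hb : elem h x * elem h.symm y * elem h x = elem h.symm y * elem h x * elem h.symm y) :
    x * y = -1 := by
  have h1 := congrArg (fun X : GL ι F => X.val i j) hb
  simp [elem_val, mul_add, add_mul, h, h.symm] at h1
  apply mul_left_cancel₀ hx
  linear_combination h1

theorem eq_mul_of_commutator {i j k : ι} (hij : i ≠ j) (hjk : j ≠ k) (hik : i ≠ k) {s t u : F}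
    (hc : elem hij s * elem hjk t = elem hik u * elem hjk t * elem hij s) : u = s * t := by
  rw [elem_commutator hij hjk hik, mul_left_inj, mul_left_inj] at hc
  exact (elem_injective hik hc).symm

variable [CharZero F] {Φ : GL ι F →* GL ι F} {ε : Fˣ}

theorem permGL_elem_apply (hΦ : ∀ i, Φ (refl i) = GeneralLinearGroup.scalar ι ε * refl i)
    (σ : Equiv.Perm ι) {i j : ι} (h : i ≠ j) (t : F) (a b : ι) :
    Φ (permGL σ) (σ a) a * Φ (elem h t) a b =
      Φ (elem (σ.injective.ne h) t) (σ a) (σ b) * Φ (permGL σ) (σ b) b := by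
  have h1 := congrArg Φ (permGL_mul_elem σ h t)
  have h2 := congrArg (fun X : GL ι F => X.val (σ a) b) h1
  have h3 := permGL_apply_of_hom hΦ σ
  simp only [map_mul, Units.val_mul] at h2
  exact (monomial_mul_apply h3 _ a b).symm.trans (h2.trans (mul_monomial_apply h3 _ (σ a) b))

theorem elem_apply_self_of_hom (hΦ : ∀ i, Φ (refl i) = GeneralLinearGroup.scalar ι ε * refl i)
    {i j : ι} (h : i ≠ j) (t : F) (a : ι) : Φ (elem h t) a a = 1 := by
  rw [elem_val_of_hom hΦ]
  simp [single_apply]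
  grind

theorem elem_add_apply_off (hΦ : ∀ i, Φ (refl i) = GeneralLinearGroup.scalar ι ε * refl i)
    {i j : ι} (h : i ≠ j) (s t : F) :
    Φ (elem h (s + t)) i j = Φ (elem h s) i j + Φ (elem h t) i j ∧
      Φ (elem h s) i j * Φ (elem h t) j i = 0 := by
  have h1 := elem_add_apply hΦ h s t (a := i) (b := j) (.inl rfl)
  have h2 := elem_add_apply hΦ h s t (a := i) (b := i) (.inl rfl)
  simp only [elem_apply_self_of_hom hΦ] at h1 h2
  exact ⟨by linear_combination h1, by linear_combination -h2⟩

theorem exists_ringHom_elem (hΦ : ∀ i, Φ (refl i) = GeneralLinearGroup.scalar ι ε * refl i)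
    {i₀ j₀ : ι} (h₀ : i₀ ≠ j₀) (hb : Φ (elem h₀ 1) i₀ j₀ ≠ 0) :
    ∃ φ : F →+* F, ∀ {i j : ι} (h : i ≠ j), Φ (elem h 1) i j ≠ 0 ∧
      ∀ t, Φ (elem h t) = elem h (Φ (elem h 1) i j * φ t) := by
  set b : F → F := fun t => Φ (elem h₀ t) i₀ j₀ with hbdef
  change b 1 ≠ 0 at hb
  have hadd (s t : F) : b (s + t) = b s + b t := (elem_add_apply_off hΦ h₀ s t).1
  have hzero : b 0 = 0 := by simpa using hadd 0 0
  have hc (t : F) : Φ (elem h₀ t) j₀ i₀ = 0 :=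
    (mul_eq_zero.mp (elem_add_apply_off hΦ h₀ 1 t).2).resolve_left hb
  have hmul (s t : F) : b (s * t) * b 1 = b s * b t := by
    by_cases hs : s = 0
    · simp [hs, hzero]
    · have h1 := elem_smul_diag_apply hΦ h₀ (Units.mk0 s hs) t i₀ j₀
      have h2 := elem_smul_diag_apply hΦ h₀ (Units.mk0 s hs) 1 i₀ j₀
      have h3 := monomial_ne_zero (σ := 1)
        (diagGL_apply_of_hom hΦ (Pi.mulSingle i₀ (Units.mk0 s hs))) j₀
      rw [Equiv.Perm.one_apply] at h3
      simp only [Units.val_mk0, mul_one] at h1 h2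
      apply mul_right_cancel₀ h3
      linear_combination b t * h2 - b 1 * h1
  let φ : F →+* F :=
    { toFun := fun t => b t / b 1
      map_one' := div_self hb
      map_zero' := by rw [hzero, zero_div]
      map_add' := fun s t => by rw [hadd, add_div]
      map_mul' := fun s t => by
        rw [div_mul_div_comm, ← hmul, mul_div_mul_right _ _ hb] }
  refine ⟨φ, fun {i j} h => ?_⟩
  obtain ⟨σ, rfl, rfl⟩ := exists_perm_apply_eq h₀ h
  have hm (a : ι) := monomial_ne_zero (permGL_apply_of_hom hΦ σ) a
  have hB (t : F) := permGL_elem_apply hΦ σ h₀ t i₀ j₀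
  refine ⟨fun h0 => ?_, fun t => ?_⟩
  · have := hB 1
    rw [h0, zero_mul] at this
    exact (mul_ne_zero (hm i₀) hb) this
  · have hC := permGL_elem_apply hΦ σ h₀ t j₀ i₀
    rw [hc, mul_zero, eq_comm, mul_eq_zero, or_iff_left (hm i₀)] at hC
    have hkey : Φ (elem h t) (σ i₀) (σ j₀) = Φ (elem h 1) (σ i₀) (σ j₀) * φ t := by
      apply mul_right_cancel₀ (hm j₀)
      rw [mul_right_comm, ← hB t, ← hB 1]
      change _ * b t = _ * b 1 * (b t / b 1)
      field_simp
    apply Units.ext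
    rw [elem_val_of_hom hΦ, elem_val, hC, hkey]
    simp

theorem exists_conj_of_refl (hΦ : ∀ i, Φ (refl i) = GeneralLinearGroup.scalar ι ε * refl i)
    {i₀ j₀ : ι} (h₀ : i₀ ≠ j₀) (hb : Φ (elem h₀ 1) i₀ j₀ ≠ 0) :
    ∃ (φ : F →+* F) (R : GL ι F) (lam : Fˣ →* Fˣ), ∀ A,
      Φ A = GeneralLinearGroup.scalar ι (lam (GeneralLinearGroup.det A)) *
        (R⁻¹ * GeneralLinearGroup.map φ A * R) := by
  obtain ⟨φ, hφ⟩ := exists_ringHom_elem hΦ h₀ hb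
  let β (i j : ι) : Fˣ := if h : i ≠ j then Units.mk0 _ (hφ h).1 else 1
  have hβ {i j : ι} (h : i ≠ j) (t : F) : Φ (elem h t) = elem h (β i j * φ t) := by
    rw [(hφ h).2]
    simp [β, h]
  have hbraid {i j : ι} (h : i ≠ j) : β i j * β j i = 1 := by
    have h1 := congrArg Φ (elem_braid (F := F) h)
    simp only [map_mul, hβ, map_neg, map_one, mul_one] at h1
    have h2 := mul_eq_neg_one_of_braid h (β i j).ne_zero h1
    apply Units.ext
    push_cast
    linear_combination -h2
  have hcomm {i j k : ι} (hij : i ≠ j) (hjk : j ≠ k) (hik : i ≠ k) :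
      β i k = β i j * β j k := by
    have h1 := congrArg Φ (elem_commutator hij hjk hik (1 : F) 1)
    simp only [map_mul, hβ, map_one, mul_one] at h1
    exact Units.ext (eq_mul_of_commutator hij hjk hik h1)
  have hβ₀ : β i₀ i₀ = 1 := by simp [β]
  have hcob {i j : ι} (h : i ≠ j) : β i j * β j i₀ = β i i₀ := by
    by_cases hj : j = i₀
    · rw [hj, hβ₀, mul_one]
    by_cases hi : i = i₀
    · rw [hi, hβ₀, hbraid (Ne.symm hj)]
    · exact (hcomm h hj hi).symm
  let D : GL ι F := diagGL fun i => β i i₀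
  have hD {i j : ι} (h : i ≠ j) (t : F) : D⁻¹ * Φ (elem h t) * D = elem h (φ t) := by
    rw [mul_assoc, inv_mul_eq_iff_eq_mul, diagGL_mul_elem, hβ, ← hcob h]
    push_cast
    congr 2
    field_simp
  have : Nonempty ι := ⟨i₀⟩
  obtain ⟨lam, hlam⟩ := exists_character (Φ := (MulAut.conj D⁻¹).toMonoidHom.comp Φ) (φ := φ)
    (fun h t => by simpa using hD h t)
  refine ⟨φ, D⁻¹, lam, fun A => ?_⟩
  have h1 := hlam A
  simp only [MonoidHom.comp_apply, MulEquiv.toMonoidHom_eq_coe, MonoidHom.coe_coe,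
    MulAut.conj_apply, inv_inv] at h1
  rw [inv_inv, ← mul_assoc, ← mul_assoc, GeneralLinearGroup.scalar_commute, mul_assoc D, ← h1]
  group

end Standard

section Contragredient

variable {ι F : Type*} [Fintype ι] [DecidableEq ι] [Field F]

/-- The contragredient automorphism `A ↦ (A⁻¹)ᵀ`. -/
def contragredient : GL ι F →* GL ι F :=
  MonoidHom.mk' (fun A => ⟨(A⁻¹).valᵀ, A.valᵀ,
      by rw [← transpose_mul, ← Units.val_mul, mul_inv_cancel, Units.val_one, transpose_one],
      by rw [← transpose_mul, ← Units.val_mul, inv_mul_cancel, Units.val_one, transpose_one]⟩)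
    fun A B => by
      apply Units.ext
      simp only [_root_.mul_inv_rev, Units.val_mul, transpose_mul]

theorem contragredient_val (A : GL ι F) : (contragredient A).val = (A⁻¹).valᵀ := rfl

theorem contragredient_contragredient (A : GL ι F) : contragredient (contragredient A) = A := by
  apply Units.ext
  rw [contragredient_val, ← map_inv, contragredient_val, inv_inv, transpose_transpose]

theorem contragredient_scalar (u : Fˣ) :
    contragredient (GeneralLinearGroup.scalar ι u) = GeneralLinearGroup.scalar ι u⁻¹ := by
  apply Units.ext
  rw [contragredient_val, ← map_inv, GeneralLinearGroup.coe_scalar]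
  ext a b
  simp [scalar_apply, diagonal_apply, eq_comm]

theorem contragredient_refl (i : ι) : contragredient (refl i : GL ι F) = refl i := by
  have h : (refl i : GL ι F)⁻¹ = refl i := by
    rw [refl, ← map_inv, ← Pi.mulSingle_inv, inv_neg, inv_one]
  apply Units.ext
  rw [contragredient_val, h, refl_val, diagonal_transpose]

/-- The cofactor matrix is the contragredient up to the determinant. -/
theorem adjugate_transpose_eq (A : GL ι F) :
    (adjugate A.val)ᵀ = (GeneralLinearGroup.det A : F) • (contragredient A).val := by
  rw [contragredient_val, ← transpose_smul]
  congr 1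
  have h1 := congrArg (· * (A⁻¹).val) (adjugate_mul A.val)
  simp only [mul_assoc, smul_mul, one_mul] at h1
  rwa [← Units.val_mul, mul_inv_cancel, Units.val_one, mul_one] at h1

theorem elem_eq_one_of_elem_eq_one {G : Type*} [Group G] (Φ : GL ι F →* G) {i j : ι} (h : i ≠ j)
    {t : F} (ht : t ≠ 0) (hΦ : Φ (elem h t) = 1) {k l : ι} (h' : k ≠ l) (s : F) :
    Φ (elem h' s) = 1 := by
  obtain ⟨σ, rfl, rfl⟩ := exists_perm_apply_eq h h'
  by_cases hs : s = 0
  · rw [hs, elem_zero, map_one]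
  have h1 : Φ (elem h s) = 1 := by
    have h2 := congrArg Φ
      (diagGL_mul_elem (Pi.mulSingle i (Units.mk0 (s / t) (div_ne_zero hs ht))) h t)
    simpa [Pi.mulSingle_eq_of_ne h.symm, ht, hΦ] using h2
  have h2 := congrArg Φ (permGL_mul_elem σ h s)
  simpa [h1] using h2

theorem elem_ne_one {G : Type*} [Group G] (Φ : GL ι F →* G) {A : GL ι F}
    (hA : GeneralLinearGroup.det A = 1) (hΦ : Φ A ≠ 1) {i j : ι} (h : i ≠ j) {t : F}
    (ht : t ≠ 0) : Φ (elem h t) ≠ 1 := by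
  intro h1
  apply hΦ
  rw [hom_eq_of_elem_eq_one Φ (fun h' s => elem_eq_one_of_elem_eq_one Φ h ht h1 h' s) i A, hA]
  simp

variable [CharZero F] {Φ : GL ι F →* GL ι F} {ε : Fˣ}

theorem exists_conj_contragredient_of_refl
    (hΦ : ∀ i, Φ (refl i) = GeneralLinearGroup.scalar ι ε * refl i)
    {i₀ j₀ : ι} (h₀ : i₀ ≠ j₀) (hb : Φ (elem h₀ 1) j₀ i₀ ≠ 0) :
    ∃ (φ : F →+* F) (R : GL ι F) (lam : Fˣ →* Fˣ), ∀ A,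
      Φ A = GeneralLinearGroup.scalar ι (lam (GeneralLinearGroup.det A)) *
        (R⁻¹ * contragredient (GeneralLinearGroup.map φ A) * R) := by
  obtain ⟨φ, R, lam, h⟩ := exists_conj_of_refl (Φ := contragredient.comp Φ) (ε := ε⁻¹)
    (fun i => by simp [hΦ, contragredient_scalar, contragredient_refl]) h₀ (by
      rw [MonoidHom.comp_apply, contragredient_val, ← map_inv, elem_inv, transpose_apply]
      intro h0
      apply hb
      have h1 := (elem_add_apply_off hΦ h₀ 1 (-1)).2
      have h2 := elem_add_apply hΦ h₀ 1 (-1) (a := j₀) (b := i₀) (.inr rfl)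
      rw [add_neg_cancel, elem_zero, map_one, elem_apply_self_of_hom hΦ,
        elem_apply_self_of_hom hΦ, h0] at h2
      simpa [h₀.symm] using h2.symm)
  refine ⟨φ, contragredient R, lam⁻¹, fun A => ?_⟩
  rw [← contragredient_contragredient (Φ A)]
  have := h A
  simp only [MonoidHom.comp_apply] at this
  simp [this, contragredient_scalar]

/-- Normal form of the homomorphisms that respect the diagonal reflections up to a scalar. -/
theorem exists_normal_form_of_refl
    (hΦ : ∀ i, Φ (refl i) = GeneralLinearGroup.scalar ι ε * refl i)
    {i₀ j₀ : ι} (h₀ : i₀ ≠ j₀) (h1 : Φ (elem h₀ 1) ≠ 1) :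
    ∃ (φ : F →+* F) (R : GL ι F) (lam : Fˣ →* Fˣ),
      (∀ A, Φ A = GeneralLinearGroup.scalar ι (lam (GeneralLinearGroup.det A)) *
        (R⁻¹ * GeneralLinearGroup.map φ A * R)) ∨
      (∀ A, Φ A = GeneralLinearGroup.scalar ι (lam (GeneralLinearGroup.det A)) *
        (R⁻¹ * contragredient (GeneralLinearGroup.map φ A) * R)) := by
  by_cases hb : Φ (elem h₀ 1) i₀ j₀ = 0
  · by_cases hc : Φ (elem h₀ 1) j₀ i₀ = 0
    · exact absurd (Units.ext (by rw [elem_val_of_hom hΦ, hb, hc]; simp)) h1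
    · obtain ⟨φ, R, lam, h⟩ := exists_conj_contragredient_of_refl hΦ h₀ hc
      exact ⟨φ, R, lam, .inr h⟩
  · obtain ⟨φ, R, lam, h⟩ := exists_conj_of_refl hΦ h₀ hb
    exact ⟨φ, R, lam, .inl h⟩

end Contragredient

section Collapse

variable {ι F : Type*} [Fintype ι] [DecidableEq ι] [Field F] [CharZero F]

theorem elem_eq_one_of_commGroup {G : Type*} [CommGroup G] (χ : GL ι F →* G) {i j : ι}
    (h : i ≠ j) (t : F) : χ (elem h t) = 1 := by
  have h1 := congrArg χ (diagGL_mul_elem (Pi.mulSingle i (Units.mk0 2 two_ne_zero)) h t)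
  simp only [Pi.mulSingle_eq_same, Pi.mulSingle_eq_of_ne h.symm, Units.val_mk0, Units.val_one,
    inv_one, mul_one, two_mul, ← elem_mul_elem, map_mul] at h1
  rw [mul_comm, mul_left_inj, right_eq_mul] at h1
  exact h1

theorem exists_refl_ne_of_ne {G : Type*} [Group G] (Φ : GL ι F →* G) {i j k : ι} (h : i ≠ j)
    (hi : i ≠ k) (hj : j ≠ k) (hΦ : ∀ t : F, t ≠ 0 → Φ (elem h t) ≠ 1) :
    Φ (refl i) ≠ Φ (refl k) := by
  intro hik
  have h1 := congrArg Φ (refl_mul_elem_left h (1 : F))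
  have h2 := congrArg Φ (refl_mul_elem_of_ne h hi hj (1 : F))
  rw [map_mul, map_mul] at h1 h2
  rw [hik, h2, mul_left_inj] at h1
  apply hΦ (1 + 1) (by norm_num)
  rw [← elem_mul_elem, map_mul]
  nth_rw 1 [h1]
  rw [← map_mul, elem_mul_elem, neg_add_cancel, elem_zero, map_one]

theorem scalar_of_sq_eq_one {M : Matrix (Fin 2) (Fin 2) F} (h : M * M = 1) (hdet : M.det = 1) :
    M ∈ Set.range (scalar (Fin 2)) := by
  have h00 := congrFun₂ h 0 0
  have h01 := congrFun₂ h 0 1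
  have h10 := congrFun₂ h 1 0
  have h11 := congrFun₂ h 1 1
  simp [mul_apply, Fin.sum_univ_two] at h00 h01 h10 h11
  rw [det_fin_two] at hdet
  have e0 : M 0 0 * (M 0 0 + M 1 1) = 2 := by linear_combination h00 + hdet
  have e1 : M 1 1 * (M 0 0 + M 1 1) = 2 := by linear_combination h11 + hdet
  have hne : M 0 0 + M 1 1 ≠ 0 := fun h0 => by simp [h0] at e0
  have b0 : M 0 1 = 0 := mul_right_cancel₀ hne (by linear_combination h01)
  have c0 : M 1 0 = 0 := mul_right_cancel₀ hne (by linear_combination h10)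
  have ad : M 1 1 = M 0 0 := mul_right_cancel₀ hne (e1.trans e0.symm)
  refine ⟨M 0 0, ?_⟩
  ext a b
  fin_cases a <;> fin_cases b <;> simp [b0, c0, ad]

theorem refl_ne_of_fin_two (Φ : GL (Fin 2) F →* GL (Fin 2) F) {i j : Fin 2} (h : i ≠ j)
    (hΦ : ∀ t : F, t ≠ 0 → Φ (elem h.symm t) ≠ 1) : Φ (refl i) ≠ Φ (refl j) := by
  intro hij
  have hw : (elem h (1 : F) * elem h.symm (-1) * elem h 1) *
      (elem h (1 : F) * elem h.symm (-1) * elem h 1) = refl i * refl j := by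
    apply Units.ext
    simp only [Units.val_mul, elem_val, refl_val]
    ext a b
    fin_cases i <;> fin_cases j <;> first | exact absurd rfl h | skip
    all_goals fin_cases a <;> fin_cases b <;>
      simp [mul_apply, Fin.sum_univ_two, one_apply, single_apply]
  set X := elem h (1 : F) with hX
  set Y := elem h.symm (-1 : F) with hY
  have hsq : Φ (X * Y * X) * Φ (X * Y * X) = 1 := by
    rw [← map_mul, hw, map_mul, hij, ← map_mul, refl_mul_refl, map_one]
  have hdet : GeneralLinearGroup.det (Φ (X * Y * X)) = 1 := by
    change (GeneralLinearGroup.det.comp Φ) (X * Y * X) = 1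
    rw [map_mul, map_mul, hX, hY, elem_eq_one_of_commGroup, elem_eq_one_of_commGroup, mul_one,
      mul_one]
  have hcen : Φ (X * Y * X) ∈ Subgroup.center (GL (Fin 2) F) := by
    rw [GeneralLinearGroup.mem_center_iff_val_mem_range_scalar]
    exact scalar_of_sq_eq_one (congrArg Units.val hsq) (congrArg Units.val hdet)
  have hXY : Φ X = Φ Y := by
    have h1 : Φ (X * Y * X) * Φ X = Φ Y * Φ (X * Y * X) := by
      rw [← map_mul, ← map_mul]
      have hb : X * Y * X = Y * X * Y := elem_braid h
      nth_rw 1 [hb]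
      simp only [mul_assoc]
    rw [Subgroup.mem_center_iff.mp hcen (Φ Y), mul_right_inj] at h1
    exact h1
  have h2 : Φ (elem h (2 : F)) = Φ (elem h.symm (-(2 : F)⁻¹)) := by
    have d1 := congrArg Φ (diagGL_mul_elem (Pi.mulSingle i (Units.mk0 2 two_ne_zero)) h (1 : F))
    have d2 := congrArg Φ
      (diagGL_mul_elem (Pi.mulSingle i (Units.mk0 2 two_ne_zero)) h.symm (-1 : F))
    rw [map_mul, map_mul, ← hX, hXY] at d1
    rw [map_mul, map_mul, ← hY, d1, mul_left_inj] at d2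
    simpa [Pi.mulSingle_eq_of_ne h.symm] using d2
  have h3 : Φ (elem h (2 : F)) = Φ (elem h.symm (-2)) := by
    rw [show (2 : F) = 1 + 1 by norm_num, ← elem_mul_elem, map_mul, ← hX, hXY, ← map_mul, hY,
      elem_mul_elem]
    congr 2
    norm_num
  apply hΦ (2 - (2 : F)⁻¹) (by norm_num)
  rw [sub_eq_add_neg, ← elem_mul_elem, map_mul, ← h2, h3, ← map_mul, elem_mul_elem,
    add_neg_cancel, elem_zero, map_one]

end Collapse

section Weights

theorem lt_choose {n k : ℕ} (hk : 2 ≤ k) (hn : k + 2 ≤ n) : n < n.choose k := by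
  obtain ⟨m, rfl⟩ := Nat.exists_eq_add_of_le hn
  clear hn
  induction m with
  | zero =>
    rw [add_zero, Nat.choose_symm_add, Nat.choose_two_right, ← Nat.succ_le_iff,
      Nat.le_div_iff_mul_le two_pos]
    change (k + 3) * 2 ≤ (k + 2) * (k + 1)
    nlinarith
  | succ m ih =>
    obtain ⟨l, rfl⟩ : ∃ l, k = l + 1 := ⟨k - 1, by omega⟩
    rw [← add_assoc, Nat.choose_succ_succ']
    have : 0 < (l + 1 + 2 + m).choose l := Nat.choose_pos (by omega)
    omega

theorem exists_common_eigenvector {F V κ : Type*} [Field F] [CharZero F] [AddCommGroup V]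
    [Module F V] (T : κ → Module.End F V) (hT : ∀ i, T i * T i = 1)
    (hcomm : ∀ i j, Commute (T i) (T j)) (s : Finset κ) (W : Submodule F V) (hW : W ≠ ⊥)
    (hinv : ∀ i, ∀ v ∈ W, T i v ∈ W) :
    ∃ v ∈ W, v ≠ 0 ∧ ∀ i ∈ s, T i v = v ∨ T i v = -v := by
  classical
  induction s using Finset.induction_on with
  | empty =>
    obtain ⟨v, hv, h0⟩ := W.exists_mem_ne_zero_of_ne_bot hW
    exact ⟨v, hv, h0, by simp⟩
  | insert k s _ ih =>
    obtain ⟨v, hv, h0, h⟩ := ih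
    by_cases hk : T k v = -v
    · exact ⟨v, hv, h0, by simpa [hk] using h⟩
    · refine ⟨v + T k v, W.add_mem hv (hinv k v hv), fun h1 => hk ?_, fun i hi => ?_⟩
      · exact (neg_eq_of_add_eq_zero_right h1).symm
      · rcases Finset.mem_insert.mp hi with rfl | hi
        · left
          rw [map_add, ← Module.End.mul_apply, hT, Module.End.one_apply, add_comm]
        · have h2 : T i (T k v) = T k (T i v) := LinearMap.congr_fun (hcomm i k) v
          rcases h i hi with h3 | h3
          · left; rw [map_add, h2, h3]
          · right; rw [map_add, h2, h3, map_neg, neg_add]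

theorem linearIndependent_of_weight {F V κ α : Type*} [Field F] [AddCommGroup V]
    [Module F V] {T : κ → Module.End F V} (hcomm : ∀ i j, Commute (T i) (T j))
    {χ : α → κ → F} (hχ : Function.Injective χ) {v : α → V} (hv : ∀ a, v a ≠ 0)
    (h : ∀ a i, T i (v a) = χ a i • v a) : LinearIndependent F v := by
  have hind := Module.End.independent_iInf_maxGenEigenspace_of_forall_mapsTo T
    fun i j φ => Module.End.mapsTo_maxGenEigenspace_of_comm (hcomm j i) φ
  refine (hind.comp hχ).linearIndependent _ (fun a => ?_) hv
  simp only [Function.comp, Submodule.mem_iInf]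
  intro i
  exact (Module.End.genEigenspace (T i) (χ a i)).monotone le_top
    (Module.End.mem_eigenspace_iff.mpr (h a i))

theorem weight_injective {ι F : Type*} [DecidableEq ι] [Field F] [CharZero F] :
    Function.Injective fun (s : Finset ι) (i : ι) => if i ∈ s then (-1 : F) else 1 := by
  intro s t hst
  ext i
  have := congrFun hst i
  by_cases hs : i ∈ s <;> by_cases ht : i ∈ t <;> simp [hs, ht, self_eq_neg, neg_eq_self] at this ⊢

variable {ι F : Type*} [Fintype ι] [DecidableEq ι] [Field F]

/-- `IsWeight Φ s v`: the vector `v` is negated by `Φ (refl i)` for `i ∈ s` and fixed by it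
for `i ∉ s`. -/
def IsWeight (Φ : GL ι F →* GL ι F) (s : Finset ι) (v : ι → F) : Prop :=
  v ≠ 0 ∧ ∀ i, (Φ (refl i)).val *ᵥ v = (if i ∈ s then (-1 : F) else 1) • v

theorem IsWeight.map {Φ : GL ι F →* GL ι F} {s : Finset ι} {v : ι → F} (h : IsWeight Φ s v)
    (σ : Equiv.Perm ι) :
    IsWeight Φ (s.map σ.toEmbedding) ((Φ (permGL σ)).val *ᵥ v) := by
  refine ⟨fun h0 => h.1 ?_, fun i => ?_⟩
  · have h1 := congrArg ((Φ (permGL σ))⁻¹.val *ᵥ ·) h0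
    simpa only [mulVec_mulVec, ← Units.val_mul, inv_mul_cancel, Units.val_one, one_mulVec,
      mulVec_zero] using h1
  · have h1 := permGL_mul_refl (F := F) σ (σ.symm i)
    rw [Equiv.apply_symm_apply] at h1
    rw [mulVec_mulVec, ← Units.val_mul, ← map_mul, ← h1, map_mul, Units.val_mul,
      ← mulVec_mulVec, h.2, mulVec_smul]
    simp [Finset.mem_map_equiv]

theorem commute_toLin'_refl (Φ : GL ι F →* GL ι F) (i j : ι) :
    Commute (toLin' (Φ (refl i)).val) (toLin' (Φ (refl j)).val) := by
  have h1 : Commute (refl i : GL ι F) (refl j) := refl_mul_diagGL i _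
  have h2 := congrArg Units.val (h1.map Φ).eq
  exact ((toLin'_mul _ _).symm.trans (congrArg toLin' h2)).trans (toLin'_mul _ _)

theorem linearIndependent_isWeight [CharZero F] {Φ : GL ι F →* GL ι F} {α : Type*}
    {s : α → Finset ι} (hs : Function.Injective s) {v : α → ι → F}
    (h : ∀ a, IsWeight Φ (s a) (v a)) : LinearIndependent F v := by
  refine linearIndependent_of_weight (T := fun i => toLin' (Φ (refl i)).val) (commute_toLin'_refl Φ)
    (weight_injective.comp hs) (fun a => (h a).1) (fun a i => (h a).2 i)

theorem exists_isWeight [CharZero F] {Φ : GL ι F →* GL ι F} {i j : ι}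
    (hij : Φ (refl i) ≠ Φ (refl j)) :
    ∃ s v, IsWeight Φ s v ∧ s ≠ ∅ ∧ s ≠ Finset.univ := by
  let T : ι → Module.End F (ι → F) := fun i => toLin' (Φ (refl i)).val
  have hT (i : ι) : T i * T i = 1 := by
    have h1 : (Φ (refl i)).val * (Φ (refl i)).val = 1 := by
      rw [← Units.val_mul, ← map_mul, refl_mul_refl, map_one, Units.val_one]
    change toLin' _ ∘ₗ toLin' _ = _
    rw [← toLin'_mul, h1, toLin'_one]
    rfl
  have hcomm (i j : ι) : Commute (T i) (T j) := commute_toLin'_refl Φ i j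
  have hW : LinearMap.range (T i - T j) ≠ ⊥ := by
    rw [ne_eq, LinearMap.range_eq_bot, sub_eq_zero]
    exact fun h0 => hij (Units.ext (toLin'.injective h0))
  obtain ⟨v, hv, h0, h⟩ := exists_common_eigenvector T hT hcomm Finset.univ _ hW (by
    rintro k _ ⟨w, rfl⟩
    exact ⟨T k w, LinearMap.congr_fun ((hcomm k i).sub_right (hcomm k j)).eq.symm w⟩)
  have hsum : T i v + T j v = 0 := by
    obtain ⟨w, rfl⟩ := hv
    have h1 : (T i + T j) * (T i - T j) = 0 := by
      rw [add_mul, mul_sub, mul_sub, hT, hT, (hcomm i j).eq]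
      abel
    exact LinearMap.congr_fun h1 w
  have hnn : ¬ (v + v = 0) := by rwa [← two_nsmul, smul_eq_zero_iff_right two_ne_zero]
  have hne : v ≠ -v := fun h1 => hnn (eq_neg_iff_add_eq_zero.mp h1)
  classical
  refine ⟨Finset.univ.filter fun k => T k v = -v, v, ⟨h0, fun k => ?_⟩, fun hs => ?_, fun hs => ?_⟩
  · change T k v = _
    by_cases hk : T k v = -v
    · simp [hk]
    · simp [(h k (Finset.mem_univ k)).resolve_right hk]
  · have hk (k : ι) : T k v = v :=
      (h k (Finset.mem_univ k)).resolve_right fun hk => by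
        have : k ∈ (∅ : Finset ι) := hs ▸ Finset.mem_filter.mpr ⟨Finset.mem_univ k, hk⟩
        simp at this
    rw [hk, hk] at hsum
    exact hnn hsum
  · have hk (k : ι) : T k v = -v :=
      (Finset.mem_filter.mp (hs.symm ▸ Finset.mem_univ k :
        k ∈ Finset.univ.filter fun k => T k v = -v)).2
    rw [hk, hk, ← neg_add, neg_eq_zero] at hsum
    exact hnn hsum

theorem exists_isWeight_of_card_eq {Φ : GL ι F →* GL ι F} {s t : Finset ι} {v : ι → F}
    (h : IsWeight Φ s v) (hst : t.card = s.card) : ∃ w, IsWeight Φ t w := by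
  obtain ⟨σ, hσ⟩ : ∃ σ : Equiv.Perm ι, s.map σ.toEmbedding = t := by
    let e : {x // x ∈ s} ≃ {x // x ∈ t} := Finset.equivOfCardEq hst.symm
    refine ⟨e.extendSubtype, Finset.eq_of_subset_of_card_le (fun x hx => ?_) (by simp [hst])⟩
    obtain ⟨y, hy, rfl⟩ := Finset.mem_map.mp hx
    exact e.extendSubtype_mem y hy
  exact hσ ▸ ⟨_, h.map σ⟩

theorem card_eq_of_isWeight [CharZero F] {Φ : GL ι F →* GL ι F} {s : Finset ι} {v : ι → F}
    (h : IsWeight Φ s v) (h0 : s ≠ ∅) (h1 : s ≠ Finset.univ) :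
    s.card = 1 ∨ s.card + 1 = Fintype.card ι := by
  have hpos : 0 < s.card := Finset.card_pos.mpr (Finset.nonempty_iff_ne_empty.mpr h0)
  have hlt : s.card < Fintype.card ι := (Finset.card_lt_iff_ne_univ s).mpr h1
  by_contra! hc
  have hw (t : Finset.powersetCard s.card (Finset.univ : Finset ι)) : ∃ w, IsWeight Φ t.1 w :=
    exists_isWeight_of_card_eq h (Finset.mem_powersetCard.mp t.2).2
  choose w hw using hw
  have hli := (linearIndependent_isWeight Subtype.val_injective hw).fintype_card_le_finrank
  rw [Fintype.card_coe, Finset.card_powersetCard, Finset.card_univ,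
    Module.finrank_fintype_fun_eq_card] at hli
  exact hli.not_gt (lt_choose (by omega) (by omega))

/-- Up to conjugation and a sign, `Φ` fixes all the diagonal reflections. -/
theorem exists_conj_refl [CharZero F] {Φ : GL ι F →* GL ι F} {i j : ι}
    (hij : Φ (refl i) ≠ Φ (refl j)) :
    ∃ (S : GL ι F) (ε : Fˣ), ∀ k,
      S⁻¹ * Φ (refl k) * S = GeneralLinearGroup.scalar ι ε * refl k := by
  obtain ⟨s, v, h, h0, h1⟩ := exists_isWeight hij
  obtain ⟨ε, t, ht, hcard, hmem⟩ : ∃ (ε : Fˣ) (t : ι → Finset ι), Function.Injective t ∧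
      (∀ a, (t a).card = s.card) ∧
      ∀ a k, (if k ∈ t a then (-1 : F) else 1) = ε * if a = k then -1 else 1 := by
    rcases card_eq_of_isWeight h h0 h1 with hs | hs
    · exact ⟨1, fun a => {a}, Finset.singleton_injective,
        fun a => by rw [hs, Finset.card_singleton],
        fun a k => by simp [eq_comm]⟩
    · refine ⟨-1, fun a => {a}ᶜ, compl_injective.comp Finset.singleton_injective, fun a => ?_,
        fun a k => ?_⟩
      · rw [Finset.card_compl, Finset.card_singleton]
        omega
      · by_cases hk : a = k <;> simp [hk, eq_comm]
  choose w hw using fun a => exists_isWeight_of_card_eq h (hcard a)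
  have hli := linearIndependent_isWeight ht hw
  let S : GL ι F := ((linearIndependent_cols_iff_isUnit (A := (of w)ᵀ)).mp hli).unit
  have hS (a b : ι) : S a b = w b a := rfl
  refine ⟨S, ε, fun k => ?_⟩
  rw [mul_assoc, inv_mul_eq_iff_eq_mul, ← mul_assoc, ← GeneralLinearGroup.scalar_commute, mul_assoc]
  ext a b
  have := congrFun ((hw b).2 k) a
  rw [Units.val_mul, Units.val_mul, GeneralLinearGroup.coe_scalar, scalar_apply, diagonal_mul,
    Units.val_mul, mul_refl_apply, hS]
  rw [hmem] at this
  refine Eq.trans this ?_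
  simp only [Pi.smul_apply, smul_eq_mul]
  split_ifs <;> ring

end Weights

section Classification

theorem exists_refl_ne {F : Type*} [Field F] [CharZero F] {n : ℕ} (hn : 2 ≤ n)
    (Φ : GL (Fin n) F →* GL (Fin n) F)
    (hΦ : ∀ {i j : Fin n} (h : i ≠ j) (t : F), t ≠ 0 → Φ (elem h t) ≠ 1) :
    ∃ i j, Φ (refl i) ≠ Φ (refl j) := by
  obtain rfl | hn := hn.eq_or_lt
  · exact ⟨0, 1, refl_ne_of_fin_two Φ zero_ne_one (hΦ _)⟩
  · have h : (⟨0, by omega⟩ : Fin n) ≠ ⟨1, by omega⟩ := by simp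
    exact ⟨⟨0, by omega⟩, ⟨2, hn⟩,
      exists_refl_ne_of_ne Φ h (by simp) (by simp) (hΦ h)⟩

theorem exists_normal_form {ι F : Type*} [Fintype ι] [DecidableEq ι] [Field F] [CharZero F]
    {Φ : GL ι F →* GL ι F} (hΦ : ∀ {i j : ι} (h : i ≠ j) (t : F), t ≠ 0 → Φ (elem h t) ≠ 1)
    {i j : ι} (hij : Φ (refl i) ≠ Φ (refl j)) :
    ∃ (φ : F →+* F) (R : GL ι F) (lam : Fˣ →* Fˣ),
      (∀ A, Φ A = GeneralLinearGroup.scalar ι (lam (GeneralLinearGroup.det A)) *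
        (R⁻¹ * GeneralLinearGroup.map φ A * R)) ∨
      (∀ A, Φ A = GeneralLinearGroup.scalar ι (lam (GeneralLinearGroup.det A)) *
        (R⁻¹ * contragredient (GeneralLinearGroup.map φ A) * R)) := by
  obtain ⟨S, ε, hS⟩ := exists_conj_refl hij
  let Ψ : GL ι F →* GL ι F := (MulAut.conj S⁻¹).toMonoidHom.comp Φ
  have hΨ (A : GL ι F) : Ψ A = S⁻¹ * Φ A * S := by simp [Ψ]
  have hback {A B : GL ι F} {R : GL ι F} {u : Fˣ}
      (h : Ψ A = GeneralLinearGroup.scalar ι u * (R⁻¹ * B * R)) :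
      Φ A = GeneralLinearGroup.scalar ι u * ((R * S⁻¹)⁻¹ * B * (R * S⁻¹)) := by
    rw [hΨ, mul_assoc, inv_mul_eq_iff_eq_mul, ← mul_assoc, ← GeneralLinearGroup.scalar_commute,
      ← eq_mul_inv_iff_mul_eq] at h
    rw [h]
    group
  have h₀ : i ≠ j := fun h => hij (by rw [h])
  obtain ⟨φ, R, lam, h⟩ := exists_normal_form_of_refl (Φ := Ψ) (ε := ε)
    (fun k => (hΨ _).trans (hS k)) h₀ (fun h1 => hΦ h₀ 1 one_ne_zero (by
      rw [hΨ, mul_assoc, inv_mul_eq_one] at h1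
      exact (right_eq_mul.mp h1)))
  exact ⟨φ, R * S⁻¹, lam, h.imp (fun h A => hback (h A)) fun h A => hback (h A)⟩

theorem scalar_mul_val {ι F : Type*} [Fintype ι] [DecidableEq ι] [Field F] (u : Fˣ) (A : GL ι F) :
    (GeneralLinearGroup.scalar ι u * A).val = (u : F) • A.val := by
  rw [Units.val_mul, GeneralLinearGroup.coe_scalar, scalar_apply, ← smul_eq_diagonal_mul]

end Classification

end MultiplicativeMapsGL

open MultiplicativeMapsGL in
/-- Classification of nontrivial multiplicative maps on `GL(n,F)`,
`n ≥ 2`: `Φ(A) = λ(det A) · R⁻¹ (φ(a_ij)) R` or `Φ(A) = λ(det A) · R⁻¹ (adj(φ(a_ij)))ᵀ R`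
for a ring homomorphism `φ : F → F`, some `R ∈ GL(n,F)`, and a multiplicative
`λ : Fˣ → Fˣ`. -/
theorem classification_of_multiplicative_maps_GL {F : Type*} [Field F] [CharZero F]
    {n : ℕ} (hn : 2 ≤ n)
    (Φ : GL (Fin n) F → GL (Fin n) F)
    (hmul : ∀ A B : GL (Fin n) F, Φ (A * B) = Φ A * Φ B)
    (h1 : Φ 1 = 1)
    (hnontriv : ∃ A : GL (Fin n) F, (A : Matrix (Fin n) (Fin n) F).det = 1 ∧ Φ A ≠ 1) :
    ∃ (φ : F →+* F) (R : GL (Fin n) F) (lam : Fˣ → Fˣ),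
      (∀ x y : Fˣ, lam (x * y) = lam x * lam y) ∧
      ((∀ A : GL (Fin n) F,
          (Φ A : Matrix (Fin n) (Fin n) F) =
            ((lam (Matrix.GeneralLinearGroup.det A) : Fˣ) : F) •
              (((R⁻¹ : GL (Fin n) F) : Matrix (Fin n) (Fin n) F) *
                (A : Matrix (Fin n) (Fin n) F).map φ *
                (R : Matrix (Fin n) (Fin n) F))) ∨
        (∀ A : GL (Fin n) F,
          (Φ A : Matrix (Fin n) (Fin n) F) =
            ((lam (Matrix.GeneralLinearGroup.det A) : Fˣ) : F) •
              (((R⁻¹ : GL (Fin n) F) : Matrix (Fin n) (Fin n) F) *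
                (Matrix.adjugate ((A : Matrix (Fin n) (Fin n) F).map φ)).transpose *
                (R : Matrix (Fin n) (Fin n) F)))) := by
  obtain ⟨B, hB, hΦB⟩ := hnontriv
  let Ψ : GL (Fin n) F →* GL (Fin n) F := ⟨⟨Φ, h1⟩, hmul⟩
  have hΨ {i j : Fin n} (h : i ≠ j) (t : F) (ht : t ≠ 0) : Ψ (elem h t) ≠ 1 :=
    elem_ne_one Ψ (Units.ext hB) hΦB h ht
  obtain ⟨i, j, hij⟩ := exists_refl_ne hn Ψ hΨ
  obtain ⟨φ, R, lam, h | h⟩ := exists_normal_form hΨ hij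
  · refine ⟨φ, R, lam, map_mul lam, .inl fun A => ?_⟩
    exact (congrArg Units.val (h A)).trans (scalar_mul_val _ _)
  · refine ⟨φ, R, fun x => lam x * (Units.map (φ : F →* F) x)⁻¹, fun x y => ?_, .inr fun A => ?_⟩
    · simp only [map_mul, mul_inv]
      exact mul_mul_mul_comm _ _ _ _
    · refine (congrArg Units.val (h A)).trans ((scalar_mul_val _ _).trans ?_)
      have hadj := adjugate_transpose_eq (Matrix.GeneralLinearGroup.map φ A)
      rw [Matrix.GeneralLinearGroup.map_det] at hadj
      change (Matrix.adjugate ((A : Matrix (Fin n) (Fin n) F).map φ)).transpose = _ at hadj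
      rw [hadj, Matrix.mul_smul, Matrix.smul_mul, smul_smul]
      beta_reduce
      rw [Units.val_mul (lam _), Units.inv_mul_cancel_right]
      rfl
end

section
/- Let F be a field of characteristic 0, let n ≥ 2, and let Φ : M_n(F) → M_n(F) be a multiplicative map with Φ(0) = 0 and Φ(I_n) = I_n that is non-degenerate, i.e., there exists a singular matrix A (det A = 0) with Φ(A) ≠ 0. Then there exist a ring homomorphism φ : F → F and an invertible matrix R ∈ GL(n,F) such that either (i) for every A = (a_ij) ∈ M_n(F), Φ(A) = R⁻¹ (φ(a_ij)) R, or (ii) for every A = (a_ij) ∈ M_n(F), Φ(A) = R⁻¹ (adjugate((φ(a_ij))))ᵀ R. Here (φ(a_ij)) denotes the matrix obtained by applying φ to each entry of A, and (adjugate(B))ᵀ is the cofactor matrix of B. -/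
section

open Matrix

theorem lt_choose_of_two_le {n k : ℕ} (hk : 2 ≤ k) (hkn : k + 2 ≤ n) : n < n.choose k := by
  induction n generalizing k with
  | zero => omega
  | succ n ih =>
    obtain ⟨k, rfl⟩ : ∃ l, k = l + 1 := ⟨k - 1, by omega⟩
    rw [Nat.choose_succ_succ']
    have h₁ : 0 < n.choose k := Nat.choose_pos (by omega)
    have h₂ : 0 < n.choose (k + 1) := Nat.choose_pos (by omega)
    by_cases h : k + 3 ≤ n
    · have := ih hk h
      omega
    · by_cases h' : 2 ≤ k
      · have := ih h' (by omega)
        omega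
      · obtain rfl : k = 1 := by omega
        obtain rfl : n = 3 := by omega
        decide

/-- At most `n` nonzero pairwise orthogonal idempotents fit in the `n × n` matrices. -/
theorem card_le_of_orthogonal_idempotents {F ι : Type*} [Field F] [Fintype ι] {n : ℕ}
    (e : ι → Matrix (Fin n) (Fin n) F) (hne : ∀ i, e i ≠ 0) (hidem : ∀ i, e i * e i = e i)
    (horth : ∀ i j, i ≠ j → e i * e j = 0) : Fintype.card ι ≤ n := by
  classical
  have hv : ∀ i, ∃ w, e i *ᵥ w ≠ 0 := by
    intro i
    by_contra! h
    exact hne i (Matrix.ext_of_mulVec_single fun j => by rw [h, zero_mulVec])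
  choose w hw using hv
  have hli : LinearIndependent F fun i => e i *ᵥ w i := by
    rw [Fintype.linearIndependent_iff]
    intro g hg i
    have h := congrArg (fun x => e i *ᵥ x) hg
    simp only [Matrix.mulVec_sum, Matrix.mulVec_smul, Matrix.mulVec_mulVec,
      Matrix.mulVec_zero] at h
    rw [Finset.sum_eq_single i (fun j _ hj => by simp [horth i j hj.symm]) (by simp), hidem] at h
    exact (smul_eq_zero.mp h).resolve_right (hw i)
  simpa using hli.fintype_card_le_finrank

/-- Any nonzero system of `n × n` matrix units is conjugate to the standard one. -/
theorem exists_conj_single_of_matrixUnits {F : Type*} [Field F] {n : ℕ}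
    (e : Fin n → Fin n → Matrix (Fin n) (Fin n) F)
    (hmul : ∀ i j l, e i j * e j l = e i l)
    (horth : ∀ i j k l, j ≠ k → e i j * e k l = 0) (hne : ∃ i j, e i j ≠ 0) :
    ∃ R : (Matrix (Fin n) (Fin n) F)ˣ, ∀ i j,
      (R : Matrix (Fin n) (Fin n) F) * e i j * (↑R⁻¹ : Matrix (Fin n) (Fin n) F)
        = Matrix.single i j 1 := by
  obtain ⟨i₀, j₀, hne⟩ := hne
  obtain ⟨w, hw⟩ : ∃ w, e i₀ j₀ *ᵥ w ≠ 0 := by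
    by_contra! h
    exact hne (Matrix.ext_of_mulVec_single fun j => by rw [h, zero_mulVec])
  have hact : ∀ i j l, e i j *ᵥ (e l j₀ *ᵥ w) = if j = l then e i j₀ *ᵥ w else 0 := by
    intro i j l
    split_ifs with h
    · rw [h, Matrix.mulVec_mulVec, hmul]
    · rw [Matrix.mulVec_mulVec, horth _ _ _ _ h, Matrix.zero_mulVec]
  let Q : Matrix (Fin n) (Fin n) F := Matrix.of fun a i => (e i j₀ *ᵥ w) a
  have hQ : IsUnit Q := by
    rw [← Matrix.linearIndependent_cols_iff_isUnit]
    change LinearIndependent F fun i => e i j₀ *ᵥ w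
    rw [Fintype.linearIndependent_iff]
    intro g hg i
    have h := congrArg (fun x => e i₀ i *ᵥ x) hg
    simp only [Matrix.mulVec_sum, Matrix.mulVec_smul, Matrix.mulVec_zero, hact] at h
    simpa [hw] using h
  obtain ⟨U, hU⟩ := hQ
  have hcomm : ∀ i j, e i j * Q = Q * Matrix.single i j 1 := by
    intro i j
    refine Matrix.ext_of_mulVec_single fun l => ?_
    rw [← Matrix.mulVec_mulVec, ← Matrix.mulVec_mulVec]
    have hcol : ∀ l, Q *ᵥ Pi.single l 1 = e l j₀ *ᵥ w := by
      intro l; ext a; simp [Q]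
    rw [hcol, hact]
    split_ifs with h
    · subst h
      rw [← hcol i]; congr 1; ext a; simp [Matrix.single, Pi.single_apply, eq_comm]
    · have : Matrix.single i j (1:F) *ᵥ Pi.single l 1 = 0 := by
        ext a; simp [Matrix.single, h]
      simp [this]
  refine ⟨U⁻¹, fun i j => ?_⟩
  rw [inv_inv, hU, mul_assoc, hcomm, ← hU, ← mul_assoc, Units.inv_mul, one_mul]

/-- A multiplicative function on matrices that kills the singular ones factors through the
determinant. -/
theorem exists_eq_comp_det {F : Type*} [Field F] [CharZero F] {m : ℕ}
    (f : Matrix (Fin (m + 1)) (Fin (m + 1)) F → F) (hmul : ∀ A B, f (A * B) = f A * f B)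
    (h1 : f 1 = 1) (hsing : ∀ A, A.det = 0 → f A = 0) :
    ∃ g : F → F, ∀ A, f A = g A.det := by
  let s : Fin (m + 1) → F → Matrix (Fin (m + 1)) (Fin (m + 1)) F :=
    fun i x => diagonal (Function.update 1 i x)
  obtain ⟨g, hg⟩ : ∃ g : F → F, ∀ x, g x = f (s 0 x) := ⟨_, fun _ => rfl⟩
  have hs : ∀ i x, f (s i x) = g x := by
    intro i x
    have hPs : swap F 0 i * s i x * swap F 0 i = s 0 x := by
      ext a b
      simp only [swap, PEquiv.toMatrix_toPEquiv_mul, PEquiv.mul_toMatrix_toPEquiv,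
        submatrix_apply, id, s, diagonal_apply, Equiv.symm_swap, EmbeddingLike.apply_eq_iff_eq,
        Function.update_apply]
      by_cases h : a = 0
      · simp [h]
      · have : Equiv.swap 0 i a ≠ i := by simpa [Equiv.swap_apply_eq_iff] using h
        simp [h, this]
    have hP : f (swap F 0 i) * f (swap F 0 i) = 1 := by rw [← hmul, swap_mul_self, h1]
    rw [hg, ← hPs, hmul, hmul, mul_right_comm, hP, one_mul]
  have hgmul : ∀ x y, g (x * y) = g x * g y := by
    intro x y
    rw [hg, hg, hg, ← hmul, diagonal_mul_diagonal]
    refine congrArg (fun d => f (diagonal d)) (funext fun a => ?_)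
    by_cases h : a = 0 <;> simp [h]
  have hg1 : g 1 = 1 := by
    have : Function.update (1 : Fin (m + 1) → F) 0 1 = 1 :=
      Function.update_eq_self 0 (1 : Fin (m + 1) → F)
    rw [hg]
    simp only [s, this]
    exact h1
  refine ⟨g, fun A => ?_⟩
  by_cases hA : A.det = 0
  · rw [hsing A hA, hA, hg, hsing]
    rw [det_diagonal]
    exact Finset.prod_eq_zero (Finset.mem_univ 0) (by simp)
  refine Matrix.diagonal_transvection_induction_of_det_ne_zero (fun A => f A = g A.det) A hA
    (fun D _ => ?_) (fun t => ?_) (fun A B _ _ ihA ihB => ?_)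
  · have key : ∀ T : Finset (Fin (m + 1)), f (diagonal fun i => if i ∈ T then D i else 1)
        = g (∏ i ∈ T, D i) := by
      intro T
      induction T using Finset.induction_on with
      | empty => simp [hg1, h1]
      | insert a T ha ih =>
        rw [Finset.prod_insert ha, hgmul, ← ih, ← hs a, ← hmul, diagonal_mul_diagonal]
        congr 2
        ext b
        by_cases h : b = a
        · subst h; simp [ha]
        · simp [h]
    simpa using key Finset.univ
  · have hne : ∀ B C, B * C = 1 → f B ≠ 0 := fun B C h hB => by
      simpa [hB, h1, h] using hmul B C
    have h2 : s t.i 2 * t.toMatrix = t.toMatrix * t.toMatrix * s t.i 2 := by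
      obtain ⟨i, j, hij, c⟩ := t
      simp only [TransvectionStruct.toMatrix, transvection_mul_transvection_same i j hij]
      ext a b
      simp only [s, diagonal_mul, mul_diagonal, transvection, Matrix.add_apply, one_apply,
        single_apply, Function.update_apply, Pi.one_apply]
      grind
    have h := congrArg f h2
    rw [hmul, hmul, hmul, mul_comm] at h
    have h' := mul_right_cancel₀ (hne (s t.i 2) (s t.i 2⁻¹) (by
      rw [diagonal_mul_diagonal, ← diagonal_one]
      congr 1
      ext a
      by_cases h : a = t.i <;> simp [h])) h
    rw [TransvectionStruct.det, hg1]
    exact (mul_left_cancel₀ (hne _ _ t.mul_inv) (h'.symm.trans (mul_one _).symm))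
  · rw [hmul, ihA, ihB, det_mul, hgmul]

/-- A function whose entrywise action is multiplicative on `SL_n`, `n ≥ 2`, is a ring
homomorphism. -/
theorem exists_ringHom_eq_of_map_mul {F : Type*} [Field F] {m : ℕ} (g : F → F)
    (h0 : g 0 = 0) (h1 : g 1 = 1)
    (hmul : ∀ A B : Matrix (Fin (m + 2)) (Fin (m + 2)) F, A.det = 1 → B.det = 1 →
      (A * B).map g = A.map g * B.map g) :
    ∃ φ : F →+* F, ∀ x, φ x = g x := by
  have h01 : (0 : Fin (m + 2)) ≠ 1 := by simp
  have hmap : ∀ i j : Fin (m + 2), i ≠ j → ∀ x,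
      (transvection i j x).map g = transvection i j (g x) := by
    intro i j hij x
    ext a b
    simp only [transvection, map_apply, Matrix.add_apply, one_apply, single_apply]
    grind
  have key : ∀ x y, g (1 + x * y) = 1 + g x * g y := by
    intro x y
    have h := congrFun₂ (hmul (transvection 0 1 x) (transvection 1 0 y)
      (det_transvection_of_ne _ _ h01 _) (det_transvection_of_ne _ _ h01.symm _)) 0 0
    rw [hmap _ _ h01, hmap _ _ h01.symm, map_apply, transvection_mul_apply_same,
      transvection_mul_apply_same] at h
    simpa [transvection, single_apply] using h
  have hsucc : ∀ x, g (1 + x) = 1 + g x := fun x => by simpa [h1] using key x 1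
  have hgmul : ∀ x y, g (x * y) = g x * g y := fun x y =>
    add_left_cancel ((hsucc _).symm.trans (key x y))
  refine ⟨⟨⟨⟨g, h1⟩, hgmul⟩, h0, fun a b => ?_⟩, fun _ => rfl⟩
  change g (a + b) = g a + g b
  by_cases ha : a = 0
  · simp [ha, h0]
  · rw [show a + b = a * (1 + a⁻¹ * b) by field_simp, hgmul, hsucc, mul_add, mul_one, ← hgmul,
      mul_inv_cancel_left₀ ha]

/-- The diagonal idempotent projecting onto the coordinates in `S`. -/
def coordProj (F : Type*) [Field F] {n : ℕ} (S : Finset (Fin n)) : Matrix (Fin n) (Fin n) F :=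
  diagonal fun i => if i ∈ S then 1 else 0

theorem coordProj_mul {F : Type*} [Field F] {n : ℕ} (S T : Finset (Fin n)) :
    coordProj F S * coordProj F T = coordProj F (S ∩ T) := by
  rw [coordProj, coordProj, diagonal_mul_diagonal, coordProj]
  congr 1
  ext i
  by_cases i ∈ S <;> by_cases i ∈ T <;> simp [*]

theorem exists_mul_coordProj_mul {F : Type*} [Field F] {n : ℕ} {S T : Finset (Fin n)}
    (h : S.card = T.card) : ∃ P Q, coordProj F S = P * coordProj F T * Q := by
  obtain ⟨σ, rfl⟩ := Equiv.Perm.exists_map_finset_eq S T h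
  refine ⟨σ.permMatrix F, σ.symm.toPEquiv.toMatrix, ?_⟩
  ext a b
  simp [PEquiv.toMatrix_toPEquiv_mul, PEquiv.mul_toMatrix_toPEquiv, coordProj, diagonal_apply]

/-- A non-degenerate multiplicative map vanishes on diagonal matrices of rank below some
`k ∈ {1, n - 1}` and on no coordinate projection of rank `k`. -/
theorem exists_rank_threshold {F : Type*} [Field F] [DecidableEq F] {m : ℕ}
    (Φ : Matrix (Fin (m + 2)) (Fin (m + 2)) F → Matrix (Fin (m + 2)) (Fin (m + 2)) F)
    (hmul : ∀ A B, Φ (A * B) = Φ A * Φ B) (h0 : Φ 0 = 0)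
    (hnondeg : ∃ A, A.det = 0 ∧ Φ A ≠ 0) :
    ∃ k, (k = 1 ∨ k = m + 1) ∧
      (∀ d : Fin (m + 2) → F, (Finset.univ.filter fun i => d i ≠ 0).card < k →
        Φ (diagonal d) = 0) ∧
      ∀ S, S.card = k → Φ (coordProj F S) ≠ 0 := by
  have hsupp : ∀ d : Fin (m + 2) → F, Φ (diagonal d) ≠ 0 →
      Φ (coordProj F (Finset.univ.filter fun i => d i ≠ 0)) ≠ 0 := by
    intro d hd h
    apply hd
    rw [show diagonal d = diagonal d * coordProj F (Finset.univ.filter fun i => d i ≠ 0) by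
      rw [coordProj, diagonal_mul_diagonal]
      congr 1
      ext i
      by_cases h : d i = 0 <;> simp [h], hmul, h, mul_zero]
  have hex : ∃ k, ∃ S, S.card = k ∧ k ≤ m + 1 ∧ Φ (coordProj F S) ≠ 0 := by
    obtain ⟨A, hA, hΦA⟩ := hnondeg
    obtain ⟨L, L', D, rfl⟩ := Pivot.exists_list_transvec_mul_diagonal_mul_list_transvec A
    have hD : Φ (diagonal D) ≠ 0 := by
      intro h
      apply hΦA
      rw [hmul, hmul, h, mul_zero, zero_mul]
    have hdet : ∏ i, D i = 0 := by simpa using hA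
    obtain ⟨i, -, hi⟩ := Finset.prod_eq_zero_iff.mp hdet
    refine ⟨_, _, rfl, ?_, hsupp D hD⟩
    have : (Finset.univ.filter fun i => D i ≠ 0).card < (Finset.univ : Finset (Fin (m + 2))).card :=
      Finset.card_lt_card (Finset.filter_ssubset.mpr ⟨i, Finset.mem_univ i, by simpa using hi⟩)
    simp only [Finset.card_univ, Fintype.card_fin] at this
    omega
  obtain ⟨S₀, hS₀, hle, hne₀⟩ := Nat.find_spec hex
  have hmin : ∀ S : Finset (Fin (m + 2)), S.card < Nat.find hex → Φ (coordProj F S) = 0 := by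
    intro S hS
    by_contra h
    exact Nat.find_min hex hS ⟨S, rfl, by omega, h⟩
  have hall : ∀ S, S.card = Nat.find hex → Φ (coordProj F S) ≠ 0 := by
    intro S hS h
    obtain ⟨P, Q, hPQ⟩ := exists_mul_coordProj_mul (F := F) (hS₀.trans hS.symm)
    apply hne₀
    rw [hPQ, hmul, hmul, h, mul_zero, zero_mul]
  refine ⟨Nat.find hex, ?_, fun d hd => ?_, hall⟩
  · generalize Nat.find hex = k at *
    have hk : k ≠ 0 := by
      rintro rfl
      apply hne₀
      rw [Finset.card_eq_zero.mp hS₀, ← h0]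
      simp [coordProj]
    have hcard := card_le_of_orthogonal_idempotents
      (fun S : Finset.powersetCard k (Finset.univ : Finset (Fin (m + 2))) => Φ (coordProj F S.1))
      (fun S => hall _ (Finset.mem_powersetCard.mp S.2).2)
      (fun S => by rw [← hmul, coordProj_mul, Finset.inter_self])
      (fun S T hST => by
        rw [← hmul, coordProj_mul]
        refine hmin _ ?_
        have hS := (Finset.mem_powersetCard.mp S.2).2
        have hT := (Finset.mem_powersetCard.mp T.2).2
        refine (Finset.card_lt_card (Finset.ssubset_iff_subset_ne.mpr
          ⟨Finset.inter_subset_left, fun h => hST (Subtype.ext ?_)⟩)).trans_eq hS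
        exact Finset.eq_of_subset_of_card_le (Finset.inter_eq_left.mp h) (by rw [hS, hT]))
    rw [Fintype.card_coe, Finset.card_powersetCard, Finset.card_univ, Fintype.card_fin] at hcard
    by_contra! h
    have := lt_choose_of_two_le (n := m + 2) (k := k) (by omega) (by omega)
    omega
  · by_contra h
    exact hsupp d h (hmin _ hd)

/-- A multiplicative map that does not kill a system of matrix units is, up to conjugation, read
off from a single entry. -/
theorem exists_conj_apply_eq {F : Type*} [Field F] {m : ℕ}
    (Φ : Matrix (Fin (m + 2)) (Fin (m + 2)) F → Matrix (Fin (m + 2)) (Fin (m + 2)) F)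
    (hmul : ∀ A B, Φ (A * B) = Φ A * Φ B)
    (u : Fin (m + 2) → Fin (m + 2) → Matrix (Fin (m + 2)) (Fin (m + 2)) F)
    (humul : ∀ i j l, u i j * u j l = u i l)
    (huorth : ∀ i j k l, j ≠ k → Φ (u i j * u k l) = 0) (hne : ∃ i j, Φ (u i j) ≠ 0) :
    ∃ R : (Matrix (Fin (m + 2)) (Fin (m + 2)) F)ˣ,
      (∀ i j, R.val * Φ (u i j) * R⁻¹.val = single i j 1) ∧
      ∀ A i j, (R.val * Φ A * R⁻¹.val) i j =
        (R.val * Φ (u 0 i * A * u j 0) * R⁻¹.val) 0 0 := by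
  obtain ⟨R, hR⟩ := exists_conj_single_of_matrixUnits (fun i j => Φ (u i j))
    (fun i j l => by rw [← hmul, humul]) (fun i j k l h => by rw [← hmul, huorth i j k l h]) hne
  refine ⟨R, hR, fun A i j => ?_⟩
  have : (R.val * Φ (u 0 i * A * u j 0) * R⁻¹.val) =
      (R.val * Φ (u 0 i) * R⁻¹.val) * (R.val * Φ A * R⁻¹.val) * (R.val * Φ (u j 0) * R⁻¹.val) := by
    simp only [hmul, mul_assoc, Units.inv_mul_cancel_left]
  rw [this, hR, hR]
  simp

/-- The matrix `0 ⊕ B`. -/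
def cornerEmb {F : Type*} [Field F] {n : ℕ} (B : Matrix (Fin n) (Fin n) F) :
    Matrix (Fin (n + 1)) (Fin (n + 1)) F :=
  Matrix.of (Fin.cons 0 fun i => Fin.cons 0 (B i))

section cornerEmb

variable {F : Type*} [Field F] {n : ℕ}

@[simp]
theorem cornerEmb_zero_left (B : Matrix (Fin n) (Fin n) F) (j) : cornerEmb B 0 j = 0 := by
  simp [cornerEmb]

@[simp]
theorem cornerEmb_zero_right (B : Matrix (Fin n) (Fin n) F) (i) : cornerEmb B i 0 = 0 := by
  cases i using Fin.cases <;> simp [cornerEmb]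

@[simp]
theorem cornerEmb_succ_succ (B : Matrix (Fin n) (Fin n) F) (i j) :
    cornerEmb B i.succ j.succ = B i j := by
  simp [cornerEmb]

theorem cornerEmb_mul (A B : Matrix (Fin n) (Fin n) F) :
    cornerEmb (A * B) = cornerEmb A * cornerEmb B := by
  ext i j
  cases i using Fin.cases <;> cases j using Fin.cases <;>
    simp [Matrix.mul_apply, Fin.sum_univ_succ]

theorem cornerEmb_diagonal (d : Fin n → F) :
    cornerEmb (diagonal d) = diagonal (Fin.cons 0 d : Fin (n + 1) → F) := by
  ext i j
  cases i using Fin.cases <;> cases j using Fin.cases <;>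
    simp [diagonal_apply, Fin.succ_ne_zero, (Fin.succ_ne_zero _).symm]

theorem cornerEmb_one_mul_mul (A : Matrix (Fin (n + 1)) (Fin (n + 1)) F) :
    cornerEmb 1 * A * cornerEmb 1 = cornerEmb (A.submatrix Fin.succ Fin.succ) := by
  have h : (cornerEmb 1 : Matrix (Fin (n + 1)) (Fin (n + 1)) F) =
      diagonal (Fin.cons 0 1 : Fin (n + 1) → F) := by
    rw [← cornerEmb_diagonal, ← diagonal_one]
    rfl
  rw [h]
  ext i j
  cases i using Fin.cases <;> cases j using Fin.cases <;> simp

theorem cornerEmb_one :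
    (cornerEmb 1 : Matrix (Fin (n + 1)) (Fin (n + 1)) F) = coordProj F (Finset.univ.erase 0) := by
  ext i j
  cases i using Fin.cases <;> cases j using Fin.cases <;>
    simp [coordProj, diagonal_apply, one_apply]

end cornerEmb

theorem adjugate_of_mul_self_eq_one {F : Type*} [Field F] {n : ℕ} {A : Matrix (Fin n) (Fin n) F}
    (h : A * A = 1) : A.adjugate = A.det • A := by
  calc A.adjugate = A.adjugate * A * A := by rw [mul_assoc, h, mul_one]
    _ = _ := by rw [adjugate_mul, smul_mul_assoc, one_mul]

theorem det_swap_mul_self {F : Type*} [Field F] {n : ℕ} (i j : Fin n) :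
    (swap F i j).det * (swap F i j).det = 1 := by
  rw [← det_mul, swap_mul_self, det_one]

theorem det_submatrix_succ_swap_mul_mul_swap {F : Type*} [Field F] {n : ℕ}
    (A : Matrix (Fin (n + 1)) (Fin (n + 1)) F) (i j : Fin (n + 1)) :
    ((swap F 0 i * A * swap F 0 j).submatrix Fin.succ Fin.succ).det =
      (swap F 0 i).det * A.adjugateᵀ i j * (swap F 0 j).det := by
  have h := adjugate_fin_succ_eq_det_submatrix (swap F 0 i * A * swap F 0 j) 0 0
  simp only [Fin.val_zero, add_zero, pow_zero, one_mul, Fin.succAbove_zero] at h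
  rw [← h, adjugate_mul_distrib, adjugate_mul_distrib,
    adjugate_of_mul_self_eq_one (swap_mul_self _ _),
    adjugate_of_mul_self_eq_one (swap_mul_self _ _)]
  simp [← mul_assoc]
  ring

/-- A multiplicative map that does not vanish on rank-one matrices is, up to conjugation, the
entrywise action of a ring homomorphism. -/
theorem exists_map_of_single_ne_zero {F : Type*} [Field F] {m : ℕ}
    (Φ : Matrix (Fin (m + 2)) (Fin (m + 2)) F → Matrix (Fin (m + 2)) (Fin (m + 2)) F)
    (hmul : ∀ A B, Φ (A * B) = Φ A * Φ B) (h0 : Φ 0 = 0) (h1 : Φ 1 = 1)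
    (hne : Φ (single 0 0 1) ≠ 0) :
    ∃ (φ : F →+* F) (R : (Matrix (Fin (m + 2)) (Fin (m + 2)) F)ˣ),
      ∀ A, Φ A = R⁻¹.val * A.map φ * R.val := by
  obtain ⟨R, -, hR⟩ := exists_conj_apply_eq Φ hmul (fun i j => single i j 1)
    (fun i j l => by simp) (fun i j k l h => by simp [h, h0]) ⟨0, 0, hne⟩
  obtain ⟨g, hg⟩ : ∃ g : F → F, ∀ x, g x = (R.val * Φ (single 0 0 x) * R⁻¹.val) 0 0 :=
    ⟨_, fun _ => rfl⟩
  have hΦ : ∀ A, R.val * Φ A * R⁻¹.val = A.map g := by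
    intro A
    ext i j
    rw [hR, map_apply, hg, single_mul_mul_single, one_mul, mul_one]
  have hg1 : g 1 = 1 := by
    simpa [h1] using (congrFun₂ (hΦ 1) 0 0).symm
  have hg0 : g 0 = 0 := by
    simpa [h0] using (congrFun₂ (hΦ 0) 0 0).symm
  obtain ⟨φ, hφ⟩ := exists_ringHom_eq_of_map_mul g hg0 hg1 (m := m) (fun A B _ _ => by
    rw [← hΦ, ← hΦ, ← hΦ, hmul]
    simp only [mul_assoc, Units.inv_mul_cancel_left])
  obtain rfl : ⇑φ = g := funext hφ
  refine ⟨φ, R, fun A => ?_⟩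
  rw [← hΦ]
  simp [mul_assoc]

/-- A multiplicative map whose smallest rank with nonzero image is `n - 1` is, up to conjugation,
the cofactor map composed with the entrywise action of a ring homomorphism. -/
theorem exists_cofactor_of_vanishing {F : Type*} [Field F] [CharZero F] [DecidableEq F] {m : ℕ}
    (Φ : Matrix (Fin (m + 2)) (Fin (m + 2)) F → Matrix (Fin (m + 2)) (Fin (m + 2)) F)
    (hmul : ∀ A B, Φ (A * B) = Φ A * Φ B)
    (hvanish : ∀ d : Fin (m + 2) → F, (Finset.univ.filter fun i => d i ≠ 0).card < m + 1 →
        Φ (diagonal d) = 0)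
    (hne : Φ (cornerEmb 1) ≠ 0) :
    ∃ (φ : F →+* F) (R : (Matrix (Fin (m + 2)) (Fin (m + 2)) F)ˣ),
      ∀ A, Φ A = R⁻¹.val * (A.map φ).adjugateᵀ * R.val := by
  have hsing : ∀ B : Matrix (Fin (m + 1)) (Fin (m + 1)) F, B.det = 0 → Φ (cornerEmb B) = 0 := by
    intro B hB
    obtain ⟨L, L', D, rfl⟩ := Pivot.exists_list_transvec_mul_diagonal_mul_list_transvec B
    have hdet : ∏ i, D i = 0 := by simpa using hB
    obtain ⟨i, -, hi⟩ := Finset.prod_eq_zero_iff.mp hdet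
    rw [cornerEmb_mul, cornerEmb_mul, hmul, hmul, cornerEmb_diagonal, hvanish, mul_zero, zero_mul]
    have : (Finset.univ.filter fun j => (Fin.cons 0 D : Fin (m + 2) → F) j ≠ 0) ⊆
        (Finset.univ.erase 0).erase i.succ := by
      intro j
      cases j using Fin.cases with
      | zero => simp
      | succ j =>
        simp only [Finset.mem_filter, Finset.mem_univ, true_and, Fin.cons_succ, Finset.mem_erase,
          ne_eq, Fin.succ_inj, and_true, Fin.succ_ne_zero, not_false_eq_true]
        rintro h rfl
        exact h hi
    refine (Finset.card_le_card this).trans_lt ?_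
    simp [Finset.card_erase_of_mem, Fin.succ_ne_zero]
  let u : Fin (m + 2) → Fin (m + 2) → Matrix (Fin (m + 2)) (Fin (m + 2)) F :=
    fun i j => swap F 0 i * cornerEmb 1 * swap F 0 j
  have hS0 : swap F (0 : Fin (m + 2)) 0 = 1 := by simp [swap]
  have hGG : (cornerEmb 1 * cornerEmb 1 : Matrix (Fin (m + 2)) (Fin (m + 2)) F) = cornerEmb 1 := by
    rw [← cornerEmb_mul, one_mul]
  have huu : ∀ i j k l, u i j * u k l =
      swap F 0 i * (cornerEmb 1 * (swap F 0 j * 1 * swap F 0 k) * cornerEmb 1) * swap F 0 l :=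
    fun i j k l => by simp only [u, mul_assoc, mul_one]
  obtain ⟨R, hRu, hR⟩ := exists_conj_apply_eq Φ hmul u
    (fun i j l => by
      rw [huu, mul_one, swap_mul_self, mul_one, hGG])
    (fun i j k l h => by
      rw [huu, cornerEmb_one_mul_mul, hmul, hmul, hsing, mul_zero, zero_mul]
      rw [det_submatrix_succ_swap_mul_mul_swap]
      simp [one_apply, h.symm])
    ⟨0, 0, by simpa only [u, hS0, one_mul, mul_one] using hne⟩
  have hu00 : u 0 0 = cornerEmb 1 := by simp only [u, hS0, one_mul, mul_one]
  let Ψ : Matrix (Fin (m + 2)) (Fin (m + 2)) F → Matrix (Fin (m + 2)) (Fin (m + 2)) F :=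
    fun A => R.val * Φ A * R⁻¹.val
  have hΨmul : ∀ A B, Ψ (A * B) = Ψ A * Ψ B := fun A B => by
    simp only [Ψ, hmul, mul_assoc, Units.inv_mul_cancel_left]
  have hΨG : Ψ (cornerEmb 1) = single 0 0 1 := hu00 ▸ hRu 0 0
  have hΨ : ∀ B, Ψ (cornerEmb B) = single 0 0 (Ψ (cornerEmb B) 0 0) := by
    intro B
    conv_lhs => rw [← one_mul B, ← mul_one (1 * B), cornerEmb_mul, cornerEmb_mul, hΨmul, hΨmul,
      hΨG, single_mul_mul_single, one_mul, mul_one]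
  obtain ⟨g, hg⟩ := exists_eq_comp_det (m := m) (fun B => Ψ (cornerEmb B) 0 0)
    (fun A B => by
      rw [cornerEmb_mul, hΨmul, hΨ A, hΨ B]
      simp)
    (by simp [hΨG])
    (fun B hB => by simp [Ψ, hsing B hB])
  let D : Matrix (Fin (m + 2)) (Fin (m + 2)) F := diagonal fun i => (swap F 0 i).det
  have hDD : D * D = 1 := by
    simp only [D, diagonal_mul_diagonal, det_swap_mul_self, diagonal_one]
  have hΨg : ∀ A, Ψ A = (D * A.adjugateᵀ * D).map g := by
    intro A
    ext i j
    have : u 0 i * A * u j 0 =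
        cornerEmb ((swap F 0 i * A * swap F 0 j).submatrix Fin.succ Fin.succ) := by
      rw [← cornerEmb_one_mul_mul]
      simp only [u, hS0, mul_assoc, one_mul, mul_one]
    rw [show Ψ A i j = _ from hR A i j, this]
    refine (hg _).trans ?_
    rw [det_submatrix_succ_swap_mul_mul_swap, map_apply, mul_diagonal, diagonal_mul]
  have hg1 : g 1 = 1 := by
    have := hg 1
    rw [det_one] at this
    simp [← this, hΨG]
  have hg0 : g 0 = 0 := by
    have := hg 0
    rw [det_zero] at this
    simp [← this, Ψ, hsing 0 (det_zero)]
  have hcof : ∀ M : Matrix (Fin (m + 2)) (Fin (m + 2)) F, M.det = 1 →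
      ∃ A : Matrix (Fin (m + 2)) (Fin (m + 2)) F, D * A.adjugateᵀ * D = M := by
    intro M hM
    have hDt : Dᵀ = D := diagonal_transpose _
    have hdet : D.det * D.det = 1 := by rw [← det_mul, hDD, det_one]
    refine ⟨D * M.adjugateᵀ * D, ?_⟩
    rw [adjugate_mul_distrib, adjugate_mul_distrib, adjugate_of_mul_self_eq_one hDD,
      adjugate_transpose, adjugate_adjugate _ (by simp), det_transpose, hM, one_pow, one_smul]
    simp only [transpose_mul, transpose_transpose, hDt, smul_mul_assoc,
      mul_smul_comm, smul_smul, hdet, one_smul]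
    calc D * (D * M * D) * D = (D * D) * M * (D * D) := by simp only [mul_assoc]
      _ = M := by rw [hDD, one_mul, mul_one]
  have hcofmul : ∀ A B : Matrix (Fin (m + 2)) (Fin (m + 2)) F,
      D * (A * B).adjugateᵀ * D = (D * A.adjugateᵀ * D) * (D * B.adjugateᵀ * D) := by
    intro A B
    rw [adjugate_mul_distrib, transpose_mul]
    calc _ = D * (A.adjugateᵀ * 1 * B.adjugateᵀ) * D := by rw [mul_one]
      _ = _ := by rw [← hDD]; simp only [mul_assoc]
  obtain ⟨φ, hφ⟩ := exists_ringHom_eq_of_map_mul g hg0 hg1 (m := m) (fun M N hM hN => by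
    obtain ⟨A, rfl⟩ := hcof M hM
    obtain ⟨B, rfl⟩ := hcof N hN
    rw [← hcofmul, ← hΨg, ← hΨg, ← hΨg, hΨmul])
  obtain rfl : ⇑φ = g := funext hφ
  have hDφ : D.map φ * D.map φ = 1 := by
    rw [← Matrix.map_mul, hDD, Matrix.map_one _ (map_zero φ) (map_one φ)]
  let E : (Matrix (Fin (m + 2)) (Fin (m + 2)) F)ˣ := ⟨D.map φ, D.map φ, hDφ, hDφ⟩
  refine ⟨φ, E * R, fun A => ?_⟩
  have hadj : (A.map φ).adjugateᵀ = (A.adjugateᵀ).map φ := by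
    rw [transpose_map, ← RingHom.mapMatrix_apply, ← RingHom.mapMatrix_apply, RingHom.map_adjugate]
  have h : R.val * Φ A * R⁻¹.val = E.val * (A.map φ).adjugateᵀ * E⁻¹.val := by
    rw [hadj]
    change Ψ A = D.map φ * _ * D.map φ
    rw [hΨg, Matrix.map_mul, Matrix.map_mul]
  have hE : E⁻¹ = E := rfl
  calc Φ A = R⁻¹.val * (R.val * Φ A * R⁻¹.val) * R.val := by simp [mul_assoc]
    _ = _ := by rw [h, _root_.mul_inv_rev, hE]; simp only [Units.val_mul, mul_assoc]

end

/-- Classification of non-degenerate multiplicative maps on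
`M_n(F)`, `n ≥ 2`: `Φ(A) = R⁻¹ (φ(a_ij)) R` or `Φ(A) = R⁻¹ (adj(φ(a_ij)))ᵀ R`
for a ring homomorphism `φ : F → F` and some invertible `R`. -/
theorem classification_of_nondegenerate_multiplicative_maps {F : Type*} [Field F]
    [CharZero F] {n : ℕ} (hn : 2 ≤ n)
    (Φ : Matrix (Fin n) (Fin n) F → Matrix (Fin n) (Fin n) F)
    (hmul : ∀ A B, Φ (A * B) = Φ A * Φ B)
    (h0 : Φ 0 = 0) (h1 : Φ 1 = 1)
    (hnondeg : ∃ A : Matrix (Fin n) (Fin n) F, A.det = 0 ∧ Φ A ≠ 0) :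
    ∃ (φ : F →+* F) (R : (Matrix (Fin n) (Fin n) F)ˣ),
      (∀ A : Matrix (Fin n) (Fin n) F,
        Φ A = ((R⁻¹ : (Matrix (Fin n) (Fin n) F)ˣ) : Matrix (Fin n) (Fin n) F) *
          A.map φ * (R : Matrix (Fin n) (Fin n) F)) ∨
      (∀ A : Matrix (Fin n) (Fin n) F,
        Φ A = ((R⁻¹ : (Matrix (Fin n) (Fin n) F)ˣ) : Matrix (Fin n) (Fin n) F) *
          (Matrix.adjugate (A.map φ)).transpose * (R : Matrix (Fin n) (Fin n) F)) := by
  classical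
  obtain ⟨m, rfl⟩ : ∃ m, n = m + 2 := ⟨n - 2, by omega⟩
  obtain ⟨k, hk, hvanish, hne⟩ := exists_rank_threshold Φ hmul h0 hnondeg
  rcases hk with rfl | rfl
  · have h : Matrix.single (0 : Fin (m + 2)) 0 (1 : F) = coordProj F {0} := by
      rw [← Matrix.diagonal_single, coordProj]
      congr 1
      ext i
      simp [Pi.single_apply]
    obtain ⟨φ, R, hR⟩ := exists_map_of_single_ne_zero Φ hmul h0 h1 (h ▸ hne {0} rfl)
    exact ⟨φ, R, Or.inl hR⟩
  · obtain ⟨φ, R, hR⟩ := exists_cofactor_of_vanishing Φ hmul hvanish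
      (cornerEmb_one (F := F) ▸ hne _ (by simp))
    exact ⟨φ, R, Or.inr hR⟩
end
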